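/- Let u ≥ 2 and let F be a fixed nice u-graph with r = v(F) ≥ 4 vertices and s = e(F) edges, and fix g = g(n) with g(n) → ∞ and g(n) = o(log n/log log n). There exists a constant δ = δ(F) > 0 such that, with π_+ = (aut(F)/r!)·(log n + g(n))/binom(n−1,r−1) and p_+ = (π_+/(1−n^{−δ}))^{1/s}, for every n there is a coupling of the random u-graph G = H_u(n,p_+) and the random F-graph H = H_F(n,π_+) such that, with probability tending to 1 as n → ∞: (i) every F-edge of H is present as a subgraph (copy of F) in G; and (ii) no vertex whose degree in H is at most 7g(n) is contained in the vertex set of an extra copy of F in G, where an extra copy is a copy of F on [n] that is a subgraph of G but whose corresponding F-edge is not in H. -/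

import Mathlib

open Classical Filter Asymptotics MeasureTheory
open scoped ENNReal

noncomputable section

/-- The type of potential `F`-edges on vertex set `Fin n`: a pair consisting of the
`r`-element vertex set of the copy and the `u`-edge set of the copy. -/
abbrev FE (n : ℕ) := Finset (Fin n) × Finset (Finset (Fin n))

/-- `F` (a `u`-graph on `Fin r`) is strictly 1-balanced: every proper subgraph `(V', E')`
with more than one vertex has strictly smaller 1-density, i.e.
`e'/(v'-1) < e(F)/(r-1)`, written multiplicatively. -/
def StrictlyOneBalanced {r : ℕ} (F : Finset (Finset (Fin r))) : Prop :=
  ∀ (V' : Finset (Fin r)) (E' : Finset (Finset (Fin r))),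
    E' ⊆ F → (∀ e ∈ E', e ⊆ V') → 1 < V'.card → ¬(V' = Finset.univ ∧ E' = F) →
      E'.card * (r - 1) < F.card * (V'.card - 1)

/-- After deleting the vertices in `S`, the hypergraph `F` is connected. -/
def ConnectedAvoiding {r : ℕ} (F : Finset (Finset (Fin r))) (S : Finset (Fin r)) : Prop :=
  ∀ x y : Fin r, x ∉ S → y ∉ S →
    Relation.ReflTransGen (fun a b => ∃ e ∈ F, Disjoint e S ∧ a ∈ e ∧ b ∈ e) x y

/-- `F` is 3-connected: at least 4 vertices, and no set of at most 2 vertices disconnects it. -/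
def ThreeConnected {r : ℕ} (F : Finset (Finset (Fin r))) : Prop :=
  4 ≤ r ∧ ∀ S : Finset (Fin r), S.card ≤ 2 → ConnectedAvoiding F S

/-- Two edge sets on `Fin r` are isomorphic via a permutation of the vertices. -/
def EdgeIso {r : ℕ} (F F' : Finset (Finset (Fin r))) : Prop :=
  ∃ σ : Equiv.Perm (Fin r), F.image (fun e => e.image (fun x => σ x)) = F'

/-- `F` is nice: strictly 1-balanced, 3-connected and either `u ≥ 3` or `u = 2` and `F`
cannot be transformed into an isomorphic graph by adding one edge and deleting one edge. -/
def Nice {r : ℕ} (u : ℕ) (F : Finset (Finset (Fin r))) : Prop :=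
  StrictlyOneBalanced F ∧ ThreeConnected F ∧
    (3 ≤ u ∨ (u = 2 ∧ ¬ ∃ a b : Finset (Fin r), a.card = u ∧ a ∉ F ∧ b ∈ F ∧
      EdgeIso (insert a (F.erase b)) F))

/-- `h` is an `F`-edge on `[n]`: a copy of `F`, recorded as its (`r`-element) vertex set
together with its `u`-edge set. -/
def IsFEdge {r : ℕ} (F : Finset (Finset (Fin r))) (n : ℕ) (h : FE n) : Prop :=
  ∃ φ : Fin r ↪ Fin n, h.1 = Finset.univ.map φ ∧ h.2 = F.image (fun e => e.map φ)

/-- All possible `F`-edges on `[n]`. -/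
def allFEdges {r : ℕ} (F : Finset (Finset (Fin r))) (n : ℕ) : Finset (FE n) :=
  Finset.univ.filter (fun h => IsFEdge F n h)

/-- `M`, the total number of `F`-edges on `[n]`. -/
def Mnum {r : ℕ} (F : Finset (Finset (Fin r))) (n : ℕ) : ℕ := (allFEdges F n).card

/-- All `u`-element subsets of `[n]`. -/
def allUEdges (u n : ℕ) : Finset (Finset (Fin n)) :=
  Finset.univ.filter (fun e : Finset (Fin n) => e.card = u)

/-- The number of automorphisms of `F`. -/
def autCard {r : ℕ} (F : Finset (Finset (Fin r))) : ℕ :=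
  Fintype.card {σ : Equiv.Perm (Fin r) // F.image (fun e => e.image (fun x => σ x)) = F}

/-- The degree of a vertex `v` in an `F`-graph `H`. -/
def degFE {n : ℕ} (H : Finset (FE n)) (v : Fin n) : ℕ :=
  (H.filter (fun h => v ∈ h.1)).card

/-- Two `F`-edges are partners if their vertex sets share exactly `u` vertices. -/
def Partner (u : ℕ) {n : ℕ} (h h' : FE n) : Prop :=
  h ≠ h' ∧ (h.1 ∩ h'.1).card = u

/-- The state at time `t` of the process induced by the ordering `f`. -/
def proc {α : Type*} [DecidableEq α] {m : ℕ} (f : Fin m → α) (t : ℕ) : Finset α :=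
  (Finset.univ.filter (fun i : Fin m => (i : ℕ) < t)).image f

/-- A valid ordering of all `u`-element subsets of `[n]`. -/
def ValidOrdU (u n : ℕ) (f : Fin (Nat.choose n u) → Finset (Fin n)) : Prop :=
  Function.Injective f ∧ ∀ e : Finset (Fin n), e.card = u → ∃ i, f i = e

/-- A valid ordering of all `r`-element subsets of `[n]`. -/
def ValidOrdR (r n : ℕ) (f : Fin (Nat.choose n r) → Finset (Fin n)) : Prop :=
  Function.Injective f ∧ ∀ e : Finset (Fin n), e.card = r → ∃ i, f i = e

/-- A valid ordering of all `F`-edges on `[n]`. -/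
def ValidOrdH {r : ℕ} (F : Finset (Finset (Fin r))) (n : ℕ)
    (f : Fin (Mnum F n) → FE n) : Prop :=
  Function.Injective f ∧ ∀ h : FE n, IsFEdge F n h → ∃ i, f i = h

/-- `T_H`: the first time at which the `F`-graph process has no isolated vertices. -/
def THit {r : ℕ} (F : Finset (Finset (Fin r))) (n : ℕ) (f : Fin (Mnum F n) → FE n) : ℕ :=
  sInf {t : ℕ | ∀ v : Fin n, ∃ h ∈ proc f t, v ∈ h.1}

/-- `T_E`: the first time at which the `r`-uniform hypergraph process has no isolated
vertices. -/
def TEHit (r n : ℕ) (f : Fin (Nat.choose n r) → Finset (Fin n)) : ℕ :=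
  sInf {t : ℕ | ∀ v : Fin n, ∃ e ∈ proc f t, v ∈ e}

/-- `T_G`: the first time at which every vertex of `[n]` lies in a copy of `F` in the
`u`-graph process. -/
def TGHit (u : ℕ) {r : ℕ} (F : Finset (Finset (Fin r))) (n : ℕ)
    (f : Fin (Nat.choose n u) → Finset (Fin n)) : ℕ :=
  sInf {t : ℕ | ∀ v : Fin n, ∃ h : FE n, IsFEdge F n h ∧ v ∈ h.1 ∧ h.2 ⊆ proc f t}

/-- The random variable `X` is uniformly distributed over `{a | P a}` under `μ`. -/
def UniformOn {Ω α : Type*} (μ : PMF Ω) (X : Ω → α) (P : α → Prop) : Prop :=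
  μ.toOuterMeasure {ω | P (X ω)} = 1 ∧
    ∀ a b : α, P a → P b →
      μ.toOuterMeasure {ω | X ω = a} = μ.toOuterMeasure {ω | X ω = b}

/-- Under `μ`, the random set `X` contains each element of `all` independently with
probability `p` (a Bernoulli product / binomial random subset distribution). -/
def BernoulliVia {Ω E : Type*} (μ : PMF Ω) (X : Ω → Finset E)
    (all : Finset E) (p : ℝ) : Prop :=
  ∀ A : Finset E, μ.toOuterMeasure {ω | X ω = A} =
    if A ⊆ all then ENNReal.ofReal (p ^ A.card * (1 - p) ^ (all.card - A.card)) else 0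

/-- The function `g` tends to infinity and is `o(log n / log log n)`. -/
def GoodG (g : ℕ → ℝ) : Prop :=
  Tendsto g atTop atTop ∧ g =o[atTop] fun n : ℕ => Real.log n / Real.log (Real.log n)

/-- `π₊`, the probability at the end of the critical window. -/
def piPlus {r : ℕ} (F : Finset (Finset (Fin r))) (g : ℕ → ℝ) (n : ℕ) : ℝ :=
  ((autCard F : ℝ) / (Nat.factorial r : ℝ)) *
    ((Real.log n + g n) / ((n - 1).choose (r - 1) : ℝ))

/-- `π₋`, the probability at the start of the critical window. -/
def piMinus {r : ℕ} (F : Finset (Finset (Fin r))) (g : ℕ → ℝ) (n : ℕ) : ℝ :=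
  ((autCard F : ℝ) / (Nat.factorial r : ℝ)) *
    ((Real.log n - g n) / ((n - 1).choose (r - 1) : ℝ))

/-- `p₊ = (π₊/(1-n^{-δ}))^{1/s}` where `s = e(F)`. -/
def pPlus {r : ℕ} (F : Finset (Finset (Fin r))) (g : ℕ → ℝ) (δ : ℝ) (n : ℕ) : ℝ :=
  (piPlus F g n / (1 - (n : ℝ) ^ (-δ))) ^ ((1 : ℝ) / (F.card : ℝ))

/-- Connectivity (as a multihypergraph of vertex sets) of a set of `F`-edges. -/
def ConnFE {n : ℕ} (S : Finset (FE n)) : Prop :=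
  ∀ a ∈ S, ∀ b ∈ S,
    Relation.ReflTransGen (fun x y : FE n => x ∈ S ∧ y ∈ S ∧ (x.1 ∩ y.1).Nonempty) a b

/-- The multihypergraph of vertex sets of the `F`-edges of `H` contains an avoidable
configuration: a connected `S ⊆ H` with nullity `(r-1)e(S)+1-v(S) > 1` and
`e(S) ≤ 2^(r+1)`. -/
def HasAvoidable (r : ℕ) {n : ℕ} (H : Finset (FE n)) : Prop :=
  ∃ S ⊆ H, S.Nonempty ∧ ConnFE S ∧
    (S.sup Prod.fst).card < (r - 1) * S.card ∧ S.card ≤ 2 ^ (r + 1)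

/-- `G` contains an `F`-factor: pairwise vertex-disjoint copies of `F`, each a subgraph
of `G`, whose vertex sets partition `[n]`. -/
def HasFFactor {r : ℕ} (F : Finset (Finset (Fin r))) (n : ℕ)
    (G : Finset (Finset (Fin n))) : Prop :=
  ∃ C : Finset (FE n), (∀ h ∈ C, IsFEdge F n h ∧ h.2 ⊆ G) ∧
    (∀ h ∈ C, ∀ h' ∈ C, h ≠ h' → Disjoint h.1 h'.1) ∧
    C.sup Prod.fst = Finset.univ ∧ C.card * r = n


/-! ### Bernoulli weights on finite sets -/

/-- Bernoulli product weight. -/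
def bw {E : Type*} [DecidableEq E] (all : Finset E) (p : ℝ) (A : Finset E) : ℝ :=
  if A ⊆ all then p ^ A.card * (1 - p) ^ (all.card - A.card) else 0

section bwsec
variable {E : Type*} [DecidableEq E] {all : Finset E} {p : ℝ}

theorem bw_nonneg (h0 : 0 ≤ p) (h1 : p ≤ 1) (A : Finset E) : 0 ≤ bw all p A := by
  unfold bw
  have : 0 ≤ 1 - p := by linarith
  split_ifs <;> positivity

theorem bw_mul (a b : Finset E) :
    bw all p a * bw all p b = bw all p (a ∩ b) * bw all p (a ∪ b) := by
  unfold bw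
  by_cases ha : a ⊆ all
  · by_cases hb : b ⊆ all
    · have h1 : a ∩ b ⊆ all := Finset.inter_subset_left.trans ha
      have h2 : a ∪ b ⊆ all := Finset.union_subset ha hb
      simp only [ha, hb, h1, h2, if_true]
      have e1 := Finset.card_inter_add_card_union a b
      have c1 := Finset.card_le_card ha
      have c2 := Finset.card_le_card hb
      have c3 := Finset.card_le_card h1
      have c4 := Finset.card_le_card h2
      have : p ^ a.card * (1 - p) ^ (all.card - a.card) * (p ^ b.card * (1 - p) ^ (all.card - b.card))
        = p ^ (a.card + b.card) * (1-p) ^ ((all.card - a.card) + (all.card - b.card)) := by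
        rw [pow_add, pow_add]; ring
      rw [this]
      have : p ^ (a ∩ b).card * (1 - p) ^ (all.card - (a ∩ b).card) *
          (p ^ (a ∪ b).card * (1 - p) ^ (all.card - (a ∪ b).card))
        = p ^ ((a ∩ b).card + (a ∪ b).card) *
          (1-p) ^ ((all.card - (a ∩ b).card) + (all.card - (a ∪ b).card)) := by
        rw [pow_add, pow_add]; ring
      rw [this, e1]
      congr 2
      omega
    · have h2 : ¬ a ∪ b ⊆ all := fun h => hb (Finset.subset_union_right.trans h)
      simp [hb, h2]
  · have h2 : ¬ a ∪ b ⊆ all := fun h => ha (Finset.subset_union_left.trans h)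
    simp [ha, h2]

variable [Fintype E]

/-- generating function of the intersection size -/
theorem bw_gen (B : Finset E) (hB : B ⊆ all) (x : ℝ) :
    ∑ A : Finset E, bw all p A * x ^ (A ∩ B).card = (1 - p + p * x) ^ B.card := by
  have h1 : ∏ e ∈ all, ((if e ∈ B then p * x else p) + (1 - p)) = (1 - p + p * x) ^ B.card := by
    rw [← Finset.prod_sdiff hB]
    have e1 : ∏ e ∈ all \ B, ((if e ∈ B then p * x else p) + (1 - p)) = 1 := by
      apply Finset.prod_eq_one
      intro e he
      rw [if_neg (Finset.mem_sdiff.1 he).2]; ring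
    have e2 : ∏ e ∈ B, ((if e ∈ B then p * x else p) + (1 - p)) = (1 - p + p * x) ^ B.card := by
      rw [← Finset.prod_const]
      apply Finset.prod_congr rfl
      intro e he
      rw [if_pos he]; ring
    rw [e1, e2, one_mul]
  rw [← h1, Finset.prod_add]
  have : ∑ A : Finset E, bw all p A * x ^ (A ∩ B).card
      = ∑ A ∈ all.powerset, bw all p A * x ^ (A ∩ B).card := by
    symm
    apply Finset.sum_subset (Finset.subset_univ _)
    intro A _ hA
    rw [Finset.mem_powerset] at hA
    simp [bw, hA]
  rw [this]
  apply Finset.sum_congr rfl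
  intro A hA
  rw [Finset.mem_powerset] at hA
  rw [Finset.prod_const, Finset.card_sdiff_of_subset hA, bw, if_pos hA]
  have : ∏ e ∈ A, (if e ∈ B then p * x else p) = p ^ A.card * x ^ (A ∩ B).card := by
    have : ∀ e ∈ A, (if e ∈ B then p * x else p) = p * (if e ∈ B then x else 1) := by
      intro e _; split_ifs <;> ring
    rw [Finset.prod_congr rfl this, Finset.prod_mul_distrib, Finset.prod_const,
      ← Finset.prod_filter, Finset.prod_const, Finset.filter_mem_eq_inter]
  rw [this]; ring

theorem bw_sum : ∑ A : Finset E, bw all p A = 1 := by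
  have := bw_gen (all := all) (p := p) ∅ (Finset.empty_subset _) 1
  simpa using this

/-- single element conditioning -/
theorem bw_cond_one (e : E) (he : e ∈ all) (f : Finset E → ℝ)
    (hf : ∀ A, f (insert e A) = f A) :
    ∑ A : Finset E, bw all p A * (if e ∈ A then f A else 0)
      = p * ∑ A : Finset E, bw all p A * f A := by
  have key : ∀ A : Finset E, e ∉ A → (1 - p) * bw all p (insert e A) = p * bw all p A := by
    intro A hA
    unfold bw
    by_cases h : A ⊆ all
    · have h' : insert e A ⊆ all := Finset.insert_subset he h
      rw [if_pos h, if_pos h', Finset.card_insert_of_notMem hA]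
      have := Finset.card_le_card h'
      rw [Finset.card_insert_of_notMem hA] at this
      have : all.card - A.card = (all.card - (A.card + 1)) + 1 := by omega
      rw [this, pow_succ, pow_succ]; ring
    · have h' : ¬ insert e A ⊆ all := fun hh => h ((Finset.subset_insert _ _).trans hh)
      simp [h, h']
  -- split
  have hin : ∑ A : Finset E, bw all p A * (if e ∈ A then f A else 0)
      = ∑ A ∈ Finset.univ.filter (fun A : Finset E => e ∉ A), bw all p (insert e A) * f A := by
    have : ∑ A : Finset E, bw all p A * (if e ∈ A then f A else 0)
       = ∑ A ∈ Finset.univ.filter (fun A : Finset E => e ∈ A), bw all p A * f A := by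
      rw [Finset.sum_filter]
      apply Finset.sum_congr rfl
      intro A _; split_ifs <;> simp
    rw [this]
    symm
    refine Finset.sum_bij' (fun A _ => insert e A) (fun A _ => A.erase e) ?_ ?_ ?_ ?_ ?_
    · intro A hA; simp
    · intro A hA; simp
    · intro A hA; simp at hA; simp [hA]
    · intro A hA; simp at hA; simp [Finset.insert_erase hA]
    · intro A hA; rw [hf]
  have hout : ∑ A : Finset E, bw all p A * f A
      = ∑ A : Finset E, bw all p A * (if e ∈ A then f A else 0)
      + ∑ A ∈ Finset.univ.filter (fun A : Finset E => e ∉ A), bw all p A * f A := by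
    rw [Finset.sum_filter, ← Finset.sum_add_distrib]
    apply Finset.sum_congr rfl
    intro A _; by_cases h : e ∈ A <;> simp [h]
  rw [hout, hin, mul_add]
  have : p * ∑ A ∈ Finset.univ.filter (fun A : Finset E => e ∉ A), bw all p A * f A
     = (1 - p) * ∑ A ∈ Finset.univ.filter (fun A : Finset E => e ∉ A), bw all p (insert e A) * f A := by
    rw [Finset.mul_sum, Finset.mul_sum]
    apply Finset.sum_congr rfl
    intro A hA
    rw [Finset.mem_filter] at hA
    rw [← mul_assoc, ← key A hA.2, mul_assoc]
  rw [this]; ring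

theorem bw_cond (K : Finset E) (hK : K ⊆ all) (f : Finset E → ℝ)
    (hf : ∀ e ∈ K, ∀ A, f (insert e A) = f A) :
    ∑ A : Finset E, bw all p A * (if K ⊆ A then f A else 0)
      = p ^ K.card * ∑ A : Finset E, bw all p A * f A := by
  induction K using Finset.induction_on generalizing f with
  | empty => simp
  | insert e K heK ih =>
    rw [Finset.card_insert_of_notMem heK]
    have h1 : ∀ A : Finset E, (if insert e K ⊆ A then f A else 0)
        = if e ∈ A then (if K ⊆ A then f A else 0) else 0 := by
      intro A
      by_cases h1 : e ∈ A <;> by_cases h2 : K ⊆ A <;> simp [h1, h2, Finset.insert_subset_iff]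
    simp only [h1]
    rw [bw_cond_one e (hK (Finset.mem_insert_self _ _)) (fun A => if K ⊆ A then f A else 0)]
    · rw [ih ((Finset.subset_insert _ _).trans hK) f
        (fun e' he' => hf e' (Finset.mem_insert_of_mem he'))]
      ring
    · intro A
      have : K ⊆ insert e A ↔ K ⊆ A := by
        constructor
        · intro h x hx
          rcases Finset.mem_insert.1 (h hx) with h' | h'
          · exact absurd (h' ▸ hx) heK
          · exact h'
        · exact fun h => h.trans (Finset.subset_insert _ _)
      simp only [this, hf e (Finset.mem_insert_self _ _)]

theorem bw_contains (K : Finset E) (hK : K ⊆ all) :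
    ∑ A : Finset E, bw all p A * (if K ⊆ A then 1 else 0) = p ^ K.card := by
  have := bw_cond (p := p) K hK (fun _ => 1) (fun _ _ _ => rfl)
  rw [this]; simp [bw_sum]

/-- Harris inequality, conditional on containing `R`:
increasing event `K ⊆ A` versus a decreasing event `D`. -/
theorem bw_harris (hp : 0 < p) (h1 : p ≤ 1) (R K : Finset E) (hR : R ⊆ all) (hK : K ⊆ all)
    (D : Finset E → Prop)
    (hD : ∀ A B, A ⊆ B → D B → D A) :
    ∑ A : Finset E, bw all p A * (if (R ⊆ A ∧ K ⊆ A) ∧ D A then 1 else 0)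
     ≤ p ^ (K \ R).card * ∑ A : Finset E, bw all p A * (if R ⊆ A ∧ D A then 1 else 0) := by
  have h0 := hp.le
  have hf := fkg (α := Finset E) (β := ℝ) (fun A => if K ⊆ A then 1 else 0)
    (fun A => if D A then 0 else 1) (fun A => bw all p A * (if R ⊆ A then 1 else 0))
    (fun A => mul_nonneg (bw_nonneg h0 h1 A) (by split_ifs <;> norm_num))
    (fun A => by simp only [Pi.zero_apply]; split_ifs <;> norm_num)
    (fun A => by simp only [Pi.zero_apply]; split_ifs <;> norm_num)
    (by
      intro A B hAB
      simp only
      split_ifs with a b b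
      · exact le_rfl
      · exact absurd (a.trans hAB) b
      · norm_num
      · norm_num)
    (by
      intro A B hAB
      simp only
      split_ifs with a b b
      · exact le_rfl
      · norm_num
      · exact absurd (hD _ _ hAB b) a
      · norm_num)
    (by
      intro A B
      have := bw_mul (all := all) (p := p) A B
      simp only [Finset.inf_eq_inter, Finset.sup_eq_union]
      have e : (if R ⊆ A then (1:ℝ) else 0) * (if R ⊆ B then (1:ℝ) else 0)
        ≤ (if R ⊆ A ∩ B then 1 else 0) * (if R ⊆ A ∪ B then 1 else 0) := by
        by_cases h1 : R ⊆ A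
        · by_cases h2 : R ⊆ B
          · have h3 : R ⊆ A ∩ B := Finset.subset_inter h1 h2
            have h4 : R ⊆ A ∪ B := h1.trans Finset.subset_union_left
            simp [h1, h2, h3, h4]
          · simp only [h2, if_false, mul_zero]; positivity
        · simp only [h1, if_false, zero_mul]; positivity
      calc _ = (bw all p A * bw all p B) * ((if R ⊆ A then (1:ℝ) else 0) * (if R ⊆ B then (1:ℝ) else 0)) := by ring
        _ ≤ (bw all p A * bw all p B) * ((if R ⊆ A ∩ B then 1 else 0) * (if R ⊆ A ∪ B then 1 else 0)) :=
          mul_le_mul_of_nonneg_left e (mul_nonneg (bw_nonneg h0 h1 A) (bw_nonneg h0 h1 B))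
        _ = _ := by rw [this]; ring)
  have s1 : ∑ A : Finset E, bw all p A * (if R ⊆ A then 1 else 0) = p ^ R.card := bw_contains R hR
  have s2 : ∑ A : Finset E, (bw all p A * (if R ⊆ A then 1 else 0)) * (if K ⊆ A then 1 else 0)
      = p ^ R.card * p ^ (K \ R).card := by
    rw [← pow_add]
    have : R.card + (K \ R).card = (R ∪ K).card := by
      rw [← Finset.union_sdiff_self_eq_union, Finset.card_union_of_disjoint Finset.disjoint_sdiff]
    rw [this, ← bw_contains (p := p) (R ∪ K) (Finset.union_subset hR hK)]
    apply Finset.sum_congr rfl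
    intro A _
    rw [mul_assoc]
    congr 1
    by_cases a : R ⊆ A <;> by_cases b : K ⊆ A <;> simp [a, b, Finset.union_subset_iff]
  have s3 : ∑ A : Finset E, (bw all p A * (if R ⊆ A then 1 else 0)) * (if D A then 0 else 1)
      = p ^ R.card - ∑ A : Finset E, bw all p A * (if R ⊆ A ∧ D A then 1 else 0) := by
    rw [← s1, ← Finset.sum_sub_distrib]
    apply Finset.sum_congr rfl
    intro A _
    by_cases a : R ⊆ A <;> by_cases b : D A <;> simp [a, b]
  have s4 : ∑ A : Finset E, (bw all p A * (if R ⊆ A then 1 else 0)) *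
        ((if K ⊆ A then 1 else 0) * (if D A then 0 else 1))
      = p ^ R.card * p ^ (K \ R).card -
        ∑ A : Finset E, bw all p A * (if (R ⊆ A ∧ K ⊆ A) ∧ D A then 1 else 0) := by
    rw [← s2, ← Finset.sum_sub_distrib]
    apply Finset.sum_congr rfl
    intro A _
    by_cases a : R ⊆ A <;> by_cases b : D A <;> by_cases c : K ⊆ A <;> simp [a, b, c]
  simp only [s1, s2, s3] at hf
  rw [s4] at hf
  have hpR : 0 < p ^ R.card := by positivity
  have : p ^ R.card * ∑ A : Finset E, bw all p A * (if (R ⊆ A ∧ K ⊆ A) ∧ D A then 1 else 0)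
     ≤ p ^ R.card * (p ^ (K \ R).card * ∑ A : Finset E, bw all p A * (if R ⊆ A ∧ D A then 1 else 0)) := by
    nlinarith [hf]
  exact le_of_mul_le_mul_left this hpR

end bwsec


/-! ### The coupling process -/

/-- State of the exploration: the `F`-graph `H`, the set `Y` of copies tested positively,
the set `N` of copies tested negatively, and a record `U` of untested copies. -/
structure PSt (I : Type*) where
  H : Finset I
  Y : Finset I
  N : Finset I
  U : Finset I

section procsec
variable {E I : Type*} [DecidableEq E] [DecidableEq I]

def PSt.R (es : I → Finset E) (σ : PSt I) : Finset E := σ.Y.biUnion es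
def PSt.D (es : I → Finset E) (σ : PSt I) (G : Finset E) : Prop := ∀ i ∈ σ.N, ¬ es i ⊆ G
def PSt.ok (es : I → Finset E) (σ : PSt I) (G : Finset E) : Prop := σ.R es ⊆ G ∧ σ.D es G
def PSt.yes (σ : PSt I) (h : I) : PSt I := ⟨insert h σ.H, insert h σ.Y, σ.N, σ.U⟩
def PSt.no (σ : PSt I) (h : I) : PSt I := ⟨σ.H, σ.Y, insert h σ.N, σ.U⟩
def PSt.tail (es : I → Finset E) (σ : PSt I) (h : I) : PSt I :=
  ⟨σ.H, σ.Y, σ.N, if Disjoint (es h) (σ.R es) then insert h σ.U else σ.U⟩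
def PSt.add (σ : PSt I) (h : I) : PSt I := ⟨insert h σ.H, σ.Y, σ.N, σ.U⟩

set_option linter.unusedSectionVars false
variable [Fintype E]

def Zw (es : I → Finset E) (all : Finset E) (p : ℝ) (σ : PSt I) : ℝ :=
  ∑ G : Finset E, bw all p G * (if σ.ok es G then 1 else 0)

def nuw (es : I → Finset E) (all : Finset E) (p : ℝ) (σ : PSt I) (G : Finset E) : ℝ :=
  bw all p G * (if σ.ok es G then 1 else 0) / Zw es all p σ

def qq (es : I → Finset E) (all : Finset E) (p : ℝ) (σ : PSt I) (h : I) : ℝ :=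
  Zw es all p (σ.yes h) / Zw es all p σ

/-- Expectation of `f` of the final state when the copies in the list are processed. -/
def Ex (es : I → Finset E) (all : Finset E) (p q₀ : ℝ) : List I → PSt I → (PSt I → ℝ) → ℝ
  | [], σ, f => f σ
  | h :: L, σ, f =>
    if q₀ ≤ qq es all p σ h then
      q₀ * Ex es all p q₀ L (σ.yes h) f
        + (q₀ / qq es all p σ h * (1 - qq es all p σ h)) * Ex es all p q₀ L (σ.no h) f
        + (1 - q₀ / qq es all p σ h) * Ex es all p q₀ L (σ.tail es h) f
    else q₀ * Ex es all p q₀ L (σ.add h) f + (1 - q₀) * Ex es all p q₀ L σ f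

/-- Expectation with respect to the `F`-graph only. -/
def ExH (q₀ : ℝ) : List I → Finset I → (Finset I → ℝ) → ℝ
  | [], H, f => f H
  | h :: L, H, f => q₀ * ExH q₀ L (insert h H) f + (1 - q₀) * ExH q₀ L H f

variable {es : I → Finset E} {all : Finset E} {p q₀ : ℝ}

theorem ok_yes (σ : PSt I) (h : I) (G : Finset E) :
    (σ.yes h).ok es G ↔ (σ.R es ⊆ G ∧ es h ⊆ G) ∧ σ.D es G := by
  have : (σ.yes h).R es = es h ∪ σ.R es := by
    simp [PSt.R, PSt.yes, Finset.biUnion_insert]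
  unfold PSt.ok
  rw [this, Finset.union_subset_iff]
  have : (σ.yes h).D es G ↔ σ.D es G := Iff.rfl
  rw [this]; tauto

theorem ok_yes' (σ : PSt I) (h : I) (G : Finset E) :
    (σ.yes h).ok es G ↔ σ.ok es G ∧ es h ⊆ G := by
  rw [ok_yes]; unfold PSt.ok; tauto

theorem ok_no (σ : PSt I) (h : I) (G : Finset E) :
    (σ.no h).ok es G ↔ σ.ok es G ∧ ¬ es h ⊆ G := by
  have : (σ.no h).D es G ↔ ¬ es h ⊆ G ∧ σ.D es G := by
    simp [PSt.D, PSt.no]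
  have h2 : (σ.no h).R es = σ.R es := rfl
  unfold PSt.ok
  rw [this, h2]; tauto

theorem Zw_nonneg (hp : 0 < p) (hp1 : p ≤ 1) (σ : PSt I) : 0 ≤ Zw es all p σ := by
  apply Finset.sum_nonneg
  intro G _
  apply mul_nonneg (bw_nonneg hp.le hp1 G)
  split_ifs <;> norm_num

theorem Zw_split (σ : PSt I) (h : I) :
    Zw es all p (σ.yes h) + Zw es all p (σ.no h) = Zw es all p σ := by
  unfold Zw
  rw [← Finset.sum_add_distrib]
  apply Finset.sum_congr rfl
  intro G _
  simp only [ok_yes', ok_no]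
  by_cases a : σ.ok es G <;> by_cases b : es h ⊆ G <;> simp [a, b]

theorem qq_nonneg (hp : 0 < p) (hp1 : p ≤ 1) (σ : PSt I) (h : I) : 0 ≤ qq es all p σ h :=
  div_nonneg (Zw_nonneg hp hp1 _) (Zw_nonneg hp hp1 _)

theorem qq_le_one (hp : 0 < p) (hp1 : p ≤ 1) (σ : PSt I) (h : I) : qq es all p σ h ≤ 1 := by
  apply div_le_one_of_le₀ _ (Zw_nonneg hp hp1 _)
  rw [← Zw_split σ h]
  linarith [Zw_nonneg (es := es) (all := all) hp hp1 (σ.no h)]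

theorem Zw_yes_le (hp : 0 < p) (hp1 : p ≤ 1) (hes : ∀ i, es i ⊆ all) (σ : PSt I) (h : I) :
    Zw es all p (σ.yes h) ≤ p ^ (es h \ σ.R es).card * Zw es all p σ := by
  have := bw_harris (all := all) hp hp1 (σ.R es) (es h)
    (Finset.biUnion_subset.2 fun i _ => hes i) (hes h) (σ.D es)
    (fun A B hAB hB i hi hA => hB i hi (hA.trans hAB))
  unfold Zw
  simp only [ok_yes]
  have hok : ∀ G, σ.ok es G ↔ (σ.R es ⊆ G ∧ σ.D es G) := fun _ => Iff.rfl
  simp only [hok]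
  exact this

theorem qq_le (hp : 0 < p) (hp1 : p ≤ 1) (hes : ∀ i, es i ⊆ all) (σ : PSt I) (h : I) :
    qq es all p σ h ≤ p ^ (es h \ σ.R es).card := by
  apply div_le_of_le_mul₀ (Zw_nonneg hp hp1 _) (by positivity)
  exact Zw_yes_le hp hp1 hes σ h

/-- lower bound on the conditional probability -/
theorem qq_ge (hp : 0 < p) (hp1 : p ≤ 1) (hes : ∀ i, es i ⊆ all) (σ : PSt I) (h : I) (θ : ℝ)
    (hZ : 0 < Zw es all p σ) (hθ1 : θ ≤ 1)
    (hθ : ∑ i ∈ σ.N.filter (fun i => ¬ (es i ∩ es h ⊆ σ.R es)),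
        p ^ (es i \ (es h ∪ σ.R es)).card ≤ θ) :
    p ^ (es h \ σ.R es).card * (1 - θ) ≤ qq es all p σ h := by
  set R := σ.R es with hR
  have hRall : R ⊆ all := Finset.biUnion_subset.2 fun i _ => hes i
  set N1 := σ.N.filter (fun i => ¬ (es i ∩ es h ⊆ R)) with hN1
  obtain ⟨D0, hD0d⟩ : ∃ D0 : Finset E → Prop, ∀ G, D0 G ↔
      ∀ i ∈ σ.N, es i ∩ es h ⊆ R → ¬ es i ⊆ G := ⟨_, fun _ => Iff.rfl⟩
  have hD0 : ∀ A B, A ⊆ B → D0 B → D0 A :=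
    fun A B hAB hB => (hD0d A).2 fun i hi hi2 hA => (hD0d B).1 hB i hi hi2 (hA.trans hAB)
  let m0 : ℝ := ∑ G : Finset E, bw all p G * (if R ⊆ G ∧ D0 G then 1 else 0)
  have hm0Z : Zw es all p σ ≤ m0 := by
    apply Finset.sum_le_sum
    intro G _
    apply mul_le_mul_of_nonneg_left _ (bw_nonneg hp.le hp1 G)
    by_cases a : σ.ok es G
    · have : R ⊆ G ∧ D0 G := ⟨a.1, (hD0d G).2 fun i hi _ => a.2 i hi⟩
      simp [a, this]
    · rw [if_neg a]; split_ifs <;> norm_num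
  have hm0 : 0 < m0 := hZ.trans_le hm0Z
  -- independence
  have hind : ∑ G : Finset E, bw all p G * (if (R ⊆ G ∧ es h ⊆ G) ∧ D0 G then 1 else 0)
      = p ^ (es h \ R).card * m0 := by
    have := bw_cond (p := p) (all := all) (es h \ R) (Finset.sdiff_subset.trans (hes h))
      (fun G => if R ⊆ G ∧ D0 G then 1 else 0) (by
        intro e he G
        have he' := Finset.mem_sdiff.1 he
        have h1 : R ⊆ insert e G ↔ R ⊆ G := Finset.subset_insert_iff_of_notMem he'.2
        have h2 : D0 (insert e G) ↔ D0 G := by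
          constructor
          · exact fun h => hD0 _ _ (Finset.subset_insert _ _) h
          · intro hG
            refine (hD0d _).2 fun i hi hi2 hi3 => ?_
            apply (hD0d _).1 hG i hi hi2
            rwa [Finset.subset_insert_iff_of_notMem] at hi3
            intro hei
            exact he'.2 (hi2 (Finset.mem_inter.2 ⟨hei, he'.1⟩))
        simp only [h1, h2])
    rw [← this]
    apply Finset.sum_congr rfl
    intro G _
    congr 1
    have h1 : (R ⊆ G ∧ es h ⊆ G) ↔ (es h \ R ⊆ G ∧ R ⊆ G) := by
      constructor
      · exact fun a => ⟨Finset.sdiff_subset.trans a.2, a.1⟩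
      · intro a
        refine ⟨a.2, fun x hx => ?_⟩
        by_cases hxR : x ∈ R
        · exact a.2 hxR
        · exact a.1 (Finset.mem_sdiff.2 ⟨hx, hxR⟩)
    simp only [h1]
    by_cases a : es h \ R ⊆ G <;> by_cases b : R ⊆ G <;> by_cases c : D0 G <;> simp [a, b, c]
  have hpair : ∀ i ∈ N1, ∑ G : Finset E,
      bw all p G * (if (R ⊆ G ∧ (es h ∪ es i) ⊆ G) ∧ D0 G then 1 else 0)
      ≤ p ^ (es h \ R).card * p ^ (es i \ (es h ∪ R)).card * m0 := by
    intro i _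
    have := bw_harris (all := all) hp hp1 R (es h ∪ es i) hRall
      (Finset.union_subset (hes h) (hes i)) D0 hD0
    refine this.trans (le_of_eq ?_)
    congr 1
    rw [← pow_add]
    congr 1
    rw [← Finset.card_union_of_disjoint]
    · congr 1
      ext x
      simp only [Finset.mem_union, Finset.mem_sdiff]
      tauto
    · rw [Finset.disjoint_left]
      intro x hx hx2
      simp only [Finset.mem_union, Finset.mem_sdiff] at hx hx2
      tauto
  have hmain : p ^ (es h \ R).card * m0 -
      ∑ i ∈ N1, p ^ (es h \ R).card * p ^ (es i \ (es h ∪ R)).card * m0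
      ≤ Zw es all p (σ.yes h) := by
    rw [← hind]
    refine le_trans (sub_le_sub_left (Finset.sum_le_sum hpair) _) ?_
    rw [Finset.sum_comm, ← Finset.sum_sub_distrib]
    apply Finset.sum_le_sum
    intro G _
    rw [← Finset.mul_sum, ← mul_sub]
    apply mul_le_mul_of_nonneg_left _ (bw_nonneg hp.le hp1 G)
    have hnn : 0 ≤ ∑ i ∈ N1, (if (R ⊆ G ∧ (es h ∪ es i) ⊆ G) ∧ D0 G then (1:ℝ) else 0) :=
      Finset.sum_nonneg fun i _ => by split_ifs <;> norm_num
    by_cases a : (R ⊆ G ∧ es h ⊆ G) ∧ D0 G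
    · by_cases b : (σ.yes h).ok es G
      · rw [if_pos a, if_pos b]; linarith
      · rw [if_pos a, if_neg b]
        rw [ok_yes] at b
        have : ¬ σ.D es G := fun hh => b ⟨a.1, hh⟩
        unfold PSt.D at this
        push Not at this
        obtain ⟨i, hi, hiG⟩ := this
        have hi1 : i ∈ N1 := by
          rw [hN1, Finset.mem_filter]
          exact ⟨hi, fun hh => (hD0d G).1 a.2 i hi hh hiG⟩
        have : (1:ℝ) ≤ ∑ i ∈ N1, (if (R ⊆ G ∧ (es h ∪ es i) ⊆ G) ∧ D0 G then (1:ℝ) else 0) := by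
          refine le_trans ?_ (Finset.single_le_sum
            (fun i _ => by split_ifs <;> norm_num) hi1)
          rw [if_pos ⟨⟨a.1.1, Finset.union_subset a.1.2 hiG⟩, a.2⟩]
        linarith
    · rw [if_neg a]
      have : (0:ℝ) ≤ (if (σ.yes h).ok es G then 1 else 0) := by split_ifs <;> norm_num
      linarith
  unfold qq
  rw [le_div_iff₀ hZ]
  refine le_trans ?_ hmain
  have e1 : ∑ i ∈ N1, p ^ (es h \ R).card * p ^ (es i \ (es h ∪ R)).card * m0
     = p ^ (es h \ R).card * m0 * ∑ i ∈ N1, p ^ (es i \ (es h ∪ R)).card := by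
    rw [Finset.mul_sum]; apply Finset.sum_congr rfl; intro i _; ring
  rw [e1]
  have hpos : 0 < p ^ (es h \ R).card := by positivity
  have a1 : p ^ (es h \ R).card * (1 - θ) * Zw es all p σ ≤ p ^ (es h \ R).card * (1 - θ) * m0 :=
    mul_le_mul_of_nonneg_left hm0Z (mul_nonneg hpos.le (by linarith))
  have a2 : p ^ (es h \ R).card * m0 * ∑ i ∈ N1, p ^ (es i \ (es h ∪ R)).card
      ≤ p ^ (es h \ R).card * m0 * θ :=
    mul_le_mul_of_nonneg_left hθ (by positivity)
  linarith

/-! linear structure of `Ex` -/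

theorem Ex_mono_on (hp : 0 < p) (hp1 : p ≤ 1) (hq : 0 < q₀) (hq1 : q₀ ≤ 1)
    (Inv : List I → PSt I → Prop)
    (hyes : ∀ h L σ, Inv (h :: L) σ → q₀ ≤ qq es all p σ h → Inv L (σ.yes h))
    (hno : ∀ h L σ, Inv (h :: L) σ → q₀ ≤ qq es all p σ h → qq es all p σ h < 1 → Inv L (σ.no h))
    (htail : ∀ h L σ, Inv (h :: L) σ → q₀ ≤ qq es all p σ h → Inv L (σ.tail es h))
    (hadd : ∀ h L σ, Inv (h :: L) σ → ¬ q₀ ≤ qq es all p σ h → Inv L (σ.add h))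
    (hskip : ∀ h L σ, Inv (h :: L) σ → ¬ q₀ ≤ qq es all p σ h → Inv L σ)
    (f f' : PSt I → ℝ) (hff : ∀ σ, Inv [] σ → f σ ≤ f' σ) (L : List I) (σ : PSt I)
    (hL : Inv L σ) : Ex es all p q₀ L σ f ≤ Ex es all p q₀ L σ f' := by
  induction L generalizing σ with
  | nil => exact hff σ hL
  | cons h L ih =>
    unfold Ex
    split_ifs with hc
    · have hpos : 0 < qq es all p σ h := hq.trans_le hc
      have b1 : 0 ≤ 1 - q₀ / qq es all p σ h := by
        rw [sub_nonneg]; exact div_le_one_of_le₀ hc hpos.le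
      have t1 := mul_le_mul_of_nonneg_left (ih _ (hyes h L σ hL hc)) hq.le
      have t3 := mul_le_mul_of_nonneg_left (ih _ (htail h L σ hL hc)) b1
      rcases (qq_le_one (es := es) (all := all) hp hp1 σ h).eq_or_lt with h1 | h1
      · rw [h1] at t3 ⊢
        simp only [sub_self, mul_zero, zero_mul, add_zero]
        linarith
      · have t2 := mul_le_mul_of_nonneg_left (ih _ (hno h L σ hL hc h1))
          (show 0 ≤ q₀ / qq es all p σ h * (1 - qq es all p σ h) from
            mul_nonneg (by positivity) (by linarith))
        linarith
    · have t1 := mul_le_mul_of_nonneg_left (ih _ (hadd h L σ hL hc)) hq.le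
      have t2 := mul_le_mul_of_nonneg_left (ih _ (hskip h L σ hL hc)) (sub_nonneg.2 hq1)
      linarith

theorem Ex_mono (hp : 0 < p) (hp1 : p ≤ 1) (hq : 0 < q₀) (hq1 : q₀ ≤ 1)
    (f f' : PSt I → ℝ) (hff : ∀ σ, f σ ≤ f' σ) (L : List I) (σ : PSt I) :
    Ex es all p q₀ L σ f ≤ Ex es all p q₀ L σ f' :=
  Ex_mono_on hp hp1 hq hq1 (fun _ _ => True) (by simp) (by simp) (by simp) (by simp) (by simp)
    f f' (fun σ _ => hff σ) L σ trivial

theorem Ex_add (f f' : PSt I → ℝ) (L : List I) (σ : PSt I) :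
    Ex es all p q₀ L σ (fun τ => f τ + f' τ) = Ex es all p q₀ L σ f + Ex es all p q₀ L σ f' := by
  induction L generalizing σ with
  | nil => rfl
  | cons h L ih =>
    unfold Ex
    simp only [ih]
    split_ifs <;> ring

theorem Ex_smul (c : ℝ) (f : PSt I → ℝ) (L : List I) (σ : PSt I) :
    Ex es all p q₀ L σ (fun τ => c * f τ) = c * Ex es all p q₀ L σ f := by
  induction L generalizing σ with
  | nil => rfl
  | cons h L ih =>
    unfold Ex
    simp only [ih]
    split_ifs <;> ring

theorem Ex_zero (L : List I) (σ : PSt I) :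
    Ex es all p q₀ L σ (fun _ => 0) = 0 := by
  have := Ex_smul (es := es) (all := all) (p := p) (q₀ := q₀) 0 (fun _ => 0) L σ
  simpa using this

theorem Ex_sum {ι : Type*} (s : Finset ι) (f : ι → PSt I → ℝ) (L : List I) (σ : PSt I) :
    Ex es all p q₀ L σ (fun τ => ∑ i ∈ s, f i τ) = ∑ i ∈ s, Ex es all p q₀ L σ (f i) := by
  induction s using Finset.induction_on with
  | empty => simpa using Ex_zero L σ
  | insert a s ha ih =>
    simp only [Finset.sum_insert ha]
    rw [Ex_add, ih]

theorem Ex_nonneg (hp : 0 < p) (hp1 : p ≤ 1) (hq : 0 < q₀) (hq1 : q₀ ≤ 1)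
    (f : PSt I → ℝ) (hf : ∀ σ, 0 ≤ f σ) (L : List I) (σ : PSt I) :
    0 ≤ Ex es all p q₀ L σ f := by
  have := Ex_mono (es := es) (all := all) hp hp1 hq hq1 (fun _ => 0) f hf L σ
  rwa [Ex_zero] at this

theorem nuw_step (hp : 0 < p) (hp1 : p ≤ 1) (hq : 0 < q₀) (σ : PSt I) (h : I) (G : Finset E)
    (hc : q₀ ≤ qq es all p σ h) :
    q₀ * nuw es all p (σ.yes h) G
        + (q₀ / qq es all p σ h * (1 - qq es all p σ h)) * nuw es all p (σ.no h) G
        + (1 - q₀ / qq es all p σ h) * nuw es all p σ G = nuw es all p σ G := by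
  have hpos : 0 < qq es all p σ h := hq.trans_le hc
  have hZy0 := Zw_nonneg (es := es) (all := all) hp hp1 (σ.yes h)
  have hZn0 := Zw_nonneg (es := es) (all := all) hp hp1 (σ.no h)
  have hZ0 := Zw_nonneg (es := es) (all := all) hp hp1 σ
  have hs := Zw_split (es := es) (all := all) (p := p) σ h
  have hZ : 0 < Zw es all p σ := by
    rcases hZ0.eq_or_lt with h0 | h0
    · unfold qq at hpos; rw [← h0] at hpos; simp at hpos
    · exact h0
  have hZy : 0 < Zw es all p (σ.yes h) := by
    rcases hZy0.eq_or_lt with h0 | h0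
    · unfold qq at hpos; rw [← h0] at hpos; simp at hpos
    · exact h0
  have e1 : q₀ * nuw es all p (σ.yes h) G = q₀ / qq es all p σ h *
      (bw all p G * (if (σ.yes h).ok es G then 1 else 0) / Zw es all p σ) := by
    unfold nuw qq; field_simp
  have e2 : (1 - qq es all p σ h) * nuw es all p (σ.no h) G =
      (bw all p G * (if (σ.no h).ok es G then 1 else 0) / Zw es all p σ) := by
    have : 1 - qq es all p σ h = Zw es all p (σ.no h) / Zw es all p σ := by
      unfold qq; rw [← hs] at hZ ⊢; field_simp; ring
    rw [this]
    unfold nuw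
    rcases hZn0.eq_or_lt with h0 | h0
    · rw [← h0]
      have hz : bw all p G * (if (σ.no h).ok es G then 1 else 0) = 0 := by
        have hz := h0.symm
        unfold Zw at hz
        rw [Finset.sum_eq_zero_iff_of_nonneg] at hz
        · exact hz G (Finset.mem_univ _)
        · intro G _
          apply mul_nonneg (bw_nonneg hp.le hp1 G)
          split_ifs <;> norm_num
      rw [hz]; simp
    · field_simp
  have e3 : bw all p G * (if (σ.yes h).ok es G then 1 else 0) / Zw es all p σ +
      bw all p G * (if (σ.no h).ok es G then 1 else 0) / Zw es all p σ = nuw es all p σ G := by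
    unfold nuw
    simp only [ok_yes', ok_no]
    by_cases a : σ.ok es G <;> by_cases b : es h ⊆ G <;> simp [a, b]
  rw [e1, mul_assoc, e2]
  rw [← e3]; ring

theorem Ex_nuw (hp : 0 < p) (hp1 : p ≤ 1) (hq : 0 < q₀) (G : Finset E) (L : List I) (σ : PSt I) :
    Ex es all p q₀ L σ (fun τ => nuw es all p τ G) = nuw es all p σ G := by
  induction L generalizing σ with
  | nil => rfl
  | cons h L ih =>
    unfold Ex
    simp only [ih]
    have h1 : nuw es all p (σ.tail es h) G = nuw es all p σ G := rfl
    have h2 : nuw es all p (σ.add h) G = nuw es all p σ G := rfl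
    rw [h1, h2]
    split_ifs with hc
    · exact nuw_step hp hp1 hq σ h G hc
    · ring

theorem Ex_H (hq : 0 < q₀) (f : Finset I → ℝ) (L : List I) (σ : PSt I) :
    Ex es all p q₀ L σ (fun τ => f τ.H) = ExH q₀ L σ.H f := by
  induction L generalizing σ with
  | nil => rfl
  | cons h L ih =>
    unfold Ex ExH
    simp only [ih]
    have h1 : (σ.tail es h).H = σ.H := rfl
    have h2 : (σ.no h).H = σ.H := rfl
    have h3 : (σ.yes h).H = insert h σ.H := rfl
    have h4 : (σ.add h).H = insert h σ.H := rfl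
    rw [h1, h2, h3, h4]
    split_ifs with hc
    · have : qq es all p σ h ≠ 0 := (hq.trans_le hc).ne'
      field_simp; ring
    · rfl

theorem ExH_eq [Fintype I] (L : List I) (hL : L.Nodup) (H : Finset I) (f : Finset I → ℝ) :
    ExH q₀ L H f = ∑ A : Finset I, bw L.toFinset q₀ A * f (H ∪ A) := by
  have hpow : ∀ (S : Finset I) (g : Finset I → ℝ),
      ∑ A : Finset I, bw S q₀ A * g A = ∑ A ∈ S.powerset, bw S q₀ A * g A := by
    intro S g
    symm
    apply Finset.sum_subset (Finset.subset_univ _)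
    intro A _ hA
    rw [Finset.mem_powerset] at hA
    simp [bw, hA]
  induction L generalizing H with
  | nil =>
    rw [hpow]; simp [ExH, bw]
  | cons h L ih =>
    rw [List.nodup_cons] at hL
    unfold ExH
    rw [ih hL.2, ih hL.2, List.toFinset_cons]
    have hS : h ∉ L.toFinset := by simpa using hL.1
    set S := L.toFinset
    rw [hpow, hpow, hpow, Finset.sum_powerset_insert hS, add_comm, Finset.mul_sum, Finset.mul_sum]
    congr 1
    · apply Finset.sum_congr rfl
      intro A hA
      rw [Finset.mem_powerset] at hA
      unfold bw
      have c := Finset.card_le_card hA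
      rw [if_pos hA, if_pos (hA.trans (Finset.subset_insert _ _)), Finset.card_insert_of_notMem hS]
      have : S.card + 1 - A.card = (S.card - A.card) + 1 := by omega
      rw [this, pow_succ]; ring
    · apply Finset.sum_congr rfl
      intro A hA
      rw [Finset.mem_powerset] at hA
      have hhA : h ∉ A := fun hh => hS (hA hh)
      unfold bw
      rw [if_pos hA, if_pos (Finset.insert_subset_insert _ hA), Finset.card_insert_of_notMem hS,
        Finset.card_insert_of_notMem hhA]
      have : insert h H ∪ A = H ∪ insert h A := by
        ext x; simp only [Finset.mem_union, Finset.mem_insert]; tauto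
      rw [this]
      have : S.card + 1 - (A.card + 1) = S.card - A.card := by omega
      rw [this, pow_succ]; ring

theorem ExH_nonneg (hq : 0 < q₀) (hq1 : q₀ ≤ 1) (f : Finset I → ℝ) (hf : ∀ H, 0 ≤ f H)
    (L : List I) (H : Finset I) : 0 ≤ ExH q₀ L H f := by
  induction L generalizing H with
  | nil => exact hf H
  | cons h L ih =>
    unfold ExH
    have := ih (insert h H)
    have := ih H
    have : 0 ≤ 1 - q₀ := by linarith
    positivity

theorem ExH_erase (h : I) (φ : Finset I → ℝ) (L : List I) (H : Finset I) :
    ExH q₀ L (insert h H) (fun H => φ (H.erase h)) = ExH q₀ L H (fun H => φ (H.erase h)) := by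
  induction L generalizing H with
  | nil => simp [ExH, Finset.erase_insert_eq_erase]
  | cons h' L ih =>
    unfold ExH
    rw [Finset.insert_comm, ih, ih]

theorem Ex_notU (h : I) (f : PSt I → ℝ) (L : List I) (hL : h ∉ L) (σ : PSt I) (hU : h ∉ σ.U) :
    Ex es all p q₀ L σ (fun τ => if h ∈ τ.U then f τ else 0) = 0 := by
  induction L generalizing σ with
  | nil => simp [Ex, hU]
  | cons h' L ih =>
    rw [List.mem_cons, not_or] at hL
    unfold Ex
    rw [ih hL.2 (σ.yes h') hU, ih hL.2 (σ.no h') hU, ih hL.2 (σ.add h') hU, ih hL.2 σ hU]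
    rw [ih hL.2 (σ.tail es h')]
    · simp
    · unfold PSt.tail
      simp only
      split_ifs
      · simp [hL.1, hU]
      · exact hU

theorem Ex_tail (hp : 0 < p) (hp1 : p ≤ 1) (hq : 0 < q₀) (hq1 : q₀ ≤ 1) (hes : ∀ i, es i ⊆ all)
    (h : I) (κ : ℝ) (hκ0 : 0 ≤ κ) (hκ : 1 - q₀ / p ^ (es h).card ≤ κ)
    (φ : Finset I → ℝ) (hφ : ∀ H, 0 ≤ φ H)
    (L : List I) (hL : L.Nodup) (σ : PSt I) (hU : h ∉ σ.U) :
    Ex es all p q₀ L σ (fun τ => if h ∈ τ.U then φ (τ.H.erase h) else 0)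
      ≤ κ * ExH q₀ L σ.H (fun H => φ (H.erase h)) := by
  induction L generalizing σ with
  | nil => simp only [Ex, ExH, if_neg hU]; exact mul_nonneg hκ0 (hφ _)
  | cons h' L ih =>
    rw [List.nodup_cons] at hL
    have hT0 := ExH_nonneg hq hq1 (fun H => φ (H.erase h)) (fun _ => hφ _) L σ.H
    have hT1 := ExH_nonneg hq hq1 (fun H => φ (H.erase h)) (fun _ => hφ _) L (insert h' σ.H)
    by_cases hh : h' = h
    · subst hh
      unfold Ex ExH
      rw [ExH_erase]
      rw [Ex_notU h' _ L hL.1 (σ.yes h') hU, Ex_notU h' _ L hL.1 (σ.no h') hU,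
        Ex_notU h' _ L hL.1 (σ.add h') hU, Ex_notU h' _ L hL.1 σ hU]
      set T0 := ExH q₀ L σ.H (fun H => φ (H.erase h'))
      have hr : κ * (q₀ * T0 + (1 - q₀) * T0) = κ * T0 := by ring
      rw [hr]
      split_ifs with hc
      · simp only [mul_zero, zero_add]
        have hpos : 0 < qq es all p σ h' := hq.trans_le hc
        by_cases hd : Disjoint (es h') (σ.R es)
        · have hqle := qq_le (all := all) hp hp1 hes σ h'
          have : es h' \ σ.R es = es h' := Finset.sdiff_eq_self_of_disjoint hd
          rw [this] at hqle
          have hκ' : 1 - q₀ / qq es all p σ h' ≤ κ := by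
            refine le_trans ?_ hκ
            have : q₀ / p ^ (es h').card ≤ q₀ / qq es all p σ h' :=
              div_le_div_of_nonneg_left hq.le hpos hqle
            linarith
          have hX : Ex es all p q₀ L (σ.tail es h') (fun τ => if h' ∈ τ.U then φ (τ.H.erase h') else 0)
              ≤ T0 := by
            refine le_trans (Ex_mono hp hp1 hq hq1 _ (fun τ => φ (τ.H.erase h')) ?_ L _) ?_
            · intro τ
              split_ifs
              · exact le_rfl
              · exact hφ _
            · rw [Ex_H hq (fun H => φ (H.erase h'))]; exact le_rfl
          have b1 : 0 ≤ 1 - q₀ / qq es all p σ h' := by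
            rw [sub_nonneg]; exact div_le_one_of_le₀ hc hpos.le
          calc _ ≤ (1 - q₀ / qq es all p σ h') * T0 := mul_le_mul_of_nonneg_left hX b1
            _ ≤ κ * T0 := mul_le_mul_of_nonneg_right hκ' hT0
        · rw [Ex_notU h' _ L hL.1 (σ.tail es h')]
          · simp only [mul_zero]; positivity
          · simp [PSt.tail, hd, hU]
      · simp only [mul_zero, zero_add]; positivity
    · unfold Ex ExH
      have i1 := ih hL.2 (σ.yes h') hU
      have i2 := ih hL.2 (σ.no h') hU
      have i3 := ih hL.2 (σ.tail es h') (by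
        unfold PSt.tail
        simp only
        split_ifs
        · simp [hU, Ne.symm hh]
        · exact hU)
      have i4 := ih hL.2 (σ.add h') hU
      have i5 := ih hL.2 σ hU
      have h1 : (σ.tail es h').H = σ.H := rfl
      have h2 : (σ.no h').H = σ.H := rfl
      have h3 : (σ.yes h').H = insert h' σ.H := rfl
      have h4 : (σ.add h').H = insert h' σ.H := rfl
      rw [h1] at i3; rw [h2] at i2; rw [h3] at i1; rw [h4] at i4
      set T0 := ExH q₀ L σ.H (fun H => φ (H.erase h))
      set T1 := ExH q₀ L (insert h' σ.H) (fun H => φ (H.erase h))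
      split_ifs with hc
      · have hpos : 0 < qq es all p σ h' := hq.trans_le hc
        have b1 : 0 ≤ 1 - q₀ / qq es all p σ h' := by
          rw [sub_nonneg]; exact div_le_one_of_le₀ hc hpos.le
        have b2 : 0 ≤ q₀ / qq es all p σ h' * (1 - qq es all p σ h') :=
          mul_nonneg (by positivity) (by
            linarith [qq_le_one (es := es) (all := all) hp hp1 σ h'])
        have t1 := mul_le_mul_of_nonneg_left i1 hq.le
        have t2 := mul_le_mul_of_nonneg_left i2 b2
        have t3 := mul_le_mul_of_nonneg_left i3 b1
        have e : q₀ * (κ * T1) + (q₀ / qq es all p σ h' * (1 - qq es all p σ h')) * (κ * T0)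
          + (1 - q₀ / qq es all p σ h') * (κ * T0) = κ * (q₀ * T1 + (1 - q₀) * T0) := by
          field_simp; ring
        linarith
      · have t1 := mul_le_mul_of_nonneg_left i4 hq.le
        have t2 := mul_le_mul_of_nonneg_left i5 (sub_nonneg.2 hq1)
        linarith

end procsec


section absec
set_option linter.unusedSectionVars false
variable {E I V : Type*} [DecidableEq E] [DecidableEq I] [DecidableEq V] [Fintype E] [Fintype I]
  [Fintype V]
variable {es : I → Finset E} {all : Finset E} {p q₀ : ℝ}

theorem nuw_nonneg (hp : 0 < p) (hp1 : p ≤ 1) (σ : PSt I) (G : Finset E) :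
    0 ≤ nuw es all p σ G := by
  unfold nuw
  apply div_nonneg _ (Zw_nonneg hp hp1 _)
  apply mul_nonneg (bw_nonneg hp.le hp1 G)
  split_ifs <;> norm_num

theorem nuw_sum (σ : PSt I) (hZ : 0 < Zw es all p σ) : ∑ G, nuw es all p σ G = 1 := by
  unfold nuw
  rw [← Finset.sum_div]
  exact div_self hZ.ne'

theorem nuw_event (σ : PSt I) (h : I) :
    ∑ G, nuw es all p σ G * (if es h ⊆ G then 1 else 0) = qq es all p σ h := by
  unfold qq nuw
  conv_rhs => rw [Zw, Finset.sum_div]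
  apply Finset.sum_congr rfl
  intro G _
  simp only [ok_yes']
  by_cases a : σ.ok es G <;> by_cases b : es h ⊆ G <;> simp [a, b]

/-- The invariant of the exploration. -/
def PInv (es : I → Finset E) (all : Finset E) (p : ℝ) (C : Finset I) (Bad : Finset I → Prop)
    (L : List I) (σ : PSt I) : Prop :=
  L.Nodup ∧ (∀ h ∈ L, h ∈ C ∧ h ∉ σ.H ∧ h ∉ σ.N) ∧ σ.H ⊆ C ∧ σ.N ⊆ C ∧ Disjoint σ.H σ.N ∧
  0 < Zw es all p σ ∧
  (¬ Bad σ.H → σ.Y = σ.H ∧ ∀ h ∈ C, h ∈ L ∨ h ∈ σ.H ∨ h ∈ σ.N ∨ h ∈ σ.U ∨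
    (∃ i ∈ σ.N, es i ⊆ es h ∪ σ.R es) ∨ ¬ Disjoint (es h) (σ.R es))

theorem coupling_bound (hp : 0 < p) (hp1 : p ≤ 1) (hq : 0 < q₀) (hq1 : q₀ ≤ 1)
    (hes : ∀ i, es i ⊆ all) (C : Finset I) (vs : I → Finset V)
    (s : ℕ) (hs : ∀ i ∈ C, (es i).card = s)
    (Bad : Finset I → Prop) (hBad : ∀ A B, A ⊆ B → Bad A → Bad B)
    (hA : ∀ H ⊆ C, ¬ Bad H → ∀ i ∈ C, i ∉ H → ¬ es i ⊆ H.biUnion es)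
    (θ : ℝ) (hθ1 : θ ≤ 1) (hθ : q₀ ≤ p ^ s * (1 - θ))
    (hB : ∀ H ⊆ C, ¬ Bad H → ∀ h ∈ C, ∀ N ⊆ C,
      (∀ i ∈ N, ¬ es i ⊆ es h ∪ H.biUnion es) →
      ∑ i ∈ N.filter (fun i => ¬ (es i ∩ es h ⊆ H.biUnion es)),
        p ^ (es i \ (es h ∪ H.biUnion es)).card ≤ θ)
    (ε : ℝ) (hε : 0 ≤ ε)
    (hV : ∀ H ⊆ C, ¬ Bad H → ∀ v : V,
      ∑ i ∈ C.filter (fun i => v ∈ vs i ∧ ¬ Disjoint (es i) (H.biUnion es) ∧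
          ¬ es i ⊆ H.biUnion es), p ^ (es i \ H.biUnion es).card ≤ ε)
    (κ : ℝ) (hκ0 : 0 ≤ κ) (hκ : 1 - q₀ / p ^ s ≤ κ)
    (low : V → Finset I → Prop) (hlow : ∀ v H h, low v H → low v (H.erase h)) :
    Ex es all p q₀ C.toList ⟨∅, ∅, ∅, ∅⟩ (fun σ => ∑ G, nuw es all p σ G *
      (if (∀ h ∈ σ.H, es h ⊆ G) ∧ ∀ v, low v σ.H → ¬ ∃ h ∈ C, es h ⊆ G ∧ h ∉ σ.H ∧ v ∈ vs h
        then 0 else 1)) ≤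
    (∑ H, bw C q₀ H * (if Bad H then 1 else 0)) +
    ∑ v, ((∑ h ∈ C.filter (fun h => v ∈ vs h),
        p ^ s * (κ * ∑ H, bw C q₀ H * (if low v (H.erase h) then 1 else 0))) +
      ε * ∑ H, bw C q₀ H * (if low v H then 1 else 0)) := by
  have hExH : ∀ f : Finset I → ℝ, ExH q₀ C.toList ∅ f = ∑ H, bw C q₀ H * f H := by
    intro f
    rw [ExH_eq _ C.nodup_toList]
    simp
  set σ0 : PSt I := ⟨∅, ∅, ∅, ∅⟩ with hσ0
  -- the key lower bound
  have hkey : ∀ h L σ, PInv es all p C Bad (h :: L) σ → ¬ Bad σ.H →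
      (∀ i ∈ σ.N, ¬ es i ⊆ es h ∪ σ.R es) → q₀ ≤ qq es all p σ h := by
    rintro h L σ ⟨hnd, hL, hHC, hNC, hdis, hZ, hmain⟩ hbad hi
    obtain ⟨hY, -⟩ := hmain hbad
    have hR : σ.R es = σ.H.biUnion es := by unfold PSt.R; rw [hY]
    have hhC := (hL h List.mem_cons_self).1
    have := qq_ge hp hp1 hes σ h θ hZ hθ1 (by
      rw [hR] at hi ⊢
      exact hB σ.H hHC hbad h hhC σ.N hNC hi)
    refine le_trans (le_trans hθ ?_) this
    apply mul_le_mul_of_nonneg_right _ (by linarith)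
    apply pow_le_pow_of_le_one hp.le hp1
    rw [← hs h hhC]
    exact Finset.card_le_card Finset.sdiff_subset
  have hZpos : ∀ h σ, q₀ ≤ qq es all p σ h → 0 < Zw es all p (σ.yes h) := by
    intro h σ hc
    have hpos := hq.trans_le hc
    rcases (Zw_nonneg (es := es) (all := all) hp hp1 (σ.yes h)).eq_or_lt with h0 | h0
    · unfold qq at hpos; rw [← h0] at hpos; simp at hpos
    · exact h0
  have hstep := Ex_mono_on (es := es) (all := all) hp hp1 hq hq1 (PInv es all p C Bad)
    (by -- yes
      rintro h L σ ⟨hnd, hL, hHC, hNC, hdis, hZ, hmain⟩ hc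
      rw [List.nodup_cons] at hnd
      have hh := hL h List.mem_cons_self
      refine ⟨hnd.2, ?_, ?_, hNC, ?_, hZpos h σ hc, ?_⟩
      · intro h' hh'
        have := hL h' (List.mem_cons_of_mem _ hh')
        refine ⟨this.1, ?_, this.2.2⟩
        simp only [PSt.yes, Finset.mem_insert, not_or]
        exact ⟨fun e => hnd.1 (e ▸ hh'), this.2.1⟩
      · exact Finset.insert_subset hh.1 hHC
      · simp only [PSt.yes]
        rw [Finset.disjoint_insert_left]
        exact ⟨hh.2.2, hdis⟩
      · intro hb
        have hb' : ¬ Bad σ.H := fun x => hb (hBad _ _ (Finset.subset_insert _ _) x)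
        obtain ⟨hY, hc⟩ := hmain hb'
        have hRR : σ.R es ⊆ (σ.yes h).R es := by
          simp [PSt.R, PSt.yes, Finset.biUnion_insert]
        refine ⟨by simp [PSt.yes, hY], fun h' hh' => ?_⟩
        rcases hc h' hh' with h1 | h1 | h1 | h1 | ⟨i, hi, h1⟩ | h1
        · rcases List.mem_cons.1 h1 with h2 | h2
          · right; left; simp [PSt.yes, h2]
          · left; exact h2
        · right; left; simp [PSt.yes, h1]
        · right; right; left; exact h1
        · right; right; right; left; exact h1
        · right; right; right; right; left
          exact ⟨i, hi, h1.trans (Finset.union_subset_union_right hRR)⟩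
        · right; right; right; right; right
          exact fun hd => h1 (hd.mono_right hRR))
    (by -- no
      rintro h L σ ⟨hnd, hL, hHC, hNC, hdis, hZ, hmain⟩ hc hlt
      rw [List.nodup_cons] at hnd
      have hh := hL h List.mem_cons_self
      refine ⟨hnd.2, ?_, hHC, ?_, ?_, ?_, ?_⟩
      · intro h' hh'
        have := hL h' (List.mem_cons_of_mem _ hh')
        refine ⟨this.1, this.2.1, ?_⟩
        simp only [PSt.no, Finset.mem_insert, not_or]
        exact ⟨fun e => hnd.1 (e ▸ hh'), this.2.2⟩
      · exact Finset.insert_subset hh.1 hNC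
      · simp only [PSt.no]
        rw [Finset.disjoint_insert_right]
        exact ⟨hh.2.1, hdis⟩
      · have hsp := Zw_split (es := es) (all := all) (p := p) σ h
        unfold qq at hlt
        rw [div_lt_one hZ] at hlt
        linarith
      · intro hb
        obtain ⟨hY, hc⟩ := hmain hb
        refine ⟨hY, fun h' hh' => ?_⟩
        rcases hc h' hh' with h1 | h1 | h1 | h1 | ⟨i, hi, h1⟩ | h1
        · rcases List.mem_cons.1 h1 with h2 | h2
          · right; right; left; simp [PSt.no, h2]
          · left; exact h2
        · right; left; exact h1
        · right; right; left; simp [PSt.no, h1]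
        · right; right; right; left; exact h1
        · right; right; right; right; left
          exact ⟨i, by simp [PSt.no, hi], h1⟩
        · right; right; right; right; right
          exact h1)
    (by -- tail
      rintro h L σ ⟨hnd, hL, hHC, hNC, hdis, hZ, hmain⟩ hc
      rw [List.nodup_cons] at hnd
      have hh := hL h List.mem_cons_self
      refine ⟨hnd.2, ?_, hHC, hNC, hdis, hZ, ?_⟩
      · intro h' hh'
        exact hL h' (List.mem_cons_of_mem _ hh')
      · intro hb
        obtain ⟨hY, hc⟩ := hmain hb
        have hU : σ.U ⊆ (σ.tail es h).U := by
          simp only [PSt.tail]; split_ifs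
          · exact Finset.subset_insert _ _
          · exact Finset.Subset.refl _
        refine ⟨hY, fun h' hh' => ?_⟩
        rcases hc h' hh' with h1 | h1 | h1 | h1 | ⟨i, hi, h1⟩ | h1
        · rcases List.mem_cons.1 h1 with h2 | h2
          · right; right; right
            by_cases hd : Disjoint (es h) (σ.R es)
            · left; simp [PSt.tail, hd, h2]
            · right; right; rw [h2]; exact hd
          · left; exact h2
        · right; left; exact h1
        · right; right; left; exact h1
        · right; right; right; left; exact hU h1
        · right; right; right; right; left
          exact ⟨i, hi, h1⟩
        · right; right; right; right; right
          exact h1)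
    (by -- add
      rintro h L σ hI hc
      have hI' := hI
      obtain ⟨hnd, hL, hHC, hNC, hdis, hZ, hmain⟩ := hI
      rw [List.nodup_cons] at hnd
      have hh := hL h List.mem_cons_self
      refine ⟨hnd.2, ?_, ?_, hNC, ?_, hZ, ?_⟩
      · intro h' hh'
        have := hL h' (List.mem_cons_of_mem _ hh')
        refine ⟨this.1, ?_, this.2.2⟩
        simp only [PSt.add, Finset.mem_insert, not_or]
        exact ⟨fun e => hnd.1 (e ▸ hh'), this.2.1⟩
      · exact Finset.insert_subset hh.1 hHC
      · simp only [PSt.add]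
        rw [Finset.disjoint_insert_left]
        exact ⟨hh.2.2, hdis⟩
      · intro hb
        exfalso
        have hb' : ¬ Bad σ.H := fun x => hb (hBad _ _ (Finset.subset_insert _ _) x)
        apply hc
        apply hkey h L σ hI' hb'
        intro i hi
        obtain ⟨hY, -⟩ := hmain hb'
        have := hA (insert h σ.H) (Finset.insert_subset hh.1 hHC) hb i (hNC hi) (by
          rw [Finset.mem_insert, not_or]
          exact ⟨fun e => hh.2.2 (e ▸ hi), fun hx => Finset.disjoint_left.1 hdis hx hi⟩)
        rw [Finset.biUnion_insert] at this
        unfold PSt.R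
        rw [hY]
        exact this)
    (by -- skip
      rintro h L σ hI hc
      have hI' := hI
      obtain ⟨hnd, hL, hHC, hNC, hdis, hZ, hmain⟩ := hI
      rw [List.nodup_cons] at hnd
      refine ⟨hnd.2, ?_, hHC, hNC, hdis, hZ, ?_⟩
      · intro h' hh'
        exact hL h' (List.mem_cons_of_mem _ hh')
      · intro hb
        obtain ⟨hY, hcc⟩ := hmain hb
        refine ⟨hY, fun h' hh' => ?_⟩
        rcases hcc h' hh' with h1 | h1
        · rcases List.mem_cons.1 h1 with h2 | h2
          · right; right; right; right; left
            by_contra hcon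
            push Not at hcon
            rw [h2] at hcon
            exact hc (hkey h L σ hI' hb hcon)
          · left; exact h2
        · right; exact h1)
  -- initial invariant
  have hinit : PInv es all p C Bad C.toList σ0 := by
    refine ⟨C.nodup_toList, ?_, by simp [hσ0], by simp [hσ0], by simp [hσ0], ?_, ?_⟩
    · intro h hh; simpa [hσ0] using hh
    · have : Zw es all p σ0 = 1 := by
        rw [← bw_sum (all := all) (p := p)]
        apply Finset.sum_congr rfl
        intro G _
        have : σ0.ok es G := by simp [hσ0, PSt.ok, PSt.R, PSt.D]
        simp [this]
      rw [this]; norm_num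
    · intro _
      refine ⟨rfl, fun h hh => ?_⟩
      left; simpa using hh
  refine le_trans (hstep _ (fun σ => (if Bad σ.H then 1 else 0) +
    ∑ v, ((∑ h ∈ C.filter (fun h => v ∈ vs h),
        p ^ s * (if h ∈ σ.U then (if low v (σ.H.erase h) then 1 else 0) else 0)) +
      ε * (if low v σ.H then 1 else 0))) ?_ C.toList σ0 hinit) ?_
  · -- pointwise bound
    rintro σ ⟨-, -, hHC, hNC, hdis, hZ, hmain⟩
    have hpnn : ∀ v, 0 ≤ ((∑ h ∈ C.filter (fun h => v ∈ vs h),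
        p ^ s * (if h ∈ σ.U then (if low v (σ.H.erase h) then (1:ℝ) else 0) else 0))) := by
      intro v
      apply Finset.sum_nonneg
      intro h _
      apply mul_nonneg (by positivity)
      split_ifs <;> norm_num
    have hrest : 0 ≤ ∑ v, ((∑ h ∈ C.filter (fun h => v ∈ vs h),
        p ^ s * (if h ∈ σ.U then (if low v (σ.H.erase h) then (1:ℝ) else 0) else 0)) +
      ε * (if low v σ.H then 1 else 0)) := by
      apply Finset.sum_nonneg
      intro v _
      apply add_nonneg (hpnn v)
      apply mul_nonneg hε
      split_ifs <;> norm_num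
    by_cases hb : Bad σ.H
    · rw [if_pos hb]
      refine le_trans ?_ (le_add_of_nonneg_right hrest)
      refine le_trans ?_ (nuw_sum (es := es) (all := all) (p := p) σ hZ).le
      apply Finset.sum_le_sum
      intro G _
      apply mul_le_of_le_one_right (nuw_nonneg hp hp1 _ _)
      split_ifs <;> norm_num
    · rw [if_neg hb, zero_add]
      obtain ⟨hY, hcov⟩ := hmain hb
      have hR : σ.R es = σ.H.biUnion es := by unfold PSt.R; rw [hY]
      have h1 : ∀ G, nuw es all p σ G *
          (if (∀ h ∈ σ.H, es h ⊆ G) ∧ ∀ v, low v σ.H → ¬ ∃ h ∈ C, es h ⊆ G ∧ h ∉ σ.H ∧ v ∈ vs h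
            then 0 else 1) ≤
          ∑ v, (if low v σ.H then 1 else 0) * ∑ h ∈ C.filter (fun h => v ∈ vs h ∧ h ∉ σ.H),
            nuw es all p σ G * (if es h ⊆ G then 1 else 0) := by
        intro G
        have hn := nuw_nonneg (es := es) (all := all) hp hp1 σ G
        have hnn : ∀ v, 0 ≤ (if low v σ.H then (1:ℝ) else 0) *
            ∑ h ∈ C.filter (fun h => v ∈ vs h ∧ h ∉ σ.H),
            nuw es all p σ G * (if es h ⊆ G then 1 else 0) := by
          intro v
          apply mul_nonneg
          · split_ifs <;> norm_num
          · apply Finset.sum_nonneg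
            intro h _
            apply mul_nonneg hn
            split_ifs <;> norm_num
        by_cases hok : σ.ok es G
        · split_ifs with hc
          · rw [mul_zero]
            exact Finset.sum_nonneg fun v _ => hnn v
          · have h2 : ∀ h ∈ σ.H, es h ⊆ G := by
              intro h hh
              refine subset_trans ?_ hok.1
              rw [hR]
              exact Finset.subset_biUnion_of_mem es hh
            have h3 : ∃ v, low v σ.H ∧ ∃ h ∈ C, es h ⊆ G ∧ h ∉ σ.H ∧ v ∈ vs h := by
              by_contra hcon
              push Not at hcon
              apply hc
              refine ⟨h2, fun v hv => ?_⟩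
              rintro ⟨h, a1, a2, a3, a4⟩
              exact hcon v hv h a1 a2 a3 a4
            obtain ⟨v, hv, h, a1, a2, a3, a4⟩ := h3
            refine le_trans ?_ (Finset.single_le_sum (fun v _ => hnn v) (Finset.mem_univ v))
            rw [if_pos hv, one_mul]
            refine le_trans ?_ (Finset.single_le_sum (f := fun h => nuw es all p σ G *
              (if es h ⊆ G then 1 else 0)) (fun i _ => ?_)
              (Finset.mem_filter.2 ⟨a1, a4, a3⟩))
            · simp [a2]
            · apply mul_nonneg hn
              split_ifs <;> norm_num
        · have h0 : nuw es all p σ G = 0 := by simp [nuw, hok]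
          rw [h0, zero_mul]
          rw [h0] at hnn
          exact Finset.sum_nonneg fun v _ => hnn v
      refine le_trans (Finset.sum_le_sum fun G _ => h1 G) ?_
      rw [Finset.sum_comm]
      apply Finset.sum_le_sum
      intro v _
      rw [← Finset.mul_sum, Finset.sum_comm]
      simp only [nuw_event]
      by_cases hv : low v σ.H
      swap
      · simp only [if_neg hv, zero_mul, mul_zero, add_zero]
        exact hpnn v
      simp only [if_pos hv, one_mul, mul_one]
      have h2 : ∀ h ∈ C.filter (fun h => v ∈ vs h ∧ h ∉ σ.H), qq es all p σ h ≤
          p ^ s * (if h ∈ σ.U then (if low v (σ.H.erase h) then (1:ℝ) else 0) else 0) +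
          (if ¬ Disjoint (es h) (σ.H.biUnion es) ∧ ¬ es h ⊆ σ.H.biUnion es then
            p ^ (es h \ σ.H.biUnion es).card else 0) := by
        intro h hh
        rw [Finset.mem_filter] at hh
        obtain ⟨hhC, hhv, hhH⟩ := hh
        have hq2 := qq_le (es := es) (all := all) hp hp1 hes σ h
        have hl := hlow v σ.H h hv
        simp only [if_pos hl]
        have hz : ∀ P : Prop, [Decidable P] → (0:ℝ) ≤ p ^ s * (if P then 1 else 0) := by
          intro P _
          split_ifs <;> simp <;> positivity
        have hz2 : ∀ P : Prop, [Decidable P] →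
            (0:ℝ) ≤ (if P then p ^ (es h \ σ.H.biUnion es).card else 0) := by
          intro P _
          split_ifs
          · positivity
          · exact le_rfl
        have hzero : (∀ G, ¬ (σ.yes h).ok es G) → qq es all p σ h = 0 := by
          intro hc
          simp [qq, Zw, hc]
        by_cases hd : Disjoint (es h) (σ.H.biUnion es)
        · rcases hcov h hhC with h1 | h1 | h1 | h1 | ⟨i, hi, h1⟩ | h1
          · simp at h1
          · exact absurd h1 hhH
          · rw [hzero]
            · exact add_nonneg (hz _) (hz2 _)
            · intro G hG
              rw [ok_yes'] at hG
              exact hG.1.2 h h1 hG.2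
          · rw [if_pos h1, mul_one]
            refine le_trans hq2 (le_trans ?_ (le_add_of_nonneg_right (hz2 _)))
            rw [hR, Finset.sdiff_eq_self_of_disjoint hd, hs h hhC]
          · rw [hzero]
            · exact add_nonneg (hz _) (hz2 _)
            · intro G hG
              rw [ok_yes'] at hG
              exact hG.1.2 i hi (h1.trans (Finset.union_subset hG.2 hG.1.1))
          · rw [hR] at h1
            exact absurd hd h1
        · have := hA σ.H hHC hb h hhC hhH
          rw [if_pos (⟨hd, this⟩ : _ ∧ _), ← hR]
          exact le_trans hq2 (le_add_of_nonneg_left (hz _))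
      refine le_trans (Finset.sum_le_sum h2) ?_
      rw [Finset.sum_add_distrib]
      apply add_le_add
      · apply Finset.sum_le_sum_of_subset_of_nonneg
        · intro h hh
          rw [Finset.mem_filter] at hh ⊢
          exact ⟨hh.1, hh.2.1⟩
        · intro h _ _
          apply mul_nonneg (by positivity)
          split_ifs <;> norm_num
      · refine le_trans ?_ (hV σ.H hHC hb v)
        rw [← Finset.sum_filter, Finset.filter_filter]
        apply Finset.sum_le_sum_of_subset_of_nonneg
        · intro h hh
          rw [Finset.mem_filter] at hh ⊢
          exact ⟨hh.1, hh.2.1.1, hh.2.2⟩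
        · intro h _ _
          positivity
  · -- expectations
    rw [Ex_add, Ex_sum]
    rw [Ex_H hq (fun H => if Bad H then 1 else 0), hExH]
    gcongr with v
    rw [Ex_add, Ex_sum, Ex_smul, Ex_H hq (fun H => if low v H then 1 else 0), hExH]
    gcongr with h hh
    rw [Ex_smul]
    gcongr
    have hhC := (Finset.mem_filter.1 hh).1
    have := Ex_tail (es := es) (all := all) hp hp1 hq hq1 hes h κ hκ0 (by rw [hs h hhC]; exact hκ)
      (fun H => if low v H then 1 else 0) (fun H => by split_ifs <;> norm_num)
      C.toList C.nodup_toList σ0 (by simp [hσ0])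
    rw [hExH] at this
    exact this

end absec


theorem exists_edge_of_conn {r : ℕ} {F : Finset (Finset (Fin r))} {T : Finset (Fin r)}
    (hc : ConnectedAvoiding F T) {x y : Fin r} (hx : x ∉ T) (hy : y ∉ T) (hxy : x ≠ y) :
    ∃ e ∈ F, Disjoint e T ∧ x ∈ e ∧ ∃ b ∈ e, b ≠ x := by
  by_contra hcon
  push Not at hcon
  have : ∀ z, Relation.ReflTransGen (fun a b => ∃ e ∈ F, Disjoint e T ∧ a ∈ e ∧ b ∈ e) x z →
      z = x := by
    intro z hz
    induction hz with
    | refl => rfl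
    | tail _ h2 ih =>
      obtain ⟨e, he, hd, ha, hb⟩ := h2
      rw [ih] at ha
      exact hcon e he hd ha _ hb
  exact hxy (this y (hc x y hx hy)).symm

theorem cover_lemma {r : ℕ} {F : Finset (Finset (Fin r))} (h3 : ThreeConnected F)
    {ι : Type*} (S : Finset ι) (W : ι → Finset (Fin r))
    (hcov : ∀ e ∈ F, ∃ i ∈ S, e ⊆ W i) (hne : ∀ i ∈ S, W i ≠ Finset.univ)
    (h2 : ∀ i ∈ S, 2 ≤ (W i).card) :
    S.card + r + 1 ≤ ∑ i ∈ S, (W i).card := by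
  obtain ⟨hr, h3⟩ := h3
  set d : Fin r → ℕ := fun v => (S.filter (fun i => v ∈ W i)).card with hd
  have hsum : ∑ i ∈ S, (W i).card = ∑ v, d v := by
    simp only [hd, Finset.card_filter]
    rw [Finset.sum_comm]
    apply Finset.sum_congr rfl
    intro i _
    simp
  have hother : ∀ v : Fin r, ∃ w, w ≠ v := by
    intro v
    have : 1 < Fintype.card (Fin r) := by simp; omega
    exact Fintype.exists_ne_of_one_lt_card this v
  have hd1 : ∀ v, 1 ≤ d v := by
    intro v
    obtain ⟨w, hw⟩ := hother v
    obtain ⟨e, he, -, hve, -⟩ := exists_edge_of_conn (h3 ∅ (by simp)) (x := v) (y := w)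
      (by simp) (by simp) hw.symm
    obtain ⟨i, hi, hei⟩ := hcov e he
    apply Finset.card_pos.2
    exact ⟨i, Finset.mem_filter.2 ⟨hi, hei hve⟩⟩
  set B : ι → Finset (Fin r) := fun i => (W i).filter (fun v => 2 ≤ d v) with hB
  have hBW : ∀ i ∈ S, (B i).card ≤ 2 → B i = W i := by
    intro i hi hc
    by_contra hcon
    have hsub : B i ⊆ W i := Finset.filter_subset _ _
    obtain ⟨x, hx, hxB⟩ := Finset.exists_of_ssubset (Finset.ssubset_iff_subset_ne.2 ⟨hsub, hcon⟩)
    obtain ⟨y, hy⟩ : ∃ y, y ∉ W i := by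
      by_contra hcc
      push Not at hcc
      exact hne i hi (Finset.eq_univ_iff_forall.2 hcc)
    have key : ∀ z, Relation.ReflTransGen
        (fun a b => ∃ e ∈ F, Disjoint e (B i) ∧ a ∈ e ∧ b ∈ e) x z → z ∈ W i ∧ z ∉ B i := by
      intro z hz
      induction hz with
      | refl => exact ⟨hx, hxB⟩
      | tail _ hs ih =>
        obtain ⟨e, he, hdis, ha, hb⟩ := hs
        obtain ⟨j, hj, hej⟩ := hcov e he
        rename_i a b _
        have hda : d a < 2 := by
          by_contra hcc
          exact ih.2 (Finset.mem_filter.2 ⟨ih.1, not_lt.1 hcc⟩)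
        have hij : i = j := by
          have : (S.filter (fun i => a ∈ W i)).card ≤ 1 := Nat.lt_succ_iff.1 hda
          rw [Finset.card_le_one] at this
          exact this i (Finset.mem_filter.2 ⟨hi, ih.1⟩) j (Finset.mem_filter.2 ⟨hj, hej ha⟩)
        rw [hij]
        refine ⟨hej hb, ?_⟩
        rw [← hij]
        exact fun hbB => Finset.disjoint_left.1 hdis hb hbB
    exact hy (key y (h3 (B i) hc x y hxB (fun h => hy (hsub h)))).1
  have hB2 : ∀ i ∈ S, 2 ≤ (B i).card := by
    intro i hi
    by_contra hcon
    have := hBW i hi (by omega)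
    rw [this] at hcon
    exact hcon (h2 i hi)
  have hsumB : ∑ i ∈ S, (B i).card = ∑ v, if 2 ≤ d v then d v else 0 := by
    have : ∀ v, (if 2 ≤ d v then d v else 0) = ∑ i ∈ S, if v ∈ B i then 1 else 0 := by
      intro v
      by_cases hv : 2 ≤ d v
      · have hm : ∀ i, v ∈ B i ↔ v ∈ W i := fun i => by
          simp only [hB, Finset.mem_filter, hv, and_true]
        simp only [hm, if_pos hv]
        rw [← Finset.card_filter]
      · simp only [hB, Finset.mem_filter, hv, and_false, if_false]
        simp
    simp only [this]
    rw [Finset.sum_comm]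
    apply Finset.sum_congr rfl
    intro i _
    simp
  have hle : ∀ v ∈ Finset.univ, (if 2 ≤ d v then d v else 0) + 2 ≤ 2 * d v := by
    intro v _
    have := hd1 v
    split_ifs <;> omega
  have hsle := Finset.sum_le_sum hle
  rw [Finset.sum_add_distrib, ← hsumB, ← Finset.mul_sum] at hsle
  simp only [Finset.sum_const, Finset.card_univ, Fintype.card_fin, smul_eq_mul] at hsle
  have hk := Finset.sum_le_sum hB2
  simp only [Finset.sum_const, smul_eq_mul] at hk
  rw [hsum]
  by_contra hcon
  have heq1 : ∑ i ∈ S, 2 = ∑ i ∈ S, (B i).card := by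
    simp only [Finset.sum_const, smul_eq_mul]; omega
  have heq2 : ∑ v, ((if 2 ≤ d v then d v else 0) + 2) = ∑ v, 2 * d v := by
    rw [Finset.sum_add_distrib, ← hsumB, ← Finset.mul_sum]
    simp only [Finset.sum_const, Finset.card_univ, Fintype.card_fin, smul_eq_mul]
    omega
  have e1 := (Finset.sum_eq_sum_iff_of_le hB2).1 heq1
  have e2 := (Finset.sum_eq_sum_iff_of_le hle).1 heq2
  have e3 : ∀ i ∈ S, (W i).card = 2 := by
    intro i hi
    rw [← hBW i hi (e1 i hi).ge, ← e1 i hi]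
  let v : Fin r := ⟨0, by omega⟩
  have hv2 : d v = 2 := by
    have := e2 v (Finset.mem_univ _)
    have h1 := hd1 v
    obtain ⟨i, hi⟩ := Finset.card_pos.1 (show 0 < d v from h1)
    rw [Finset.mem_filter] at hi
    rw [← hBW i hi.1 (e1 i hi.1).ge] at hi
    have h5 := (Finset.mem_filter.1 hi.2).2
    rw [if_pos h5] at this
    omega
  obtain ⟨i, j, hij, hS⟩ := Finset.card_eq_two.1 hv2
  have hi : i ∈ S ∧ v ∈ W i := by
    rw [← Finset.mem_filter (p := fun i => v ∈ W i), hS]; simp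
  have hj : j ∈ S ∧ v ∈ W j := by
    rw [← Finset.mem_filter (p := fun i => v ∈ W i), hS]; simp
  set T := (W i).erase v ∪ (W j).erase v with hT
  have hTc : T.card ≤ 2 := by
    refine (Finset.card_union_le _ _).trans ?_
    rw [Finset.card_erase_of_mem hi.2, Finset.card_erase_of_mem hj.2, e3 i hi.1, e3 j hj.1]
  have hvT : v ∉ T := by simp [hT]
  obtain ⟨z, hz⟩ : ∃ z, z ∉ insert v T := by
    by_contra hcc
    push Not at hcc
    have h1 := Finset.eq_univ_iff_forall.2 hcc
    have h2 := Finset.card_insert_le v T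
    rw [h1] at h2
    simp at h2
    omega
  rw [Finset.mem_insert, not_or] at hz
  obtain ⟨e, he, hdis, hve, b, hb, hbv⟩ := exists_edge_of_conn (h3 T hTc) hvT hz.2 (Ne.symm hz.1)
  obtain ⟨l, hl, hel⟩ := hcov e he
  have hlS : l ∈ S.filter (fun i => v ∈ W i) := Finset.mem_filter.2 ⟨hl, hel hve⟩
  rw [hS] at hlS
  apply Finset.disjoint_left.1 hdis hb
  rw [hT, Finset.mem_union]
  simp only [Finset.mem_insert, Finset.mem_singleton] at hlS
  rcases hlS with rfl | rfl
  · left; exact Finset.mem_erase.2 ⟨hbv, hel hb⟩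
  · right; exact Finset.mem_erase.2 ⟨hbv, hel hb⟩

theorem IsFEdge.card_fst {r : ℕ} {F : Finset (Finset (Fin r))} {n : ℕ} {h : FE n}
    (hh : IsFEdge F n h) : h.1.card = r := by
  obtain ⟨φ, h1, -⟩ := hh
  rw [h1]; simp

theorem map_edge_inj {r n : ℕ} (φ : Fin r ↪ Fin n) :
    Function.Injective (fun e : Finset (Fin r) => e.map φ) := Finset.map_injective φ

theorem IsFEdge.card_snd {r : ℕ} {F : Finset (Finset (Fin r))} {n : ℕ} {h : FE n}
    (hh : IsFEdge F n h) : h.2.card = F.card := by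
  obtain ⟨φ, -, h2⟩ := hh
  rw [h2, Finset.card_image_of_injective _ (map_edge_inj φ)]

theorem IsFEdge.sub {r : ℕ} {F : Finset (Finset (Fin r))} {n : ℕ} {h : FE n}
    (hh : IsFEdge F n h) {e : Finset (Fin n)} (he : e ∈ h.2) : e ⊆ h.1 := by
  obtain ⟨φ, h1, h2⟩ := hh
  rw [h2, Finset.mem_image] at he
  obtain ⟨e', -, rfl⟩ := he
  rw [h1]
  exact Finset.map_subset_map.2 (Finset.subset_univ _)

theorem IsFEdge.ecard {r u : ℕ} {F : Finset (Finset (Fin r))} (hu : ∀ e ∈ F, e.card = u)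
    {n : ℕ} {h : FE n}
    (hh : IsFEdge F n h) {e : Finset (Fin n)} (he : e ∈ h.2) : e.card = u := by
  obtain ⟨φ, h1, h2⟩ := hh
  rw [h2, Finset.mem_image] at he
  obtain ⟨e', he', rfl⟩ := he
  rw [Finset.card_map]
  exact hu e' he'

/-- two copies on the same vertex set differing in one edge -/
theorem nice_contra {r n : ℕ} {F : Finset (Finset (Fin r))} (hu : ∀ e ∈ F, e.card = 2)
    (hN : ¬ ∃ a b : Finset (Fin r), a.card = 2 ∧ a ∉ F ∧ b ∈ F ∧
      EdgeIso (insert a (F.erase b)) F)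
    {h h₁ : FE n} (hh : IsFEdge F n h) (hh₁ : IsFEdge F n h₁) (hV : h₁.1 = h.1)
    (e : Finset (Fin n)) (he : h.2 \ h₁.2 = {e}) : False := by
  have hc : h.2.card = h₁.2.card := by rw [hh.card_snd, hh₁.card_snd]
  have hc2 : (h₁.2 \ h.2).card = 1 := by
    have := Finset.card_sdiff_add_card_inter h.2 h₁.2
    have h2 := Finset.card_sdiff_add_card_inter h₁.2 h.2
    rw [he, Finset.card_singleton] at this
    rw [Finset.inter_comm] at h2
    omega
  obtain ⟨e1, he1⟩ := Finset.card_eq_one.1 hc2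
  have hem : e ∈ h.2 ∧ e ∉ h₁.2 := by
    rw [← Finset.mem_sdiff, he]; simp
  have hem1 : e1 ∈ h₁.2 ∧ e1 ∉ h.2 := by
    rw [← Finset.mem_sdiff, he1]; simp
  have heq : h.2 = insert e (h₁.2.erase e1) := by
    ext x
    have q1 := congrArg (x ∈ ·) he
    have q2 := congrArg (x ∈ ·) he1
    simp only [Finset.mem_sdiff, Finset.mem_singleton, eq_iff_iff] at q1 q2
    rw [Finset.mem_insert, Finset.mem_erase]
    tauto
  have hecard := hh.ecard hu hem.1
  have hesub : e ⊆ h₁.1 := hV ▸ hh.sub hem.1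
  obtain ⟨φ, a1, a2⟩ := hh
  obtain ⟨φ₁, b1, b2⟩ := hh₁
  have hτ : ∀ x, ∃ y, φ y = φ₁ x := by
    intro x
    have : φ₁ x ∈ h.1 := by rw [← hV, b1]; simp
    rw [a1] at this
    simpa using this
  choose τ hτ using hτ
  have hτi : Function.Injective τ := by
    intro x y hxy
    apply φ₁.injective
    rw [← hτ, ← hτ, hxy]
  let T : Equiv.Perm (Fin r) := Equiv.ofBijective τ (Finite.injective_iff_bijective.1 hτi)
  obtain ⟨b, hb, hbe⟩ := Finset.mem_image.1 (b2 ▸ hem1.1)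
  set a : Finset (Fin r) := Finset.univ.filter (fun x => φ₁ x ∈ e) with ha
  have hae : a.map φ₁ = e := by
    ext x
    simp only [ha, Finset.mem_map, Finset.mem_filter, Finset.mem_univ, true_and]
    constructor
    · rintro ⟨y, hy, rfl⟩; exact hy
    · intro hx
      have := hesub hx
      rw [b1] at this
      obtain ⟨y, -, rfl⟩ := Finset.mem_map.1 this
      exact ⟨y, hx, rfl⟩
  have haF : a ∉ F := by
    intro h
    apply hem.2
    rw [b2, ← hae]
    exact Finset.mem_image_of_mem (fun e : Finset (Fin r) => e.map φ₁) h
  apply hN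
  refine ⟨a, b, ?_, haF, hb, T, ?_⟩
  · rw [← hecard, ← hae, Finset.card_map]
  · apply Finset.image_injective (map_edge_inj φ)
    rw [← a2, heq, Finset.image_image]
    have hcomp : ((fun e : Finset (Fin r) => e.map φ) ∘
        fun e : Finset (Fin r) => e.image (fun x => T x)) = fun e : Finset (Fin r) => e.map φ₁ := by
      funext e
      simp only [Function.comp]
      ext x
      simp only [Finset.mem_map, Finset.mem_image]
      constructor
      · rintro ⟨y, ⟨z, hz, rfl⟩, rfl⟩
        exact ⟨z, hz, (hτ z).symm⟩
      · rintro ⟨z, hz, rfl⟩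
        exact ⟨T z, ⟨z, hz, rfl⟩, hτ z⟩
    rw [hcomp, Finset.image_insert, Finset.image_erase (map_edge_inj φ₁), ← b2, hae, hbe]

theorem card_VS {r n : ℕ} (S : Finset (FE n)) (A : Finset (Fin n)) (hA : A.card = r)
    (hS : ∀ i ∈ S, i.1.card = r) (hsum : S.card + r + 1 ≤ ∑ i ∈ S, (i.1 ∩ A).card) :
    (S.biUnion Prod.fst).card + 1 ≤ (r - 1) * S.card := by
  have h1 : (S.biUnion Prod.fst) ⊆ A ∪ S.biUnion (fun i => i.1 \ A) := by
    intro x hx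
    obtain ⟨i, hi, hx⟩ := Finset.mem_biUnion.1 hx
    by_cases hxA : x ∈ A
    · exact Finset.mem_union_left _ hxA
    · exact Finset.mem_union_right _ (Finset.mem_biUnion.2 ⟨i, hi, Finset.mem_sdiff.2 ⟨hx, hxA⟩⟩)
  have h2 := (Finset.card_le_card h1).trans ((Finset.card_union_le _ _).trans
    (Nat.add_le_add_left Finset.card_biUnion_le _))
  have h3 : ∑ i ∈ S, (i.1 \ A).card + ∑ i ∈ S, (i.1 ∩ A).card = r * S.card := by
    rw [← Finset.sum_add_distrib, Finset.sum_congr rfl (fun i hi => by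
      rw [Finset.card_sdiff_add_card_inter, hS i hi]), Finset.sum_const, smul_eq_mul, mul_comm]
  rw [Nat.sub_mul, one_mul]
  omega

theorem struct_lemma {r n u : ℕ} (hu2 : 2 ≤ u) {F : Finset (Finset (Fin r))}
    (hu : ∀ e ∈ F, e.card = u) (hF : Nice u F) (H : Finset (FE n))
    (hH : ∀ h ∈ H, IsFEdge F n h) (h : FE n) (hh : IsFEdge F n h) (hhH : h ∉ H)
    (hsub : h.2 ⊆ H.biUnion Prod.snd) :
    ∃ S ⊆ H, 1 ≤ S.card ∧ S.card ≤ F.card ∧ (S.biUnion Prod.fst).card + 1 ≤ (r - 1) * S.card := by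
  have hex : ∀ e : Finset (Fin n), ∃ i : FE n, e ∈ h.2 → i ∈ H ∧ e ∈ i.2 := by
    intro e
    by_cases he : e ∈ h.2
    · obtain ⟨i, hi, hei⟩ := Finset.mem_biUnion.1 (hsub he)
      exact ⟨i, fun _ => ⟨hi, hei⟩⟩
    · exact ⟨h, fun h => absurd h he⟩
  choose f hf using hex
  set S := h.2.image f with hS
  have hSH : S ⊆ H := by
    intro i hi
    obtain ⟨e, he, rfl⟩ := Finset.mem_image.1 hi
    exact (hf e he).1
  have hScard : S.card ≤ F.card := by
    rw [← hh.card_snd]; exact Finset.card_image_le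
  have hSr : ∀ S' ⊆ S, ∀ i ∈ S', i.1.card = r := fun S' hS' i hi =>
    (hH i (hSH (hS' hi))).card_fst
  have hsubi : ∀ e ∈ h.2, e ⊆ (f e).1 ∩ h.1 := fun e he =>
    Finset.subset_inter ((hH _ (hf e he).1).sub (hf e he).2) (hh.sub he)
  have h2S : ∀ i ∈ S, u ≤ (i.1 ∩ h.1).card := by
    intro i hi
    obtain ⟨e, he, rfl⟩ := Finset.mem_image.1 hi
    rw [← hh.ecard hu he]
    exact Finset.card_le_card (hsubi e he)
  obtain ⟨hr, h3⟩ := hF.2.1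
  have hFne : F.Nonempty := by
    obtain ⟨e, he, -⟩ := exists_edge_of_conn (h3 ∅ (by simp)) (x := ⟨0, by omega⟩)
      (y := ⟨1, by omega⟩) (by simp) (by simp) (by simp)
    exact ⟨e, he⟩
  -- enough
  suffices hsuff : ∃ S' ⊆ S, S'.card + r + 1 ≤ ∑ i ∈ S', (i.1 ∩ h.1).card by
    obtain ⟨S', hS', hs⟩ := hsuff
    refine ⟨S', hS'.trans hSH, ?_, (Finset.card_le_card hS').trans hScard,
      card_VS S' h.1 hh.card_fst (hSr S' hS') hs⟩
    rcases S'.eq_empty_or_nonempty with rfl | hne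
    · simp at hs
    · exact hne.card_pos
  by_cases hc : ∃ h₁ ∈ S, h.1 ⊆ h₁.1
  · obtain ⟨h₁, hh₁, hsub1⟩ := hc
    have hh1F := hH h₁ (hSH hh₁)
    have hV : h₁.1 = h.1 := (Finset.eq_of_subset_of_card_le hsub1 (by
      rw [hh.card_fst, hh1F.card_fst])).symm
    have hne : (h.2 \ h₁.2).Nonempty := by
      rw [Finset.sdiff_nonempty]
      intro hcon
      have h2 : h.2 = h₁.2 := Finset.eq_of_subset_of_card_le hcon (by
        rw [hh.card_snd, hh1F.card_snd])
      have : h = h₁ := Prod.ext hV.symm h2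
      exact hhH (this ▸ hSH hh₁)
    have hne1 : ∀ e ∈ h.2 \ h₁.2, f e ≠ h₁ ∧ f e ∈ S := by
      intro e he
      rw [Finset.mem_sdiff] at he
      exact ⟨fun hcon => he.2 (hcon ▸ (hf e he.1).2), Finset.mem_image_of_mem f he.1⟩
    have ha1 : (h₁.1 ∩ h.1).card = r := by rw [hV, Finset.inter_self, hh.card_fst]
    obtain ⟨e, he⟩ := hne
    obtain ⟨q1, q2⟩ := hne1 e he
    by_cases ha : 3 ≤ ((f e).1 ∩ h.1).card
    · refine ⟨{h₁, f e}, by simp [Finset.insert_subset_iff, hh₁, q2], ?_⟩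
      rw [Finset.card_pair q1.symm, Finset.sum_pair q1.symm, ha1]
      omega
    · have hue : u = 2 := by have := h2S _ q2; omega
      by_cases hex2 : ∃ e' ∈ h.2 \ h₁.2, e' ≠ e
      · obtain ⟨e', he', hee⟩ := hex2
        obtain ⟨q3, q4⟩ := hne1 e' he'
        have q5 : f e ≠ f e' := by
          intro hcon
          apply ha
          have he1 := (Finset.mem_sdiff.1 he).1
          have he2 := (Finset.mem_sdiff.1 he').1
          have hun : e ∪ e' ⊆ (f e).1 ∩ h.1 :=
            Finset.union_subset (hsubi e he1) (by rw [hcon]; exact hsubi e' he2)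
          refine le_trans ?_ (Finset.card_le_card hun)
          by_contra hlt
          have c1 := hh.ecard hu he1
          have c2 := hh.ecard hu he2
          have t1 : e = e ∪ e' := Finset.eq_of_subset_of_card_le Finset.subset_union_left
            (by omega)
          have t2 : e' = e ∪ e' := Finset.eq_of_subset_of_card_le Finset.subset_union_right
            (by omega)
          exact hee (t2.trans t1.symm)
        refine ⟨{h₁, f e, f e'}, by simp [Finset.insert_subset_iff, hh₁, q2, q4], ?_⟩
        have hn : h₁ ∉ ({f e, f e'} : Finset (FE n)) := by
          simp only [Finset.mem_insert, Finset.mem_singleton, not_or]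
          exact ⟨q1.symm, q3.symm⟩
        rw [Finset.card_insert_of_notMem hn, Finset.sum_insert hn, Finset.card_pair q5,
          Finset.sum_pair q5, ha1]
        have := h2S _ q2
        have := h2S _ q4
        omega
      · exfalso
        push Not at hex2
        have hsing : h.2 \ h₁.2 = {e} := by
          ext x
          rw [Finset.mem_singleton]
          exact ⟨fun hx => hex2 x hx, fun hx => hx ▸ he⟩
        rcases hF.2.2 with h5 | ⟨-, h5⟩
        · omega
        · subst hue
          exact nice_contra hu h5 hh hh1F hV e hsing
  · refine ⟨S, Finset.Subset.refl _, ?_⟩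
    push Not at hc
    obtain ⟨φ, a1, a2⟩ := hh
    have hcd : ∀ i : FE n, (Finset.univ.filter (fun x => φ x ∈ i.1)).card = (i.1 ∩ h.1).card := by
      intro i
      rw [← Finset.card_map φ]
      congr 1
      ext x
      simp only [a1, Finset.mem_map, Finset.mem_filter, Finset.mem_univ, true_and,
        Finset.mem_inter]
      constructor
      · rintro ⟨y, hy, rfl⟩; exact ⟨hy, y, rfl⟩
      · rintro ⟨hy, y, rfl⟩; exact ⟨y, hy, rfl⟩
    have := cover_lemma hF.2.1 S (fun i => Finset.univ.filter (fun x => φ x ∈ i.1)) (by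
      intro e he
      have he' : e.map φ ∈ h.2 := by
        rw [a2]; exact Finset.mem_image_of_mem (fun e : Finset (Fin r) => e.map φ) he
      refine ⟨f (e.map φ), Finset.mem_image_of_mem _ he', ?_⟩
      intro x hx
      rw [Finset.mem_filter]
      refine ⟨Finset.mem_univ _, ?_⟩
      exact (Finset.mem_inter.1 (hsubi _ he' (Finset.mem_map_of_mem φ hx))).1) (by
      intro i hi hcon
      apply hc i hi
      rw [a1]
      intro x hx
      obtain ⟨y, -, rfl⟩ := Finset.mem_map.1 hx
      have : y ∈ Finset.univ.filter (fun x => φ x ∈ i.1) := by rw [hcon]; simp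
      exact (Finset.mem_filter.1 this).2) (by
      intro i hi
      rw [hcd]
      exact hu2.trans (h2S i hi))
    simpa only [hcd] using this


/-- closed neighbourhood of a vertex in an `F`-graph -/
def nbrFE {n : ℕ} (H : Finset (FE n)) (x : Fin n) : Finset (Fin n) :=
  insert x ((H.filter (fun h => x ∈ h.1)).biUnion Prod.fst)

def ballFE {n : ℕ} (H : Finset (FE n)) (x : Fin n) : ℕ → Finset (Fin n)
  | 0 => {x}
  | k + 1 => (ballFE H x k).biUnion (nbrFE H)

theorem nbrFE_card {r n D : ℕ} {H : Finset (FE n)} (hr : ∀ h ∈ H, h.1.card = r)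
    (hD : ∀ v, degFE H v ≤ D) (x : Fin n) : (nbrFE H x).card ≤ 1 + r * D := by
  refine (Finset.card_insert_le _ _).trans ?_
  have : ((H.filter (fun h => x ∈ h.1)).biUnion Prod.fst).card ≤ r * D := by
    refine (Finset.card_biUnion_le_card_mul _ _ r ?_).trans ?_
    · intro h hh
      exact (hr h (Finset.mem_filter.1 hh).1).le
    · rw [mul_comm]
      exact Nat.mul_le_mul_left _ (hD x)
  omega

theorem ballFE_card {r n D : ℕ} {H : Finset (FE n)} (hr : ∀ h ∈ H, h.1.card = r)
    (hD : ∀ v, degFE H v ≤ D) (x : Fin n) (k : ℕ) : (ballFE H x k).card ≤ (1 + r * D) ^ k := by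
  induction k with
  | zero => simp [ballFE]
  | succ k ih =>
    unfold ballFE
    refine (Finset.card_biUnion_le_card_mul _ _ (1 + r * D) ?_).trans ?_
    · intro y _
      exact nbrFE_card hr hD y
    · rw [pow_succ]
      exact Nat.mul_le_mul_right _ ih

theorem ballFE_mono {n : ℕ} (H : Finset (FE n)) (x : Fin n) {k l : ℕ} (h : k ≤ l) :
    ballFE H x k ⊆ ballFE H x l := by
  induction l, h using Nat.le_induction with
  | base => exact Finset.Subset.refl _
  | succ l _ ih =>
    refine ih.trans ?_
    intro y hy
    unfold ballFE
    exact Finset.mem_biUnion.2 ⟨y, hy, Finset.mem_insert_self _ _⟩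

/-- the graph whose cliques are the edges -/
def cliqueG {r : ℕ} (E' : Finset (Finset (Fin r))) : SimpleGraph (Fin r) where
  Adj a b := a ≠ b ∧ ∃ e ∈ E', a ∈ e ∧ b ∈ e
  symm := ⟨by rintro a b ⟨h, e, he, h1, h2⟩; exact ⟨h.symm, e, he, h2, h1⟩⟩
  loopless := ⟨fun a h => h.1 rfl⟩

theorem walk_ball {r n : ℕ} {H : Finset (FE n)} {F E' : Finset (Finset (Fin r))}
    (hH : ∀ h ∈ H, IsFEdge F n h) (φ : Fin r ↪ Fin n)
    (hφ : ∀ e ∈ E', e.map φ ∈ H.biUnion Prod.snd) {x y : Fin r} (w : (cliqueG E').Walk x y) :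
    φ x ∈ ballFE H (φ y) w.length := by
  induction w with
  | nil => simp [ballFE]
  | cons hadj w ih =>
    have hadj' := hadj
    obtain ⟨-, e, he, ha, hb⟩ := hadj'
    rw [SimpleGraph.Walk.length_cons]
    unfold ballFE
    refine Finset.mem_biUnion.2 ⟨_, ih, ?_⟩
    obtain ⟨h, hh, heh⟩ := Finset.mem_biUnion.1 (hφ e he)
    have hsub := (hH h hh).sub heh
    apply Finset.mem_insert_of_mem
    refine Finset.mem_biUnion.2 ⟨h, Finset.mem_filter.2 ⟨hh, ?_⟩, ?_⟩
    · exact hsub (Finset.mem_map_of_mem φ hb)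
    · exact hsub (Finset.mem_map_of_mem φ ha)

theorem count_embed {r n D : ℕ} {H : Finset (FE n)} {F E' : Finset (Finset (Fin r))}
    (hH : ∀ h ∈ H, IsFEdge F n h) (hD : ∀ v, degFE H v ≤ D) (x0 : Fin r) (v : Fin n) :
    (Finset.univ.filter (fun φ : Fin r ↪ Fin n => φ x0 = v ∧
      ∀ e ∈ E', e.map φ ∈ H.biUnion Prod.snd)).card ≤
      n ^ (Fintype.card (cliqueG E').ConnectedComponent - 1) * (1 + r * D) ^ (r * r) := by
  set Q := (cliqueG E').ConnectedComponent with hQ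
  set A := (Finset.univ.filter (fun φ : Fin r ↪ Fin n => φ x0 = v ∧
      ∀ e ∈ E', e.map φ ∈ H.biUnion Prod.snd)) with hA
  set q0 : Q := (cliqueG E').connectedComponentMk x0 with hq0
  have hroot : ∃ root : Q → Fin r, root q0 = x0 ∧
      ∀ q, (cliqueG E').connectedComponentMk (root q) = q := by
    have : ∀ q : Q, ∃ y, (cliqueG E').connectedComponentMk y = q ∧ (q = q0 → y = x0) := by
      intro q
      by_cases h : q = q0
      · exact ⟨x0, h.symm, fun _ => rfl⟩
      · obtain ⟨y, hy⟩ := q.exists_rep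
        exact ⟨y, hy, fun h' => absurd h' h⟩
    choose root h1 h2 using this
    exact ⟨root, h2 q0 rfl, h1⟩
  obtain ⟨root, hr0, hr1⟩ := hroot
  set B : Finset (Q → Fin n) := Fintype.piFinset
    (fun q => if q = q0 then ({v} : Finset (Fin n)) else Finset.univ) with hB
  have hBcard : B.card = n ^ (Fintype.card Q - 1) := by
    rw [hB, Fintype.card_piFinset]
    rw [← Finset.mul_prod_erase _ _ (Finset.mem_univ q0)]
    rw [Finset.prod_congr rfl (g := fun _ => n)]
    · simp [Finset.card_erase_of_mem]
    · intro q hq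
      rw [if_neg (Finset.ne_of_mem_erase hq)]
      simp
  have hmaps : ∀ φ ∈ A, (fun q => φ (root q)) ∈ B := by
    intro φ hφ
    rw [hB, Fintype.mem_piFinset]
    intro q
    split_ifs with h
    · rw [h, hr0, Finset.mem_singleton]
      exact (Finset.mem_filter.1 hφ).2.1
    · exact Finset.mem_univ _
  have hfib : ∀ ψ ∈ B, (A.filter (fun φ => (fun q => φ (root q)) = ψ)).card ≤
      (1 + r * D) ^ (r * r) := by
    intro ψ _
    have hinj : ((A.filter (fun φ => (fun q => φ (root q)) = ψ)).image
        (fun φ : Fin r ↪ Fin n => (φ : Fin r → Fin n))) ⊆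
        Fintype.piFinset (fun y => ballFE H (ψ ((cliqueG E').connectedComponentMk y)) r) := by
      intro f hf
      obtain ⟨φ, hφ, rfl⟩ := Finset.mem_image.1 hf
      rw [Finset.mem_filter] at hφ
      rw [Fintype.mem_piFinset]
      intro y
      rw [← hφ.2]
      have hreach : (cliqueG E').Reachable y (root ((cliqueG E').connectedComponentMk y)) := by
        rw [← SimpleGraph.ConnectedComponent.eq, hr1]
      obtain ⟨w, hw⟩ := hreach.exists_isPath
      have hl := hw.length_lt
      rw [Fintype.card_fin] at hl
      exact ballFE_mono H _ hl.le (walk_ball hH φ (Finset.mem_filter.1 hφ.1).2.2 w)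
    have hc := Finset.card_le_card hinj
    rw [Finset.card_image_of_injective _ DFunLike.coe_injective, Fintype.card_piFinset] at hc
    refine hc.trans ((Finset.prod_le_prod' (fun y _ =>
      ballFE_card (fun h hh => (hH h hh).card_fst) hD _ r)).trans ?_)
    simp [← pow_mul]
  rw [Finset.card_eq_sum_card_fiberwise hmaps]
  refine (Finset.sum_le_sum hfib).trans ?_
  rw [Finset.sum_const, smul_eq_mul, hBcard]

theorem density {r u : ℕ} (hu2 : 2 ≤ u) {F E' : Finset (Finset (Fin r))}
    (hu : ∀ e ∈ F, e.card = u) (hF : StrictlyOneBalanced F) (hE : E' ⊆ F) (hne : E'.Nonempty)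
    (hneF : E' ≠ F) :
    E'.card * (r - 1) + 1 + F.card * Fintype.card (cliqueG E').ConnectedComponent
      ≤ F.card * r := by
  set Q := (cliqueG E').ConnectedComponent with hQ
  set mk : Fin r → Q := (cliqueG E').connectedComponentMk with hmk
  let Vq : Q → Finset (Fin r) := fun q => Finset.univ.filter (fun x => mk x = q)
  let Eqq : Q → Finset (Finset (Fin r)) := fun q => E'.filter (fun e => e ⊆ Vq q)
  have hne1 : ∀ e ∈ E', e.Nonempty := fun e he => by
    rw [← Finset.card_pos, hu e (hE he)]; omega
  have hVpos : ∀ q, 1 ≤ (Vq q).card := by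
    intro q
    obtain ⟨y, hy⟩ := q.exists_rep
    exact Finset.card_pos.2 ⟨y, Finset.mem_filter.2 ⟨Finset.mem_univ _, hy⟩⟩
  have hVsum : ∑ q, (Vq q).card = r := by
    have := Finset.card_eq_sum_card_fiberwise (f := mk) (s := Finset.univ) (t := Finset.univ)
      (fun _ _ => Finset.mem_univ _)
    rw [Finset.card_univ, Fintype.card_fin] at this
    exact this.symm
  have hsame : ∀ e ∈ E', ∀ a ∈ e, ∀ b ∈ e, mk a = mk b := by
    intro e he a ha b hb
    by_cases hab : a = b
    · rw [hab]
    · apply SimpleGraph.ConnectedComponent.sound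
      exact SimpleGraph.Adj.reachable ⟨hab, e, he, ha, hb⟩
  have hEsum : ∑ q, (Eqq q).card = E'.card := by
    have h1 : E' = Finset.univ.biUnion Eqq := by
      ext e
      constructor
      · intro he
        obtain ⟨a, ha⟩ := hne1 e he
        refine Finset.mem_biUnion.2 ⟨mk a, Finset.mem_univ _, Finset.mem_filter.2 ⟨he, ?_⟩⟩
        intro b hb
        exact Finset.mem_filter.2 ⟨Finset.mem_univ _, hsame e he b hb a ha⟩
      · intro he
        obtain ⟨q, -, hq⟩ := Finset.mem_biUnion.1 he
        exact (Finset.mem_filter.1 hq).1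
    conv_rhs => rw [h1]
    rw [Finset.card_biUnion]
    intro q _ q' _ hqq
    change Disjoint (Eqq q) (Eqq q')
    rw [Finset.disjoint_left]
    intro e he he'
    rw [Finset.mem_filter] at he he'
    obtain ⟨a, ha⟩ := hne1 e he.1
    have h1 := (Finset.mem_filter.1 (he.2 ha)).2
    have h2 := (Finset.mem_filter.1 (he'.2 ha)).2
    exact hqq (h1.symm.trans h2)
  have hstrict : ∀ q, 1 < (Vq q).card →
      (Eqq q).card * (r - 1) < F.card * ((Vq q).card - 1) := by
    intro q hq
    apply hF (Vq q) (Eqq q) ((Finset.filter_subset _ _).trans hE)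
      (fun e he => (Finset.mem_filter.1 he).2) hq
    rintro ⟨-, h2⟩
    apply hneF
    apply Finset.Subset.antisymm hE
    rw [← h2]
    exact Finset.filter_subset _ _
  have hle : ∀ q ∈ Finset.univ, (Eqq q).card * (r - 1) ≤ F.card * ((Vq q).card - 1) := by
    intro q _
    by_cases hq : 1 < (Vq q).card
    · exact (hstrict q hq).le
    · have : (Eqq q).card = 0 := by
        rw [Finset.card_eq_zero, Finset.eq_empty_iff_forall_notMem]
        intro e he
        rw [Finset.mem_filter] at he
        have h1 := Finset.card_le_card he.2
        rw [hu e (hE he.1)] at h1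
        omega
      rw [this, zero_mul]
      exact Nat.zero_le _
  have hlt : ∑ q, (Eqq q).card * (r - 1) < ∑ q, F.card * ((Vq q).card - 1) := by
    apply Finset.sum_lt_sum hle
    obtain ⟨e, he⟩ := hne
    obtain ⟨a, ha⟩ := hne1 e he
    refine ⟨mk a, Finset.mem_univ _, hstrict _ ?_⟩
    have hsub : e ⊆ Vq (mk a) := fun b hb =>
      Finset.mem_filter.2 ⟨Finset.mem_univ _, hsame e he b hb a ha⟩
    have h1 := Finset.card_le_card hsub
    rw [hu e (hE he)] at h1
    omega
  rw [← Finset.sum_mul, hEsum, ← Finset.mul_sum] at hlt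
  have hs1 : ∑ q, ((Vq q).card - 1) + Fintype.card Q = r := by
    refine Eq.trans ?_ hVsum
    rw [← Finset.card_univ, Finset.card_eq_sum_ones, ← Finset.sum_add_distrib]
    apply Finset.sum_congr rfl
    intro q _
    have := hVpos q
    omega
  calc E'.card * (r - 1) + 1 + F.card * Fintype.card Q
      ≤ F.card * ∑ q, ((Vq q).card - 1) + F.card * Fintype.card Q := by
        have := hlt; gcongr; omega
    _ = F.card * r := by rw [← mul_add, hs1]

theorem analytic_bound {r n s e' c : ℕ} (hn : 1 ≤ n) (hr : 1 ≤ r) (hc : 1 ≤ c) (hes : e' ≤ s)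
    (hs : 1 ≤ s) {p L : ℝ} (hp : 0 < p) (hL : 1 ≤ L) (hpL : (n : ℝ) ^ (r - 1) * p ^ s ≤ L)
    (hd : e' * (r - 1) + 1 + s * c ≤ s * r) :
    (n : ℝ) ^ (c - 1) * p ^ (s - e') ≤ (n : ℝ) ^ (-(1 : ℝ) / s) * L := by
  have hn0 : (1 : ℝ) ≤ n := by exact_mod_cast hn
  have hnpos : (0 : ℝ) < n := by linarith
  have hs0 : s ≠ 0 := by omega
  apply le_of_pow_le_pow_left₀ hs0 (by positivity)
  have h1 : ((n : ℝ) ^ (-(1 : ℝ) / s)) ^ s = (n : ℝ)⁻¹ := by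
    rw [← Real.rpow_natCast, ← Real.rpow_mul hnpos.le, div_mul_cancel₀ _ (by positivity),
      Real.rpow_neg_one]
  rw [mul_pow, mul_pow, h1]
  obtain ⟨r', rfl⟩ : ∃ r', r = r' + 1 := ⟨r - 1, by omega⟩
  obtain ⟨c', rfl⟩ : ∃ c', c = c' + 1 := ⟨c - 1, by omega⟩
  obtain ⟨f, rfl⟩ : ∃ f, s = e' + f := ⟨s - e', by omega⟩
  simp only [Nat.add_sub_cancel, Nat.add_sub_cancel_left] at hd hpL ⊢
  have hexp : c' * (e' + f) + 1 ≤ r' * f := by nlinarith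
  have h2 : ((n : ℝ) ^ r' * p ^ (e' + f)) ^ f ≤ L ^ (e' + f) := by
    calc ((n : ℝ) ^ r' * p ^ (e' + f)) ^ f ≤ L ^ f := by gcongr
      _ ≤ L ^ (e' + f) := pow_le_pow_right₀ hL (by omega)
  rw [inv_mul_eq_div, le_div_iff₀ hnpos]
  refine le_trans ?_ h2
  rw [mul_pow, ← pow_mul, ← pow_mul, ← pow_mul, ← pow_mul]
  calc (n : ℝ) ^ (c' * (e' + f)) * p ^ (f * (e' + f)) * n
      = (n : ℝ) ^ (c' * (e' + f) + 1) * p ^ ((e' + f) * f) := by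
        rw [pow_succ, mul_comm f (e' + f)]; ring
    _ ≤ _ := by gcongr

theorem count_lemma {r n u D : ℕ} (hu2 : 2 ≤ u) (hr : 1 ≤ r) {F : Finset (Finset (Fin r))}
    (hu : ∀ e ∈ F, e.card = u) (hF : StrictlyOneBalanced F) (hs : 1 ≤ F.card) (hn : 1 ≤ n)
    (H : Finset (FE n)) (hH : ∀ h ∈ H, IsFEdge F n h) (hD : ∀ v, degFE H v ≤ D)
    {p L : ℝ} (hp : 0 < p) (hL : 1 ≤ L)
    (hpL : (n : ℝ) ^ (r - 1) * p ^ F.card ≤ L) (v : Fin n) :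
    ∑ i ∈ (allFEdges F n).filter (fun i => v ∈ i.1 ∧ ¬ Disjoint i.2 (H.biUnion Prod.snd) ∧
        ¬ i.2 ⊆ H.biUnion Prod.snd), p ^ (i.2 \ H.biUnion Prod.snd).card ≤
      2 ^ F.card * r * (1 + r * D) ^ (r * r) * ((n : ℝ) ^ (-(1 : ℝ) / F.card) * L) := by
  set R := H.biUnion Prod.snd with hR
  set X := (allFEdges F n).filter (fun i => v ∈ i.1 ∧ ¬ Disjoint i.2 R ∧ ¬ i.2 ⊆ R) with hX
  -- the copies with given data
  set K : ℝ := (1 + r * D) ^ (r * r) * ((n : ℝ) ^ (-(1 : ℝ) / F.card) * L) with hK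
  have hK0 : 0 ≤ K := by positivity
  let emb : (Fin r ↪ Fin n) → FE n := fun φ => (Finset.univ.map φ, F.image (fun e => e.map φ))
  let P := (F.powerset.filter (fun E' => E'.Nonempty ∧ E' ≠ F)) ×ˢ (Finset.univ : Finset (Fin r))
  let A : Finset (Finset (Fin r)) × Fin r → Finset (Fin r ↪ Fin n) := fun x =>
    Finset.univ.filter (fun φ => φ x.2 = v ∧ F.filter (fun e => e.map φ ∈ R) = x.1)
  have hcover : X ⊆ P.biUnion (fun x => (A x).image emb) := by
    intro i hi
    rw [hX, Finset.mem_filter] at hi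
    obtain ⟨hiC, hv, hd, hns⟩ := hi
    obtain ⟨φ, a1, a2⟩ := (Finset.mem_filter.1 hiC).2
    rw [a1] at hv
    obtain ⟨x0, -, hx0⟩ := Finset.mem_map.1 hv
    refine Finset.mem_biUnion.2 ⟨(F.filter (fun e => e.map φ ∈ R), x0), ?_, ?_⟩
    · rw [Finset.mem_product, Finset.mem_filter, Finset.mem_powerset]
      refine ⟨⟨Finset.filter_subset _ _, ?_, ?_⟩, Finset.mem_univ _⟩
      · rw [Finset.not_disjoint_iff] at hd
        obtain ⟨e, he, heR⟩ := hd
        rw [a2] at he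
        obtain ⟨e', he', rfl⟩ := Finset.mem_image.1 he
        exact ⟨e', Finset.mem_filter.2 ⟨he', heR⟩⟩
      · intro hcon
        apply hns
        intro e he
        rw [a2] at he
        obtain ⟨e', he', rfl⟩ := Finset.mem_image.1 he
        have h5 : e' ∈ F.filter (fun e => e.map φ ∈ R) := by
          simp only at hcon
          rw [hcon]; exact he'
        exact (Finset.mem_filter.1 h5).2
    · refine Finset.mem_image.2 ⟨φ, Finset.mem_filter.2 ⟨Finset.mem_univ _, hx0, rfl⟩, ?_⟩
      exact Prod.ext a1.symm a2.symm
  have hterm : ∀ x ∈ P, ∑ i ∈ (A x).image emb, p ^ (i.2 \ R).card ≤ K := by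
    rintro ⟨E', x0⟩ hx
    rw [Finset.mem_product, Finset.mem_filter, Finset.mem_powerset] at hx
    obtain ⟨⟨hE, hne, hneF⟩, -⟩ := hx
    simp only at hE hne hneF
    have hE' : E'.card ≤ F.card := Finset.card_le_card hE
    have hval : ∀ i ∈ (A (E', x0)).image emb, p ^ (i.2 \ R).card = p ^ (F.card - E'.card) := by
      intro i hi
      obtain ⟨φ, hφ, rfl⟩ := Finset.mem_image.1 hi
      obtain ⟨-, -, h2⟩ := Finset.mem_filter.1 hφ
      simp only at h2
      congr 1
      have : (F.image (fun e => e.map φ)) \ R = (F \ E').image (fun e => e.map φ) := by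
        ext e
        simp only [Finset.mem_sdiff, Finset.mem_image, ← h2, Finset.mem_filter]
        constructor
        · rintro ⟨⟨a, ha, rfl⟩, hR⟩
          exact ⟨a, ⟨ha, fun h => hR h.2⟩, rfl⟩
        · rintro ⟨a, ⟨ha, h⟩, rfl⟩
          exact ⟨⟨a, ha, rfl⟩, fun hR => h ⟨ha, hR⟩⟩
      change ((F.image (fun e => e.map φ)) \ R).card = _
      rw [this, Finset.card_image_of_injective _ (map_edge_inj φ), Finset.card_sdiff_of_subset hE]
    rw [Finset.sum_congr rfl hval, Finset.sum_const, nsmul_eq_mul]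
    have hcnt : ((A (E', x0)).image emb).card ≤
        n ^ (Fintype.card (cliqueG E').ConnectedComponent - 1) * (1 + r * D) ^ (r * r) := by
      refine Finset.card_image_le.trans (le_trans (Finset.card_le_card ?_)
        (count_embed (E' := E') hH hD x0 v))
      intro φ hφ
      obtain ⟨-, h1, h2⟩ := Finset.mem_filter.1 hφ
      refine Finset.mem_filter.2 ⟨Finset.mem_univ _, h1, ?_⟩
      intro e he
      simp only at h2
      rw [← h2] at he
      exact (Finset.mem_filter.1 he).2
    have hden := density hu2 hu hF hE hne hneF
    have hcpos : 1 ≤ Fintype.card (cliqueG E').ConnectedComponent :=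
      Fintype.card_pos_iff.2 ⟨(cliqueG E').connectedComponentMk x0⟩
    have han := analytic_bound hn hr hcpos hE' hs hp hL hpL hden
    have hcnt' : (((A (E', x0)).image emb).card : ℝ) ≤
        (n : ℝ) ^ (Fintype.card (cliqueG E').ConnectedComponent - 1) *
          (1 + r * D) ^ (r * r) := by exact_mod_cast hcnt
    calc (((A (E', x0)).image emb).card : ℝ) * p ^ (F.card - E'.card)
        ≤ ((n : ℝ) ^ (Fintype.card (cliqueG E').ConnectedComponent - 1) *
          (1 + r * D) ^ (r * r)) * p ^ (F.card - E'.card) := by gcongr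
      _ = (1 + r * D) ^ (r * r) * ((n : ℝ) ^
          (Fintype.card (cliqueG E').ConnectedComponent - 1) * p ^ (F.card - E'.card)) := by ring
      _ ≤ K := by rw [hK]; gcongr
  have hpos : ∀ i : FE n, 0 ≤ p ^ (i.2 \ R).card := fun i => by positivity
  calc ∑ i ∈ X, p ^ (i.2 \ R).card
      ≤ ∑ i ∈ P.biUnion (fun x => (A x).image emb), p ^ (i.2 \ R).card :=
        Finset.sum_le_sum_of_subset_of_nonneg hcover (fun i _ _ => hpos i)
    _ ≤ ∑ x ∈ P, ∑ i ∈ (A x).image emb, p ^ (i.2 \ R).card := by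
        have hgen : ∀ P' : Finset (Finset (Finset (Fin r)) × Fin r),
          ∑ i ∈ P'.biUnion (fun x => (A x).image emb), p ^ (i.2 \ R).card ≤
            ∑ x ∈ P', ∑ i ∈ (A x).image emb, p ^ (i.2 \ R).card := by
          intro P'
          induction P' using Finset.induction_on with
          | empty => simp
          | insert a s ha ih =>
            rw [Finset.biUnion_insert, Finset.sum_insert ha]
            have := Finset.sum_union_inter (s₁ := (A a).image emb)
              (s₂ := s.biUnion (fun x => (A x).image emb)) (f := fun i => p ^ (i.2 \ R).card)
            have h0 : 0 ≤ ∑ i ∈ ((A a).image emb) ∩ (s.biUnion (fun x => (A x).image emb)),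
              p ^ (i.2 \ R).card := Finset.sum_nonneg fun i _ => hpos i
            linarith
        exact hgen P
    _ ≤ ∑ x ∈ P, K := Finset.sum_le_sum hterm
    _ = P.card * K := by rw [Finset.sum_const, nsmul_eq_mul]
    _ ≤ (2 ^ F.card * r) * K := by
        apply mul_le_mul_of_nonneg_right _ hK0
        have : P.card ≤ 2 ^ F.card * r := by
          rw [Finset.card_product, Finset.card_univ, Fintype.card_fin]
          apply Nat.mul_le_mul_right
          rw [← Finset.card_powerset]
          exact Finset.card_filter_le _ _
        exact_mod_cast this
    _ = _ := by rw [hK]; ring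


section prob
variable {n : ℕ} {q : ℝ}

theorem bw_sum_mono {E : Type*} [Fintype E] [DecidableEq E] {C : Finset E}
    (h0 : 0 ≤ q) (h1 : q ≤ 1) (f f' : Finset E → ℝ)
    (hff : ∀ H ⊆ C, f H ≤ f' H) : ∑ H, bw C q H * f H ≤ ∑ H, bw C q H * f' H := by
  apply Finset.sum_le_sum
  intro H _
  by_cases hH : H ⊆ C
  · exact mul_le_mul_of_nonneg_left (hff H hH) (bw_nonneg h0 h1 H)
  · simp [bw, hH]

theorem deg_eq_inter {C H : Finset (FE n)} (hH : H ⊆ C) (v : Fin n) :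
    degFE H v = (H ∩ C.filter (fun h => v ∈ h.1)).card := by
  unfold degFE
  congr 1
  ext h
  simp only [Finset.mem_filter, Finset.mem_inter]
  exact ⟨fun h' => ⟨h'.1, hH h'.1, h'.2⟩, fun h' => ⟨h'.1, h'.2.2⟩⟩

theorem deg_erase_eq_inter {C H : Finset (FE n)} (hH : H ⊆ C) (v : Fin n) (h0 : FE n) :
    degFE (H.erase h0) v = (H ∩ (C.filter (fun h => v ∈ h.1)).erase h0).card := by
  unfold degFE
  congr 1
  ext h
  simp only [Finset.mem_filter, Finset.mem_inter, Finset.mem_erase]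
  exact ⟨fun h' => ⟨h'.1.2, h'.1.1, hH h'.1.2, h'.2⟩, fun h' => ⟨⟨h'.2.1, h'.1⟩, h'.2.2.2⟩⟩

theorem deg_upper (h0 : 0 ≤ q) (h1 : q ≤ 1) (C : Finset (FE n)) (D : ℕ) (v : Fin n) :
    ∑ H, bw C q H * (if D ≤ degFE H v then 1 else 0) ≤
      (1 + q) ^ (C.filter (fun h => v ∈ h.1)).card / 2 ^ D := by
  have hg := bw_gen (p := q) (C.filter (fun h => v ∈ h.1)) (Finset.filter_subset _ C) 2
  have he : (1 - q + q * 2) = 1 + q := by ring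
  rw [he] at hg
  rw [← hg, Finset.sum_div]
  simp only [mul_div_assoc]
  apply bw_sum_mono h0 h1
  intro H hH
  rw [deg_eq_inter hH]
  split_ifs with hd
  · rw [le_div_iff₀ (by positivity), one_mul]
    exact pow_le_pow_right₀ (by norm_num) hd
  · positivity

theorem deg_lower (h0 : 0 ≤ q) (h1 : q ≤ 1) (C : Finset (FE n)) (a x : ℝ)
    (hx : 0 < x) (hx1 : x ≤ 1) (v : Fin n) (h : FE n) :
    ∑ H, bw C q H * (if (degFE (H.erase h) v : ℝ) ≤ a then 1 else 0) ≤
      (1 - q + q * x) ^ ((C.filter (fun h => v ∈ h.1)).card - 1) * x ^ (-a) := by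
  have hg := bw_gen (p := q) ((C.filter (fun h => v ∈ h.1)).erase h)
    ((Finset.erase_subset _ _).trans (Finset.filter_subset _ C)) x
  have hb1 : 1 - q + q * x ≤ 1 := by nlinarith
  have hb0 : 0 ≤ 1 - q + q * x := by nlinarith
  calc ∑ H, bw C q H * (if (degFE (H.erase h) v : ℝ) ≤ a then 1 else 0)
      ≤ ∑ H, bw C q H * (x ^ (H ∩ (C.filter (fun h => v ∈ h.1)).erase h).card * x ^ (-a)) := by
        apply bw_sum_mono h0 h1
        intro H hH
        rw [deg_erase_eq_inter hH]
        split_ifs with hd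
        · rw [← Real.rpow_natCast, ← Real.rpow_add hx]
          exact Real.one_le_rpow_of_pos_of_le_one_of_nonpos hx hx1 (by linarith)
        · positivity
    _ = (1 - q + q * x) ^ ((C.filter (fun h => v ∈ h.1)).erase h).card * x ^ (-a) := by
        rw [← hg, Finset.sum_mul]
        apply Finset.sum_congr rfl
        intro H _
        ring
    _ ≤ _ := by
        apply mul_le_mul_of_nonneg_right _ (by positivity)
        apply pow_le_pow_of_le_one hb0 hb1
        exact Finset.pred_card_le_card_erase

/-- the low degree bound without erasing -/
theorem deg_lower' (h0 : 0 ≤ q) (h1 : q ≤ 1) (C : Finset (FE n)) (a x : ℝ)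
    (hx : 0 < x) (hx1 : x ≤ 1) (v : Fin n) :
    ∑ H, bw C q H * (if (degFE H v : ℝ) ≤ a then 1 else 0) ≤
      (1 - q + q * x) ^ ((C.filter (fun h => v ∈ h.1)).card - 1) * x ^ (-a) := by
  refine le_trans ?_ (deg_lower h0 h1 C a x hx hx1 v (∅, ∅))
  apply bw_sum_mono h0 h1
  intro H _
  have hle : degFE (H.erase (∅, ∅)) v ≤ degFE H v := by
    unfold degFE
    exact Finset.card_le_card (Finset.filter_subset_filter _ (Finset.erase_subset _ _))
  split_ifs with a1 a2
  · exact le_rfl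
  · exfalso
    apply a2
    exact le_trans (by exact_mod_cast hle) a1
  · norm_num
  · norm_num

/-- dense configurations -/
def DenseFE (r s : ℕ) {n : ℕ} (H : Finset (FE n)) : Prop :=
  ∃ S ⊆ H, 1 ≤ S.card ∧ S.card ≤ s ∧ (S.biUnion Prod.fst).card + 1 ≤ (r - 1) * S.card

/-- number of subconfigurations on `t` points (crude bound) -/
def cfgc (t : ℕ) : ℕ := 2 ^ (2 ^ t * 2 ^ 2 ^ t)

theorem count_dense {r k : ℕ} (hr : 1 ≤ r) {F : Finset (Finset (Fin r))} :
    ((allFEdges F n).powerset.filter (fun S => S.card = k ∧ 1 ≤ S.card ∧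
      (S.biUnion Prod.fst).card + 1 ≤ (r - 1) * k)).card ≤
      n ^ ((r - 1) * k - 1) * cfgc ((r - 1) * k - 1) := by
  set t := (r - 1) * k - 1 with ht
  let T : (Fin t → Fin n) → Finset (Fin n) := fun w => Finset.univ.image w
  let Z : (Fin t → Fin n) → Finset (Finset (FE n)) := fun w =>
    ((T w).powerset ×ˢ (T w).powerset.powerset).powerset
  have hTc : ∀ w, (T w).card ≤ t := fun w => Finset.card_image_le.trans (by simp)
  have hsub : ((allFEdges F n).powerset.filter (fun S => S.card = k ∧ 1 ≤ S.card ∧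
      (S.biUnion Prod.fst).card + 1 ≤ (r - 1) * k)) ⊆ Finset.univ.biUnion Z := by
    intro S hS
    rw [Finset.mem_filter, Finset.mem_powerset] at hS
    obtain ⟨hSC, -, hS1, hV⟩ := hS
    obtain ⟨i, hi⟩ := Finset.card_pos.1 hS1
    have hSF : ∀ i ∈ S, IsFEdge F n i := fun i hi => (Finset.mem_filter.1 (hSC hi)).2
    have hne : (S.biUnion Prod.fst).Nonempty := by
      have hc := (hSF i hi).card_fst
      obtain ⟨x, hx⟩ := Finset.card_pos.1 (show 0 < i.1.card by omega)
      exact ⟨x, Finset.mem_biUnion.2 ⟨i, hi, hx⟩⟩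
    obtain ⟨x0, -⟩ := id hne
    -- surjection
    have hex : ∃ w : Fin t → Fin n, S.biUnion Prod.fst ⊆ T w := by
      set V := S.biUnion Prod.fst with hVd
      let e := V.equivFin
      refine ⟨fun j => if hj : (j : ℕ) < V.card then (e.symm ⟨j, hj⟩ : Fin n) else x0, ?_⟩
      intro x hx
      have hlt : ((e ⟨x, hx⟩ : Fin V.card) : ℕ) < V.card := (e ⟨x, hx⟩).2
      refine Finset.mem_image.2 ⟨⟨(e ⟨x, hx⟩ : Fin V.card), by omega⟩, Finset.mem_univ _, ?_⟩
      simp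
    obtain ⟨w, hw⟩ := hex
    refine Finset.mem_biUnion.2 ⟨w, Finset.mem_univ _, ?_⟩
    rw [Finset.mem_powerset]
    intro j hj
    have hjV : j.1 ⊆ T w := (Finset.subset_biUnion_of_mem Prod.fst hj).trans hw
    rw [Finset.mem_product, Finset.mem_powerset, Finset.mem_powerset]
    refine ⟨hjV, fun e he => Finset.mem_powerset.2 (((hSF j hj).sub he).trans hjV)⟩
  refine (Finset.card_le_card hsub).trans ?_
  refine (Finset.card_biUnion_le_card_mul _ _ (cfgc t) ?_).trans ?_
  · intro w _
    simp only [Z, cfgc, Finset.card_powerset, Finset.card_product]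
    have := hTc w
    gcongr <;> norm_num
  · simp

theorem dense_prob {r s : ℕ} (hr : 1 ≤ r) {F : Finset (Finset (Fin r))}
    (h0 : 0 ≤ q) (h1 : q ≤ 1) (hn : 1 ≤ n) {L : ℝ} (hL : 1 ≤ L)
    (hqL : (n : ℝ) ^ (r - 1) * q ≤ L) :
    ∑ H, bw (allFEdges F n) q H * (if DenseFE r s H then 1 else 0) ≤
      (∑ k ∈ Finset.Icc 1 s, (cfgc ((r - 1) * k - 1) : ℝ)) * (L ^ s / n) := by
  have hn0 : (0 : ℝ) < n := by exact_mod_cast hn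
  set C := allFEdges F n with hC
  let X : ℕ → Finset (Finset (FE n)) := fun k => (C.powerset.filter (fun S => S.card = k ∧
    1 ≤ S.card ∧ (S.biUnion Prod.fst).card + 1 ≤ (r - 1) * k))
  have h2 : ∀ H ⊆ C, (if DenseFE r s H then (1 : ℝ) else 0) ≤
      ∑ k ∈ Finset.Icc 1 s, ∑ S ∈ X k, (if S ⊆ H then 1 else 0) := by
    intro H hH
    have hnn : ∀ k, (0 : ℝ) ≤ ∑ S ∈ X k, (if S ⊆ H then 1 else 0) := fun k =>
      Finset.sum_nonneg fun S _ => by split_ifs <;> norm_num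
    split_ifs with hd
    · obtain ⟨S, hS, a1, a2, a3⟩ := hd
      refine le_trans ?_ (Finset.single_le_sum (fun k _ => hnn k)
        (Finset.mem_Icc.2 ⟨a1, a2⟩ : S.card ∈ Finset.Icc 1 s))
      refine le_trans ?_ (Finset.single_le_sum (f := fun S => if S ⊆ H then (1 : ℝ) else 0)
        (fun S _ => by split_ifs <;> norm_num)
        (Finset.mem_filter.2 ⟨Finset.mem_powerset.2 (hS.trans hH), rfl, a1, a3⟩ : S ∈ X S.card))
      simp [hS]
    · exact Finset.sum_nonneg fun k _ => hnn k
  refine (bw_sum_mono h0 h1 _ _ h2).trans ?_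
  simp only [Finset.mul_sum]
  rw [Finset.sum_comm, Finset.sum_mul]
  apply Finset.sum_le_sum
  intro k hk
  rw [Finset.mem_Icc] at hk
  rw [Finset.sum_comm]
  have h3 : ∀ S ∈ X k, ∑ H, bw C q H * (if S ⊆ H then 1 else 0) = q ^ k := by
    intro S hS
    rw [Finset.mem_filter, Finset.mem_powerset] at hS
    rw [bw_contains S hS.1, hS.2.1]
  rw [Finset.sum_congr rfl h3, Finset.sum_const, nsmul_eq_mul]
  have hcnt : ((X k).card : ℝ) ≤ (n : ℝ) ^ ((r - 1) * k - 1) * cfgc ((r - 1) * k - 1) := by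
    exact_mod_cast count_dense (n := n) (k := k) hr (F := F)
  by_cases hX : (X k).card = 0
  · rw [hX]
    simp only [Nat.cast_zero, zero_mul]
    positivity
  have hpos : 1 ≤ (r - 1) * k := by
    obtain ⟨S, hS⟩ := Finset.card_pos.1 (Nat.pos_of_ne_zero hX)
    have := (Finset.mem_filter.1 hS).2.2.2
    omega
  calc ((X k).card : ℝ) * q ^ k
      ≤ ((n : ℝ) ^ ((r - 1) * k - 1) * cfgc ((r - 1) * k - 1)) * q ^ k := by gcongr
    _ = cfgc ((r - 1) * k - 1) * (((n : ℝ) ^ (r - 1) * q) ^ k / n) := by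
        have : ((n : ℝ) ^ (r - 1) * q) ^ k = (n : ℝ) ^ ((r - 1) * k - 1) * n * q ^ k := by
          rw [mul_pow, ← pow_mul, ← pow_succ]
          congr 2
          omega
        rw [this]
        field_simp
    _ ≤ cfgc ((r - 1) * k - 1) * (L ^ s / n) := by
        gcongr
        calc ((n : ℝ) ^ (r - 1) * q) ^ k ≤ L ^ k := by gcongr
          _ ≤ L ^ s := pow_le_pow_right₀ hL hk.2

/-- The bad event. -/
def BadFE (r s D : ℕ) {n : ℕ} (H : Finset (FE n)) : Prop :=
  (∃ v, D ≤ degFE H v) ∨ DenseFE r s H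

theorem bad_prob {r s D : ℕ} (hr : 1 ≤ r) {F : Finset (Finset (Fin r))}
    (h0 : 0 ≤ q) (h1 : q ≤ 1) (hn : 1 ≤ n) {L : ℝ} (hL : 1 ≤ L)
    (hqL : (n : ℝ) ^ (r - 1) * q ≤ L) {m : ℕ}
    (hm : ∀ v, ((allFEdges F n).filter (fun h => v ∈ h.1)).card ≤ m) :
    ∑ H, bw (allFEdges F n) q H * (if BadFE r s D H then 1 else 0) ≤
      n * ((1 + q) ^ m / 2 ^ D) +
      (∑ k ∈ Finset.Icc 1 s, (cfgc ((r - 1) * k - 1) : ℝ)) * (L ^ s / n) := by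
  have h2 : ∀ H ⊆ allFEdges F n, (if BadFE r s D H then (1 : ℝ) else 0) ≤
      (∑ v, (if D ≤ degFE H v then 1 else 0)) + (if DenseFE r s H then 1 else 0) := by
    intro H _
    have hnn : (0 : ℝ) ≤ ∑ v, (if D ≤ degFE H v then 1 else 0) :=
      Finset.sum_nonneg fun v _ => by split_ifs <;> norm_num
    have hnn2 : (0 : ℝ) ≤ (if DenseFE r s H then 1 else 0) := by split_ifs <;> norm_num
    split_ifs with hb hd hd
    · linarith
    · rcases hb with ⟨v, hv⟩ | hb
      · have := Finset.single_le_sum (f := fun v => if D ≤ degFE H v then (1 : ℝ) else 0)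
          (fun v _ => by split_ifs <;> norm_num) (Finset.mem_univ v)
        simp only [hv, if_true] at this
        linarith
      · exact absurd hb hd
    · linarith
    · linarith
  refine (bw_sum_mono h0 h1 _ _ h2).trans ?_
  simp only [mul_add, Finset.sum_add_distrib]
  apply add_le_add _ (dense_prob hr h0 h1 hn hL hqL)
  simp only [Finset.mul_sum]
  rw [Finset.sum_comm]
  have h3 : ∀ v ∈ (Finset.univ : Finset (Fin n)),
      ∑ H, bw (allFEdges F n) q H * (if D ≤ degFE H v then 1 else 0) ≤ (1 + q) ^ m / 2 ^ D := by
    intro v _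
    refine (deg_upper h0 h1 _ D v).trans ?_
    gcongr
    · linarith
    · exact hm v
  refine (Finset.sum_le_sum h3).trans ?_
  simp

end prob

/-! Counting the copies through a vertex. -/

theorem card_emb_hit {r n : ℕ} (hr : 1 ≤ r) (hrn : r ≤ n) (v : Fin n) :
    (Finset.univ.filter (fun φ : Fin r ↪ Fin n => v ∈ Finset.univ.map φ)).card =
      r * (n - 1).descFactorial (r - 1) := by
  have h1 := Finset.card_filter_add_card_filter_not (s := Finset.univ)
    (fun φ : Fin r ↪ Fin n => v ∈ Finset.univ.map φ)
  rw [Finset.card_univ, Fintype.card_embedding_eq, Fintype.card_fin, Fintype.card_fin] at h1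
  have h2 : (Finset.univ.filter (fun φ : Fin r ↪ Fin n => ¬ v ∈ Finset.univ.map φ)).card =
      (n - 1).descFactorial r := by
    have : Fintype.card (Fin r ↪ {w : Fin n // w ≠ v}) = (n - 1).descFactorial r := by
      rw [Fintype.card_embedding_eq, Fintype.card_fin]
      congr 1
      simp
    rw [← this, ← Finset.card_univ]
    symm
    apply Finset.card_bij (fun ψ _ => ψ.trans (Function.Embedding.subtype _))
    · intro ψ _
      simp only [Finset.mem_filter, Finset.mem_univ, true_and, Finset.mem_map, not_exists]
      intro x hx
      exact (ψ x).2 hx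
    · intro ψ _ ψ' _ h
      ext x
      have := DFunLike.congr_fun h x
      exact congrArg Fin.val this
    · intro φ hφ
      simp only [Finset.mem_filter, Finset.mem_univ, true_and, Finset.mem_map, not_exists] at hφ
      refine ⟨⟨fun x => ⟨φ x, hφ x⟩, fun x y h => φ.injective (congrArg Subtype.val h)⟩,
        Finset.mem_univ _, ?_⟩
      ext x
      rfl
  obtain ⟨k, rfl⟩ : ∃ k, r = k + 1 := ⟨r - 1, by omega⟩
  obtain ⟨m, rfl⟩ : ∃ m, n = m + 1 := ⟨n - 1, by omega⟩
  rw [h2, Nat.succ_descFactorial_succ] at h1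
  simp only [Nat.add_sub_cancel] at h1 ⊢
  rw [Nat.descFactorial_succ] at h1
  obtain ⟨l, rfl⟩ : ∃ l, m = k + l := ⟨m - k, by omega⟩
  rw [Nat.add_sub_cancel_left] at h1
  nlinarith

def embFE {r : ℕ} (F : Finset (Finset (Fin r))) {n : ℕ} (φ : Fin r ↪ Fin n) : FE n :=
  (Finset.univ.map φ, F.image (fun e => e.map φ))

theorem Mv_image {r n : ℕ} (F : Finset (Finset (Fin r))) (v : Fin n) :
    (allFEdges F n).filter (fun h => v ∈ h.1) =
      (Finset.univ.filter (fun φ : Fin r ↪ Fin n => v ∈ Finset.univ.map φ)).image (embFE F) := by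
  ext h
  simp only [allFEdges, Finset.mem_filter, Finset.mem_univ, true_and, Finset.mem_image]
  constructor
  · rintro ⟨⟨φ, h1, h2⟩, hv⟩
    exact ⟨φ, h1 ▸ hv, Prod.ext h1.symm h2.symm⟩
  · rintro ⟨φ, hv, rfl⟩
    exact ⟨⟨φ, rfl, rfl⟩, hv⟩

theorem Mv_upper {r n : ℕ} (hr : 1 ≤ r) (hrn : r ≤ n) (F : Finset (Finset (Fin r))) (v : Fin n) :
    ((allFEdges F n).filter (fun h => v ∈ h.1)).card ≤ r * n ^ (r - 1) := by
  rw [Mv_image]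
  refine Finset.card_image_le.trans ?_
  rw [card_emb_hit hr hrn]
  apply Nat.mul_le_mul_left
  exact (Nat.descFactorial_le_pow _ _).trans (Nat.pow_le_pow_left (by omega) _)

theorem Mv_lower {r n : ℕ} (hr : 1 ≤ r) (hrn : r ≤ n) (F : Finset (Finset (Fin r))) (v : Fin n) :
    r.factorial * (n - 1).choose (r - 1) ≤
      ((allFEdges F n).filter (fun h => v ∈ h.1)).card * autCard F := by
  have h1 : r.factorial * (n - 1).choose (r - 1) = r * (n - 1).descFactorial (r - 1) := by
    rw [Nat.descFactorial_eq_factorial_mul_choose, ← mul_assoc, Nat.mul_factorial_pred (by omega)]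
  rw [h1, ← card_emb_hit hr hrn v, Mv_image]
  rw [mul_comm]
  apply Finset.card_le_mul_card_image
  intro h hh
  obtain ⟨φ0, hφ0, rfl⟩ := Finset.mem_image.1 hh
  have hperm : ∀ φ : Fin r ↪ Fin n, embFE F φ = embFE F φ0 →
      ∃ σ : {σ : Equiv.Perm (Fin r) // F.image (fun e => e.image (fun x => σ x)) = F},
        ∀ x, φ x = φ0 (σ.1 x) := by
    intro φ hφ
    have e1 : Finset.univ.map φ = Finset.univ.map φ0 := congrArg Prod.fst hφ
    have e2 : F.image (fun e => e.map φ) = F.image (fun e => e.map φ0) := congrArg Prod.snd hφ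
    have hτ : ∀ x, ∃ y, φ0 y = φ x := by
      intro x
      have : φ x ∈ Finset.univ.map φ := by simp
      rw [e1] at this
      simpa using this
    choose τ hτ using hτ
    have hτi : Function.Injective τ := by
      intro x y hxy
      apply φ.injective
      rw [← hτ, ← hτ, hxy]
    let T : Equiv.Perm (Fin r) := Equiv.ofBijective τ (Finite.injective_iff_bijective.1 hτi)
    refine ⟨⟨T, ?_⟩, fun x => (hτ x).symm⟩
    apply Finset.image_injective (map_edge_inj φ0)
    rw [← e2, Finset.image_image]
    congr 1
    funext e
    simp only [Function.comp]
    ext x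
    simp only [Finset.mem_map, Finset.mem_image]
    constructor
    · rintro ⟨y, ⟨z, hz, rfl⟩, rfl⟩
      exact ⟨z, hz, (hτ z).symm⟩
    · rintro ⟨z, hz, rfl⟩
      exact ⟨T z, ⟨z, hz, rfl⟩, hτ z⟩
  unfold autCard
  rw [← Finset.card_univ]
  set A := Finset.filter (fun φ => embFE F φ = embFE F φ0)
    (Finset.univ.filter (fun φ : Fin r ↪ Fin n => v ∈ Finset.univ.map φ)) with hA
  have hex : ∀ φ : Fin r ↪ Fin n, ∃ σ : {σ : Equiv.Perm (Fin r) //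
      F.image (fun e => e.image (fun x => σ x)) = F}, φ ∈ A → ∀ x, φ x = φ0 (σ.1 x) := by
    intro φ
    by_cases hφ : φ ∈ A
    · obtain ⟨σ, hσ⟩ := hperm φ (Finset.mem_filter.1 hφ).2
      exact ⟨σ, fun _ => hσ⟩
    · exact ⟨⟨1, by simp⟩, fun h => absurd h hφ⟩
  choose f hf using hex
  apply Finset.card_le_card_of_injOn f (fun _ _ => Finset.mem_univ _)
  intro φ hφ φ' hφ' hff
  ext x
  rw [hf φ hφ, hf φ' hφ', hff]


section cplsec
set_option linter.unusedSectionVars false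
variable {E I : Type*} [DecidableEq E] [DecidableEq I] [Fintype E] [Fintype I]
variable {es : I → Finset E} {all : Finset E} {p q₀ : ℝ}

theorem Ex_le_of_Z (hp : 0 < p) (hp1 : p ≤ 1) (hq : 0 < q₀) (hq1 : q₀ ≤ 1)
    (f f' : PSt I → ℝ) (hff : ∀ σ, 0 < Zw es all p σ → f σ ≤ f' σ) (L : List I) (σ : PSt I)
    (hZ : 0 < Zw es all p σ) : Ex es all p q₀ L σ f ≤ Ex es all p q₀ L σ f' := by
  refine Ex_mono_on hp hp1 hq hq1 (fun _ σ => 0 < Zw es all p σ) ?_ ?_ ?_ ?_ ?_ f f' hff L σ hZ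
  · intro h L σ hZ hc
    have hpos := hq.trans_le hc
    rcases (Zw_nonneg (es := es) (all := all) hp hp1 (σ.yes h)).eq_or_lt with h0 | h0
    · unfold qq at hpos; rw [← h0] at hpos; simp at hpos
    · exact h0
  · intro h L σ hZ hc hlt
    have h2 := Zw_split (es := es) (all := all) (p := p) σ h
    unfold qq at hlt
    rw [div_lt_one hZ] at hlt
    linarith
  · intro h L σ hZ hc
    exact hZ
  · intro h L σ hZ hc
    exact hZ
  · intro h L σ hZ hc
    exact hZ

theorem Ex_eq_of_Z (hp : 0 < p) (hp1 : p ≤ 1) (hq : 0 < q₀) (hq1 : q₀ ≤ 1)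
    (f f' : PSt I → ℝ) (hff : ∀ σ, 0 < Zw es all p σ → f σ = f' σ) (L : List I) (σ : PSt I)
    (hZ : 0 < Zw es all p σ) : Ex es all p q₀ L σ f = Ex es all p q₀ L σ f' :=
  le_antisymm (Ex_le_of_Z hp hp1 hq hq1 f f' (fun σ h => (hff σ h).le) L σ hZ)
    (Ex_le_of_Z hp hp1 hq hq1 f' f (fun σ h => (hff σ h).ge) L σ hZ)

theorem coupling_exists (hp : 0 < p) (hp1 : p ≤ 1) (hq : 0 < q₀) (hq1 : q₀ ≤ 1)
    (es : I → Finset E) (all : Finset E) (C : Finset I) (Good : Finset E → Finset I → Prop) (b : ℝ)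
    (hb : Ex es all p q₀ C.toList ⟨∅, ∅, ∅, ∅⟩ (fun σ => ∑ G, nuw es all p σ G *
      (if Good G σ.H then 0 else 1)) ≤ b) :
    ∃ μ : PMF (Finset E × Finset I), BernoulliVia μ Prod.fst all p ∧
      BernoulliVia μ Prod.snd C q₀ ∧
      ENNReal.ofReal (1 - b) ≤ μ.toOuterMeasure {ω | Good ω.1 ω.2} := by
  set σ0 : PSt I := ⟨∅, ∅, ∅, ∅⟩ with hσ0
  have hok : ∀ G, σ0.ok es G := by
    intro G; simp [PSt.ok, PSt.R, PSt.D, hσ0]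
  have hZ1 : Zw es all p σ0 = 1 := by
    unfold Zw; simp only [hok, if_true, mul_one]; exact bw_sum
  have hZ : 0 < Zw es all p σ0 := by rw [hZ1]; norm_num
  have hnu0 : ∀ G, nuw es all p σ0 G = bw all p G := by
    intro G; unfold nuw; rw [hZ1, if_pos (hok G)]; simp
  set W : Finset E × Finset I → ℝ := fun ω =>
    Ex es all p q₀ C.toList σ0 (fun σ => nuw es all p σ ω.1 * (if σ.H = ω.2 then 1 else 0)) with hW
  have hW0 : ∀ ω, 0 ≤ W ω := by
    intro ω
    refine Ex_nonneg hp hp1 hq hq1 _ (fun σ => mul_nonneg (nuw_nonneg hp hp1 _ _) ?_) _ _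
    split_ifs <;> norm_num
  have hm1 : ∀ G, ∑ H, W (G, H) = bw all p G := by
    intro G
    rw [hW]; simp only
    rw [← Ex_sum, ← hnu0, ← Ex_nuw (es := es) (all := all) hp hp1 hq G C.toList σ0]
    congr 1; funext σ
    simp
  have hm2 : ∀ H, ∑ G, W (G, H) = bw C q₀ H := by
    intro H
    rw [hW]; simp only
    rw [← Ex_sum]
    rw [Ex_eq_of_Z hp hp1 hq hq1 _ (fun σ => if σ.H = H then 1 else 0) _ _ _ hZ]
    · rw [Ex_H hq (fun H' => if H' = H then (1:ℝ) else 0), ExH_eq _ C.nodup_toList]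
      simp [hσ0]
    · intro σ hσ
      split_ifs with h
      · simp only [mul_one]; exact nuw_sum σ hσ
      · simp
  have hsum : ∑ ω, W ω = 1 := by
    rw [Fintype.sum_prod_type]
    simp only [hm1]; exact bw_sum
  have hbadsum : ∑ ω, W ω * (if Good ω.1 ω.2 then 0 else 1) ≤ b := by
    refine le_trans (le_of_eq ?_) hb
    rw [Fintype.sum_prod_type, Ex_sum]
    apply Finset.sum_congr rfl
    intro G _
    simp only
    rw [hW]; simp only
    have : ∀ x : Finset I, Ex es all p q₀ C.toList σ0 (fun σ => nuw es all p σ G *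
        (if σ.H = x then 1 else 0)) * (if Good G x then 0 else 1) =
        Ex es all p q₀ C.toList σ0 (fun σ => (if Good G x then 0 else 1) * (nuw es all p σ G *
        (if σ.H = x then 1 else 0))) := by
      intro x; rw [Ex_smul, mul_comm]
    simp only [this]
    rw [← Ex_sum]
    congr 1; funext σ
    rw [Finset.sum_eq_single σ.H]
    · simp [mul_comm]
    · intro x _ hx; simp [hx.symm]
    · simp
  have hsumE : ∑ ω, ENNReal.ofReal (W ω) = 1 := by
    rw [← ENNReal.ofReal_sum_of_nonneg (fun ω _ => hW0 ω), hsum, ENNReal.ofReal_one]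
  have hout : ∀ S : Set (Finset E × Finset I),
      (PMF.ofFintype _ hsumE).toOuterMeasure S =
        ENNReal.ofReal (∑ ω, S.indicator W ω) := by
    intro S
    rw [PMF.toOuterMeasure_apply_fintype, ENNReal.ofReal_sum_of_nonneg]
    · apply Finset.sum_congr rfl
      intro ω _
      by_cases h : ω ∈ S <;> simp [h, Set.indicator]
    · intro ω _
      exact Set.indicator_nonneg (fun ω _ => hW0 ω) ω
  refine ⟨PMF.ofFintype _ hsumE, ?_, ?_, ?_⟩
  · intro A
    rw [hout]
    have : ∑ ω, Set.indicator {ω : Finset E × Finset I | ω.1 = A} W ω = bw all p A := by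
      rw [← hm1 A, Fintype.sum_prod_type, Finset.sum_eq_single A]
      · simp
      · intro x _ hx; simp [hx]
      · simp
    rw [this]; unfold bw
    split_ifs <;> simp
  · intro A
    rw [hout]
    have : ∑ ω, Set.indicator {ω : Finset E × Finset I | ω.2 = A} W ω = bw C q₀ A := by
      rw [← hm2 A, Fintype.sum_prod_type_right, Finset.sum_eq_single A]
      · simp
      · intro x _ hx; simp [hx]
      · simp
    rw [this]; unfold bw
    split_ifs <;> simp
  · rw [hout]
    apply ENNReal.ofReal_le_ofReal
    have : ∑ ω, Set.indicator {ω : Finset E × Finset I | Good ω.1 ω.2} W ω +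
        ∑ ω, W ω * (if Good ω.1 ω.2 then 0 else 1) = ∑ ω, W ω := by
      rw [← Finset.sum_add_distrib]
      apply Finset.sum_congr rfl
      intro ω _
      by_cases h : Good ω.1 ω.2 <;> simp [h]
    linarith

end cplsec


theorem mem_allFEdges {r n : ℕ} {F : Finset (Finset (Fin r))} {h : FE n} :
    h ∈ allFEdges F n ↔ IsFEdge F n h := by
  simp [allFEdges]

theorem nice_card_pos {r u : ℕ} {F : Finset (Finset (Fin r))} (hF : Nice u F) : 1 ≤ F.card := by
  obtain ⟨h1, ⟨h4, h3⟩, -⟩ := hF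
  rw [Nat.one_le_iff_ne_zero, ← Nat.pos_iff_ne_zero, Finset.card_pos]
  by_contra hne
  rw [Finset.not_nonempty_iff_eq_empty] at hne
  have := h3 ∅ (by simp) ⟨0, by omega⟩ ⟨1, by omega⟩ (by simp) (by simp)
  rw [hne] at this
  rcases Relation.ReflTransGen.cases_head this with h | ⟨c, ⟨e, he, -⟩, -⟩
  · simp at h
  · simp at he

/-- the error bound coming from partially covered copies -/
def Kn (r s n D : ℕ) (L : ℝ) : ℝ :=
  2 ^ s * r * (1 + r * D) ^ (r * r) * ((n : ℝ) ^ (-(1 : ℝ) / s) * L)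

theorem degFE_insert_le {n : ℕ} (H : Finset (FE n)) (h : FE n) (v : Fin n) :
    degFE (insert h H) v ≤ degFE H v + 1 := by
  unfold degFE
  rw [Finset.filter_insert]
  split_ifs
  · exact Finset.card_insert_le _ _
  · omega

theorem degFE_mono {n : ℕ} {A B : Finset (FE n)} (h : A ⊆ B) (v : Fin n) :
    degFE A v ≤ degFE B v :=
  Finset.card_le_card (Finset.filter_subset_filter _ h)

theorem BadFE_mono {r s D n : ℕ} {A B : Finset (FE n)} (h : A ⊆ B) (hA : BadFE r s D A) :
    BadFE r s D B := by
  rcases hA with ⟨v, hv⟩ | ⟨S, hS, h1⟩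
  · exact Or.inl ⟨v, hv.trans (degFE_mono h v)⟩
  · exact Or.inr ⟨S, hS.trans h, h1⟩

theorem sum_biUnion_le' {ι κ : Type*} [DecidableEq ι] (S : Finset κ) (t : κ → Finset ι)
    (f : ι → ℝ) (hf : ∀ i, 0 ≤ f i) :
    ∑ i ∈ S.biUnion t, f i ≤ ∑ v ∈ S, ∑ i ∈ t v, f i := by
  induction S using Finset.induction_on with
  | empty => simp
  | insert a S ha ih =>
    rw [Finset.biUnion_insert, Finset.sum_insert ha]
    have := Finset.sum_union_inter (s₁ := t a) (s₂ := S.biUnion t) (f := f)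
    have h2 : 0 ≤ ∑ i ∈ t a ∩ S.biUnion t, f i := Finset.sum_nonneg (fun i _ => hf i)
    linarith

set_option maxHeartbeats 2000000 in
theorem fixed_n {u r n D : ℕ} (hu2 : 2 ≤ u) (hr : 4 ≤ r) {F : Finset (Finset (Fin r))}
    (hu : ∀ e ∈ F, e.card = u) (hF : Nice u F) (hrn : r ≤ n)
    {p q θ L a x P : ℝ} (hp : 0 < p) (hp1 : p ≤ 1) (hq : 0 < q) (hq1 : q ≤ 1)
    (hqp : q = p ^ F.card * (1 - θ)) (hθ0 : 0 ≤ θ) (hθ1 : θ ≤ 1) (hL : 1 ≤ L)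
    (hpL : (n : ℝ) ^ (r - 1) * p ^ F.card ≤ L)
    (hK : r * Kn r F.card n D L ≤ θ) (hx : 0 < x) (hx1 : x ≤ 1)
    (hP : ∀ v : Fin n, (1 - q + q * x) ^ (((allFEdges F n).filter (fun h => v ∈ h.1)).card - 1)
      * x ^ (-a) ≤ P) :
    ∃ μ : PMF (Finset (Finset (Fin n)) × Finset (FE n)),
      BernoulliVia μ Prod.fst (allUEdges u n) p ∧ BernoulliVia μ Prod.snd (allFEdges F n) q ∧
      ENNReal.ofReal (1 - (n * ((1 + q) ^ (r * n ^ (r - 1)) / 2 ^ D) +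
        (∑ k ∈ Finset.Icc 1 F.card, (cfgc ((r - 1) * k - 1) : ℝ)) * (L ^ F.card / n) +
        n * ((r * L * θ + Kn r F.card n D L) * P))) ≤
      μ.toOuterMeasure {ω | (∀ h ∈ ω.2, h.2 ⊆ ω.1) ∧
                 ∀ v : Fin n, (degFE ω.2 v : ℝ) ≤ a →
                   ¬ ∃ h : FE n, IsFEdge F n h ∧ h.2 ⊆ ω.1 ∧ h ∉ ω.2 ∧ v ∈ h.1} := by
  have hs1 := nice_card_pos hF
  have hn : 1 ≤ n := by omega
  set s := F.card with hsdef
  set C := allFEdges F n with hC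
  set es : FE n → Finset (Finset (Fin n)) := fun h => h.2 ∩ allUEdges u n with hes
  have hCF : ∀ {h}, h ∈ C → IsFEdge F n h := fun h => mem_allFEdges.1 h
  have hesC : ∀ h ∈ C, es h = h.2 := by
    intro h hh
    simp only [hes, Finset.inter_eq_left]
    intro e he
    simp only [allUEdges, Finset.mem_filter, Finset.mem_univ, true_and]
    exact (hCF hh).ecard hu he
  have hbi : ∀ H ⊆ C, H.biUnion es = H.biUnion Prod.snd := fun H hH =>
    Finset.biUnion_congr rfl (fun h hh => hesC h (hH hh))
  have hK0 : 0 ≤ Kn r s n D L := by unfold Kn; positivity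
  have hps : 0 < p ^ s := by positivity
  have hPnn : n = 0 ∨ 0 ≤ P := by
    right
    have v : Fin n := ⟨0, by omega⟩
    refine le_trans ?_ (hP v)
    have : 0 ≤ 1 - q + q * x := by nlinarith [mul_pos hq hx]
    have := Real.rpow_nonneg hx.le (-a)
    positivity
  have hP0 : 0 ≤ P := hPnn.resolve_left (by omega)
  have hVgen : ∀ H ⊆ C, (∀ v, degFE H v ≤ D) → ∀ v : Fin n,
      ∑ i ∈ C.filter (fun i => v ∈ i.1 ∧ ¬ Disjoint (es i) (H.biUnion es) ∧
          ¬ es i ⊆ H.biUnion es), p ^ (es i \ H.biUnion es).card ≤ Kn r s n D L := by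
    intro H hH hD v
    have := count_lemma hu2 (by omega) hu hF.1 hs1 hn H (fun h hh => hCF (hH hh)) hD hp hL hpL v
    refine le_trans (le_of_eq ?_) this
    rw [hbi H hH]
    apply Finset.sum_congr
    · apply Finset.filter_congr
      intro i hi; rw [hesC i hi]
    · intro i hi
      rw [hesC i (Finset.mem_filter.1 hi).1]
  have hcb := coupling_bound (es := es) (all := allUEdges u n) hp hp1 hq hq1
    (fun i => Finset.inter_subset_right) C (Prod.fst : FE n → Finset (Fin n)) s
    (fun i hi => by rw [hesC i hi]; exact (hCF hi).card_snd)
    (BadFE r s D) (fun A B h hA => BadFE_mono h hA)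
    (by
      intro H hH hb i hi hiH hsub
      rw [hbi H hH, hesC i hi] at hsub
      exact hb (Or.inr (struct_lemma hu2 hu hF H (fun h hh => hCF (hH hh)) i (hCF hi) hiH hsub)))
    θ hθ1 hqp.le
    (by
      intro H hH hb h hh N hN hNs
      have hins : es h ∪ H.biUnion es = (insert h H).biUnion es := by
        rw [Finset.biUnion_insert]
      have hinsC : insert h H ⊆ C := Finset.insert_subset hh hH
      have hdeg : ∀ v, degFE (insert h H) v ≤ D := by
        intro v
        have h1 := degFE_insert_le H h v
        have h2 : ¬ D ≤ degFE H v := fun h => hb (Or.inl ⟨v, h⟩)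
        omega
      have hV := hVgen (insert h H) hinsC hdeg
      refine le_trans ?_ hK
      rw [hins]
      calc _ ≤ ∑ i ∈ h.1.biUnion (fun v => C.filter (fun i => v ∈ i.1 ∧
              ¬ Disjoint (es i) ((insert h H).biUnion es) ∧ ¬ es i ⊆ (insert h H).biUnion es)),
              p ^ (es i \ (insert h H).biUnion es).card := by
            apply Finset.sum_le_sum_of_subset_of_nonneg
            · intro i hi
              rw [Finset.mem_filter] at hi
              obtain ⟨hiN, hie⟩ := hi
              have hiC := hN hiN
              rw [Finset.not_subset] at hie
              obtain ⟨e, he, -⟩ := hie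
              rw [Finset.mem_inter] at he
              have hei : e ∈ i.2 := by rw [← hesC i hiC]; exact he.1
              have heh : e ∈ h.2 := by rw [← hesC h hh]; exact he.2
              have hec := (hCF hiC).ecard hu hei
              obtain ⟨v, hv⟩ : e.Nonempty := by rw [← Finset.card_pos]; omega
              rw [Finset.mem_biUnion]
              refine ⟨v, (hCF hh).sub heh hv, ?_⟩
              rw [Finset.mem_filter]
              refine ⟨hiC, (hCF hiC).sub hei hv, ?_, ?_⟩
              · rw [Finset.not_disjoint_iff]
                exact ⟨e, he.1, Finset.mem_biUnion.2 ⟨h, Finset.mem_insert_self _ _, he.2⟩⟩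
              · rw [← hins]; exact hNs i hiN
            · intro i _ _; positivity
        _ ≤ ∑ v ∈ h.1, ∑ i ∈ C.filter (fun i => v ∈ i.1 ∧
              ¬ Disjoint (es i) ((insert h H).biUnion es) ∧ ¬ es i ⊆ (insert h H).biUnion es),
              p ^ (es i \ (insert h H).biUnion es).card := by
            apply sum_biUnion_le'
            intro i; positivity
        _ ≤ ∑ v ∈ h.1, Kn r s n D L := Finset.sum_le_sum (fun v _ => hV v)
        _ = r * Kn r s n D L := by
            rw [Finset.sum_const, (hCF hh).card_fst, nsmul_eq_mul])
    (Kn r s n D L) hK0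
    (by
      intro H hH hb v
      refine hVgen H hH (fun v => ?_) v
      have h2 : ¬ D ≤ degFE H v := fun h => hb (Or.inl ⟨v, h⟩)
      omega)
    θ hθ0 (by rw [hqp, mul_div_cancel_left₀ _ hps.ne']; linarith)
    (fun v H => (degFE H v : ℝ) ≤ a)
    (by
      intro v H h hl
      refine le_trans ?_ hl
      exact_mod_cast degFE_mono (Finset.erase_subset _ _) v)
  set GoodC : Finset (Finset (Fin n)) → Finset (FE n) → Prop := fun G H =>
    (∀ h ∈ H, es h ⊆ G) ∧ ∀ v, (degFE H v : ℝ) ≤ a → ¬ ∃ h ∈ C, es h ⊆ G ∧ h ∉ H ∧ v ∈ h.1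
    with hGood
  obtain ⟨μ, h1, h2, h3⟩ := coupling_exists hp hp1 hq hq1 es (allUEdges u n) C GoodC _
    (le_trans (le_of_eq (by
      congr 1; funext σ
      refine Finset.sum_congr rfl fun G _ => ?_
      refine congrArg (fun z => nuw es (allUEdges u n) p σ G * z) ?_
      by_cases hg : GoodC G σ.H
      · exact (if_pos hg).trans (if_pos hg).symm
      · exact (if_neg hg).trans (if_neg hg).symm)) hcb)
  refine ⟨μ, h1, h2, ?_⟩
  have hnull : μ.toOuterMeasure {ω | ¬ ω.2 ⊆ C} = 0 := by
    have : {ω : Finset (Finset (Fin n)) × Finset (FE n) | ¬ ω.2 ⊆ C} =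
        ⋃ A ∈ {A : Finset (FE n) | ¬ A ⊆ C}, {ω | ω.2 = A} := by
      ext ω; simp
    rw [this, measure_biUnion_null_iff (Set.to_countable _)]
    intro A hA
    have := h2 A
    rw [if_neg hA] at this
    exact this
  set T : Set (Finset (Finset (Fin n)) × Finset (FE n)) := {ω | (∀ h ∈ ω.2, h.2 ⊆ ω.1) ∧
                 ∀ v : Fin n, (degFE ω.2 v : ℝ) ≤ a →
                   ¬ ∃ h : FE n, IsFEdge F n h ∧ h.2 ⊆ ω.1 ∧ h ∉ ω.2 ∧ v ∈ h.1} with hT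
  have hle : μ.toOuterMeasure {ω | GoodC ω.1 ω.2} ≤ μ.toOuterMeasure T := by
    refine le_trans (measure_mono (t := T ∪ {ω | ¬ ω.2 ⊆ C}) ?_)
      (le_trans (measure_union_le _ _) (by rw [hnull, add_zero]))
    intro ω hω
    by_cases hωC : ω.2 ⊆ C
    · left
      obtain ⟨k1, k2⟩ := hω
      refine ⟨fun h hh => by rw [← hesC h (hωC hh)]; exact k1 h hh, fun v hv => ?_⟩
      rintro ⟨h, hh, hhG, hhH, hhv⟩
      have hhC := mem_allFEdges.2 hh
      exact k2 v hv ⟨h, hhC, by rw [hesC h hhC]; exact hhG, hhH, hhv⟩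
    · right; exact hωC
  refine le_trans ?_ (h3.trans hle)
  apply ENNReal.ofReal_le_ofReal
  apply sub_le_sub_left
  have hqL : (n : ℝ) ^ (r - 1) * q ≤ L := by
    refine le_trans ?_ hpL
    rw [hqp]
    apply mul_le_mul_of_nonneg_left _ (by positivity)
    nlinarith
  have hbp := bad_prob (q := q) (s := s) (D := D) (by omega : 1 ≤ r) hq.le hq1 hn hL hqL
    (fun v => Mv_upper (by omega : 1 ≤ r) hrn F v)
  refine add_le_add hbp ?_
  have hv : ∀ v : Fin n, ((∑ h ∈ C.filter (fun h => v ∈ h.1),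
        p ^ s * (θ * ∑ H, bw C q H * (if (degFE (H.erase h) v : ℝ) ≤ a then 1 else 0))) +
      Kn r s n D L * ∑ H, bw C q H * (if (degFE H v : ℝ) ≤ a then 1 else 0)) ≤
      (r * L * θ + Kn r s n D L) * P := by
    intro v
    have e1 := (deg_lower' hq.le hq1 C a x hx hx1 v).trans (hP v)
    have e2 : ∀ h, _ := fun h => (deg_lower hq.le hq1 C a x hx hx1 v h).trans (hP v)
    have e3 : (∑ h ∈ C.filter (fun h => v ∈ h.1),
        p ^ s * (θ * ∑ H, bw C q H * (if (degFE (H.erase h) v : ℝ) ≤ a then 1 else 0))) ≤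
        (C.filter (fun h => v ∈ h.1)).card * (p ^ s * (θ * P)) := by
      rw [← nsmul_eq_mul]
      apply Finset.sum_le_card_nsmul
      intro h _
      apply mul_le_mul_of_nonneg_left _ hps.le
      exact mul_le_mul_of_nonneg_left (e2 h) hθ0
    have e4 : ((C.filter (fun h => v ∈ h.1)).card : ℝ) ≤ r * (n : ℝ) ^ (r - 1) := by
      exact_mod_cast Mv_upper (by omega : 1 ≤ r) hrn F v
    have e5 : ((C.filter (fun h => v ∈ h.1)).card : ℝ) * (p ^ s * (θ * P)) ≤ r * L * θ * P := by
      calc _ ≤ r * (n : ℝ) ^ (r - 1) * (p ^ s * (θ * P)) := by gcongr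
        _ = r * ((n : ℝ) ^ (r - 1) * p ^ s) * θ * P := by ring
        _ ≤ r * L * θ * P := by gcongr
    have e6 := mul_le_mul_of_nonneg_left e1 hK0
    linarith
  calc _ ≤ ∑ v : Fin n, (r * L * θ + Kn r s n D L) * P := Finset.sum_le_sum (fun v _ => hv v)
    _ = _ := by simp


theorem autCard_pos {r : ℕ} (F : Finset (Finset (Fin r))) : 1 ≤ autCard F := by
  unfold autCard
  rw [Nat.one_le_iff_ne_zero, ← Nat.pos_iff_ne_zero, Fintype.card_pos_iff]
  refine ⟨⟨1, ?_⟩⟩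
  simp

theorem autCard_le {r : ℕ} (F : Finset (Finset (Fin r))) : autCard F ≤ r.factorial := by
  unfold autCard
  refine (Fintype.card_subtype_le _).trans ?_
  rw [Fintype.card_perm, Fintype.card_fin]

theorem choose_lower {r n : ℕ} (hr : 1 ≤ r) (hn : 2 * r ≤ n) :
    (n : ℝ) ^ (r - 1) ≤ 2 ^ (r - 1) * (r - 1).factorial * ((n - 1).choose (r - 1) : ℝ) := by
  have h := Nat.pow_le_choose (α := ℝ) (r - 1) (n - 1)
  have hf : (0 : ℝ) < ((r - 1).factorial : ℝ) := by exact_mod_cast Nat.factorial_pos _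
  rw [div_le_iff₀ hf] at h
  have h2 : (n : ℝ) ≤ 2 * ((n - 1 + 1 - (r - 1) : ℕ) : ℝ) := by
    have : n ≤ 2 * (n - 1 + 1 - (r - 1)) := by omega
    exact_mod_cast this
  calc (n : ℝ) ^ (r - 1) ≤ (2 * ((n - 1 + 1 - (r - 1) : ℕ) : ℝ)) ^ (r - 1) := by gcongr
    _ = 2 ^ (r - 1) * ((n - 1 + 1 - (r - 1) : ℕ) : ℝ) ^ (r - 1) := by rw [mul_pow]
    _ ≤ 2 ^ (r - 1) * (((n - 1).choose (r - 1) : ℝ) * (r - 1).factorial) := by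
        gcongr
    _ = _ := by ring

/-- constant -/
def c1 (r : ℕ) : ℝ := 2 ^ (r - 1) * (r - 1).factorial

theorem c1_ge (r : ℕ) : 1 ≤ c1 r := by
  unfold c1
  have : (1 : ℝ) ≤ ((r - 1).factorial : ℝ) := by exact_mod_cast Nat.one_le_iff_ne_zero.2 (Nat.factorial_ne_zero _)
  have h2 : (1 : ℝ) ≤ 2 ^ (r - 1) := one_le_pow₀ (by norm_num)
  nlinarith

theorem P_bound (M : ℕ) {ℓ γ q δ : ℝ} (hl : 3 ≤ ℓ) (hg0 : 0 ≤ γ)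
    (hg : γ * Real.log ℓ ≤ δ / 14 * ℓ) (hq0 : 0 < q) (hq1 : q ≤ 1) (hqM : ℓ + γ ≤ q * M) :
    (1 - q + q * ℓ⁻¹) ^ (M - 1) * ℓ⁻¹ ^ (-(7 * γ)) ≤ Real.exp (2 - ℓ + δ / 2 * ℓ) := by
  have hx0 : 0 < ℓ⁻¹ := by positivity
  have hx1 : ℓ⁻¹ ≤ 1 := inv_le_one_of_one_le₀ (by linarith)
  have hxl : ℓ⁻¹ * ℓ = 1 := by field_simp
  have hMs : (M : ℝ) - 1 ≤ ((M - 1 : ℕ) : ℝ) := by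
    have : M ≤ (M - 1) + 1 := by omega
    have : (M : ℝ) ≤ ((M - 1 : ℕ) : ℝ) + 1 := by exact_mod_cast this
    linarith
  have e1 : (1 - q + q * ℓ⁻¹) ^ (M - 1) ≤ Real.exp (2 - ℓ) := by
    have h0 : 0 ≤ q * (1 - ℓ⁻¹) := mul_nonneg hq0.le (by linarith)
    calc (1 - q + q * ℓ⁻¹) ^ (M - 1) ≤ (Real.exp (-(q * (1 - ℓ⁻¹)))) ^ (M - 1) := by
          apply pow_le_pow_left₀
          · nlinarith [mul_pos hq0 hx0]
          · have := Real.add_one_le_exp (-(q * (1 - ℓ⁻¹)))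
            linarith
      _ = Real.exp (-(q * (1 - ℓ⁻¹)) * ((M - 1 : ℕ) : ℝ)) := by
          rw [← Real.exp_nat_mul, mul_comm]
      _ ≤ Real.exp (2 - ℓ) := by
          apply Real.exp_le_exp.2
          have k1 := mul_le_mul_of_nonneg_left hMs h0
          have k2 := mul_le_mul_of_nonneg_left hqM (by linarith : 0 ≤ 1 - ℓ⁻¹)
          have k3 : q * (1 - ℓ⁻¹) ≤ 1 := by nlinarith [mul_pos hq0 hx0]
          have k4 : 0 ≤ (1 - ℓ⁻¹) * γ := mul_nonneg (by linarith) hg0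
          nlinarith
  have e2 : ℓ⁻¹ ^ (-(7 * γ)) ≤ Real.exp (δ / 2 * ℓ) := by
    rw [Real.rpow_def_of_pos hx0, Real.log_inv]
    apply Real.exp_le_exp.2
    nlinarith
  calc _ ≤ Real.exp (2 - ℓ) * Real.exp (δ / 2 * ℓ) := by
        apply mul_le_mul e1 e2 (Real.rpow_nonneg hx0.le _) (Real.exp_pos _).le
    _ = _ := by rw [← Real.exp_add]

set_option maxHeartbeats 2000000 in
theorem point_n {u r n : ℕ} (hu2 : 2 ≤ u) (hr : 4 ≤ r) {F : Finset (Finset (Fin r))}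
    (hu : ∀ e ∈ F, e.card = u) (hF : Nice u F) (hrn : 2 * r ≤ n) (g : ℕ → ℝ) {δ : ℝ}
    (hδ : 0 < δ) (hδ1 : δ ≤ 1) {D : ℕ} (hl : 3 ≤ Real.log n) (hD : (Real.log n) ^ 2 ≤ D)
    (hg0 : 0 ≤ g n) (hg : g n * Real.log (Real.log n) ≤ δ / 14 * Real.log n)
    (hθ : (n : ℝ) ^ (-δ) ≤ 1 / 2) (hLn : 4 * c1 r * Real.log n ≤ n)
    (hK : r * Kn r F.card n D (4 * c1 r * Real.log n) ≤ (n : ℝ) ^ (-δ)) :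
    ∃ μ : PMF (Finset (Finset (Fin n)) × Finset (FE n)),
      BernoulliVia μ Prod.fst (allUEdges u n) (pPlus F g δ n) ∧
      BernoulliVia μ Prod.snd (allFEdges F n) (piPlus F g n) ∧
      ENNReal.ofReal (1 - (Real.exp (Real.log n + r * (4 * c1 r * Real.log n) -
          (Real.log n) ^ 2 * Real.log 2) +
        (∑ k ∈ Finset.Icc 1 F.card, (cfgc ((r - 1) * k - 1) : ℝ)) *
          ((4 * c1 r * Real.log n) ^ F.card / n) +
        (r * (4 * c1 r * Real.log n) + 1) * Real.exp (2 - δ / 2 * Real.log n))) ≤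
      μ.toOuterMeasure {ω | (∀ h ∈ ω.2, h.2 ⊆ ω.1) ∧
                 ∀ v : Fin n, (degFE ω.2 v : ℝ) ≤ 7 * g n →
                   ¬ ∃ h : FE n, IsFEdge F n h ∧ h.2 ⊆ ω.1 ∧ h ∉ ω.2 ∧ v ∈ h.1} := by
  have hs1 := nice_card_pos hF
  have hn : 1 ≤ n := by omega
  have hn0 : (0 : ℝ) < n := by exact_mod_cast hn
  set ℓ := Real.log n with hℓ
  set L := 4 * c1 r * ℓ with hLdef
  set θ := (n : ℝ) ^ (-δ) with hθdef
  set s := F.card with hs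
  have hc1 := c1_ge r
  have hL1 : 1 ≤ L := by rw [hLdef]; nlinarith
  have hθ0 : 0 < θ := Real.rpow_pos_of_pos hn0 _
  have hexpl : Real.exp ℓ = n := Real.exp_log hn0
  have hθe : θ = Real.exp (-δ * ℓ) := by
    rw [hθdef, Real.rpow_def_of_pos hn0, ← hℓ]; ring_nf
  have hloglog : 1 ≤ Real.log ℓ := by
    rw [Real.le_log_iff_exp_le (by linarith)]
    have := Real.exp_one_lt_d9
    linarith
  have hgl : g n ≤ ℓ := by nlinarith
  -- the probability
  set ch : ℝ := ((n - 1).choose (r - 1) : ℝ) with hch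
  have hch0 : 0 < ch := by
    rw [hch]; exact_mod_cast Nat.choose_pos (by omega)
  have hfac : (0 : ℝ) < (r.factorial : ℝ) := by exact_mod_cast Nat.factorial_pos _
  have haut : (1 : ℝ) ≤ (autCard F : ℝ) := by exact_mod_cast autCard_pos F
  have haut' : (autCard F : ℝ) ≤ (r.factorial : ℝ) := by exact_mod_cast autCard_le F
  set q := piPlus F g n with hq
  have hqdef : q = ((autCard F : ℝ) / (Nat.factorial r : ℝ)) * ((ℓ + g n) / ch) := rfl
  have hq0 : 0 < q := by
    rw [hqdef]
    have : 0 < ℓ + g n := by linarith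
    positivity
  have hqn : (n : ℝ) ^ (r - 1) * q ≤ 2 * c1 r * ℓ := by
    have h1 : (n : ℝ) ^ (r - 1) ≤ c1 r * ch := choose_lower (by omega) hrn
    have h2 : q ≤ 2 * ℓ / ch := by
      rw [hqdef]
      calc _ ≤ 1 * ((ℓ + g n) / ch) := by
            apply mul_le_mul_of_nonneg_right
            · rwa [div_le_one hfac]
            · apply div_nonneg _ hch0.le; linarith
        _ ≤ _ := by rw [one_mul]; gcongr; linarith
    calc _ ≤ c1 r * ch * (2 * ℓ / ch) := by gcongr
      _ = _ := by field_simp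
  set Q := q / (1 - θ) with hQ
  have hθ1 : 0 < 1 - θ := by linarith
  have hQ0 : 0 < Q := div_pos hq0 hθ1
  have hqQ : q = Q * (1 - θ) := by rw [hQ]; field_simp
  have hQ2 : Q ≤ 2 * q := by rw [hQ, div_le_iff₀ hθ1]; nlinarith
  have hQL : (n : ℝ) ^ (r - 1) * Q ≤ L := by
    calc _ ≤ (n : ℝ) ^ (r - 1) * (2 * q) := by gcongr
      _ = 2 * ((n : ℝ) ^ (r - 1) * q) := by ring
      _ ≤ 2 * (2 * c1 r * ℓ) := by gcongr
      _ = L := by rw [hLdef]; ring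
  have hQ1 : Q ≤ 1 := by
    have h1 : (n : ℝ) ≤ (n : ℝ) ^ (r - 1) :=
      le_self_pow₀ (by exact_mod_cast hn) (by omega)
    have h2 : (n : ℝ) * Q ≤ n := (mul_le_mul_of_nonneg_right h1 hQ0.le).trans (hQL.trans hLn)
    by_contra hc
    push Not at hc
    nlinarith
  have hq1 : q ≤ 1 := by rw [hqQ]; nlinarith
  set p := pPlus F g δ n with hp
  have hpdef : p = Q ^ ((1 : ℝ) / (s : ℝ)) := rfl
  have hp0 : 0 < p := by rw [hpdef]; exact Real.rpow_pos_of_pos hQ0 _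
  have hp1 : p ≤ 1 := by rw [hpdef]; exact Real.rpow_le_one hQ0.le hQ1 (div_nonneg zero_le_one (Nat.cast_nonneg _))
  have hps : p ^ s = Q := by
    rw [hpdef, one_div]; exact Real.rpow_inv_natCast_pow hQ0.le (by omega)
  have hP : ∀ v : Fin n, (1 - q + q * ℓ⁻¹) ^ (((allFEdges F n).filter (fun h => v ∈ h.1)).card - 1)
      * ℓ⁻¹ ^ (-(7 * g n)) ≤ Real.exp (2 - ℓ + δ / 2 * ℓ) := by
    intro v
    have hM := Mv_lower (by omega : 1 ≤ r) (by omega : r ≤ n) F v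
    set M := ((allFEdges F n).filter (fun h => v ∈ h.1)).card with hMdef
    have hM' : (r.factorial : ℝ) * ch ≤ M * autCard F := by rw [hch]; exact_mod_cast hM
    refine P_bound M hl hg0 hg hq0 hq1 ?_
    have : ℓ + g n = q * ((r.factorial : ℝ) * ch / autCard F) := by
      rw [hqdef]; field_simp
    rw [this]
    apply mul_le_mul_of_nonneg_left _ hq0.le
    rw [div_le_iff₀ (by linarith)]
    exact hM'
  obtain ⟨μ, h1, h2, h3⟩ := fixed_n (D := D) (q := q) (L := L) (θ := θ) hu2 hr hu hF (by omega) hp0 hp1 hq0 hq1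
    (by rw [← hs, hps]; exact hqQ) hθ0.le (by linarith) hL1 (by rw [← hs, hps]; exact hQL)
    hK (inv_pos.2 (by linarith : 0 < ℓ)) (inv_le_one_of_one_le₀ (by linarith)) hP
  refine ⟨μ, h1, h2, le_trans ?_ h3⟩
  apply ENNReal.ofReal_le_ofReal
  apply sub_le_sub_left
  refine add_le_add (add_le_add ?_ le_rfl) ?_
  · have e1 : (1 + q) ^ (r * n ^ (r - 1)) ≤ Real.exp (r * L) := by
      calc (1 + q) ^ (r * n ^ (r - 1)) ≤ (Real.exp q) ^ (r * n ^ (r - 1)) := by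
            apply pow_le_pow_left₀ (by linarith)
            have := Real.add_one_le_exp q; linarith
        _ = Real.exp (r * ((n : ℝ) ^ (r - 1) * q)) := by
            rw [← Real.exp_nat_mul]; push_cast; ring_nf
        _ ≤ _ := by
            apply Real.exp_le_exp.2
            gcongr
            refine hqn.trans ?_
            rw [hLdef]; nlinarith
    have e2 : Real.exp (ℓ ^ 2 * Real.log 2) ≤ 2 ^ D := by
      calc Real.exp (ℓ ^ 2 * Real.log 2) ≤ Real.exp (D * Real.log 2) := by
            apply Real.exp_le_exp.2
            apply mul_le_mul_of_nonneg_right hD (Real.log_nonneg (by norm_num))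
        _ = 2 ^ D := by rw [Real.exp_nat_mul, Real.exp_log (by norm_num)]
    rw [Real.exp_sub, Real.exp_add, hexpl, mul_div_assoc]
    gcongr
  · have e1 : r * L * θ + Kn r s n D L ≤ (r * L + 1) * θ := by
      have hr1 : (1 : ℝ) ≤ r := by exact_mod_cast (by omega : 1 ≤ r)
      have : Kn r s n D L ≤ θ := by
        refine le_trans ?_ hK
        have h0 : 0 ≤ Kn r s n D L := by unfold Kn; positivity
        nlinarith
      linarith
    calc _ ≤ n * ((r * L + 1) * θ * Real.exp (2 - ℓ + δ / 2 * ℓ)) := by gcongr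
      _ = (r * L + 1) * (Real.exp ℓ * Real.exp (-δ * ℓ) * Real.exp (2 - ℓ + δ / 2 * ℓ)) := by
          rw [hθe, hexpl]; ring
      _ = _ := by
          rw [← Real.exp_add, ← Real.exp_add]
          congr 2
          ring


theorem tendsto_log_nat : Tendsto (fun n : ℕ => Real.log n) atTop atTop :=
  Real.tendsto_log_atTop.comp tendsto_natCast_atTop_atTop

theorem logpow (k : ℕ) {b : ℝ} (hb : 0 < b) :
    Tendsto (fun n : ℕ => (Real.log n) ^ k * Real.exp (-b * Real.log n)) atTop (nhds 0) := by
  have h := (isLittleO_pow_exp_pos_mul_atTop k hb).tendsto_div_nhds_zero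
  have h2 := h.comp tendsto_log_nat
  refine h2.congr (fun n => ?_)
  simp only [Function.comp]
  rw [div_eq_mul_inv, ← Real.exp_neg, neg_mul]

theorem rpow_neg_eq {n : ℕ} (hn : 1 ≤ n) (b : ℝ) :
    (n : ℝ) ^ (-b) = Real.exp (-b * Real.log n) := by
  have hn0 : (0 : ℝ) < n := by exact_mod_cast hn
  rw [Real.rpow_def_of_pos hn0]; ring_nf

theorem Kn_event {r s : ℕ} (hs : 1 ≤ s) :
    ∀ᶠ n : ℕ in atTop, r * Kn r s n (⌈(Real.log n) ^ 2⌉₊) (4 * c1 r * Real.log n) ≤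
      (n : ℝ) ^ (-(1 / (2 * (s : ℝ)))) := by
  set δ : ℝ := 1 / (2 * (s : ℝ)) with hδ
  have hs0 : (0 : ℝ) < s := by exact_mod_cast hs
  have hδ0 : 0 < δ := by positivity
  set A : ℝ := r * (2 ^ s * r * (1 + 2 * r) ^ (r * r) * (4 * c1 r)) with hA
  have hlim := (logpow (2 * (r * r) + 1) hδ0).const_mul A
  rw [mul_zero] at hlim
  filter_upwards [hlim.eventually (gt_mem_nhds (zero_lt_one)), eventually_ge_atTop 1,
    tendsto_log_nat.eventually_ge_atTop 1] with n h1 hn hl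
  set ℓ := Real.log n with hℓ
  have hc1 := c1_ge r
  have hD : ((⌈ℓ ^ 2⌉₊ : ℕ) : ℝ) ≤ 2 * ℓ ^ 2 := by
    have := Nat.ceil_lt_add_one (by positivity : 0 ≤ ℓ ^ 2)
    nlinarith
  have hexp : (n : ℝ) ^ (-(1 : ℝ) / s) = (n : ℝ) ^ (-δ) * (n : ℝ) ^ (-δ) := by
    rw [← Real.rpow_add (by exact_mod_cast hn)]
    congr 1; rw [hδ]; field_simp; ring
  have hpos : 0 < (n : ℝ) ^ (-δ) := Real.rpow_pos_of_pos (by exact_mod_cast hn) _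
  have hbase : (1 + (r : ℝ) * (⌈ℓ ^ 2⌉₊ : ℕ)) ≤ (1 + 2 * r) * ℓ ^ 2 := by
    have : (r : ℝ) * (⌈ℓ ^ 2⌉₊ : ℕ) ≤ r * (2 * ℓ ^ 2) := by gcongr
    nlinarith
  unfold Kn
  rw [hexp]
  rw [← rpow_neg_eq hn] at h1
  calc _ ≤ r * (2 ^ s * r * ((1 + 2 * r) * ℓ ^ 2) ^ (r * r) *
        ((n : ℝ) ^ (-δ) * (n : ℝ) ^ (-δ) * (4 * c1 r * ℓ))) := by gcongr
    _ = A * (ℓ ^ (2 * (r * r) + 1) * (n : ℝ) ^ (-δ)) * (n : ℝ) ^ (-δ) := by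
        rw [hA, mul_pow, ← pow_mul]; ring
    _ ≤ 1 * (n : ℝ) ^ (-δ) := by gcongr
    _ = _ := one_mul _

/-- The failure probability bound. -/
def failB (r s : ℕ) (δ : ℝ) (n : ℕ) : ℝ :=
  Real.exp (Real.log n + r * (4 * c1 r * Real.log n) - (Real.log n) ^ 2 * Real.log 2) +
        (∑ k ∈ Finset.Icc 1 s, (cfgc ((r - 1) * k - 1) : ℝ)) *
          ((4 * c1 r * Real.log n) ^ s / n) +
        (r * (4 * c1 r * Real.log n) + 1) * Real.exp (2 - δ / 2 * Real.log n)

theorem failB_tendsto (r s : ℕ) {δ : ℝ} (hδ : 0 < δ) :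
    Tendsto (failB r s δ) atTop (nhds 0) := by
  have t1 : Tendsto (fun n : ℕ => Real.exp (Real.log n + r * (4 * c1 r * Real.log n) -
      (Real.log n) ^ 2 * Real.log 2)) atTop (nhds 0) := by
    apply Real.tendsto_exp_atBot.comp
    have h2 : 0 < Real.log 2 := Real.log_pos (by norm_num)
    have : Tendsto (fun y : ℝ => y * ((1 + r * (4 * c1 r)) - y * Real.log 2)) atTop atBot := by
      apply Tendsto.atTop_mul_atBot₀ tendsto_id
      apply tendsto_atBot_add_const_left
      rw [tendsto_neg_atBot_iff]
      exact tendsto_id.atTop_mul_const h2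
    refine (this.comp tendsto_log_nat).congr (fun n => ?_)
    simp only [Function.comp]; ring
  have t2 : Tendsto (fun n : ℕ => (∑ k ∈ Finset.Icc 1 s, (cfgc ((r - 1) * k - 1) : ℝ)) *
          ((4 * c1 r * Real.log n) ^ s / n)) atTop (nhds 0) := by
    have h := (logpow s one_pos).const_mul
      ((∑ k ∈ Finset.Icc 1 s, (cfgc ((r - 1) * k - 1) : ℝ)) * (4 * c1 r) ^ s)
    rw [mul_zero] at h
    refine h.congr' ?_
    filter_upwards [eventually_ge_atTop 1] with n hn
    rw [← rpow_neg_eq hn, Real.rpow_neg_one, mul_pow]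
    ring
  have t3 : Tendsto (fun n : ℕ => (r * (4 * c1 r * Real.log n) + 1) *
      Real.exp (2 - δ / 2 * Real.log n)) atTop (nhds 0) := by
    have ha := (logpow 1 (half_pos hδ)).const_mul (r * (4 * c1 r) * Real.exp 2)
    have hb := (logpow 0 (half_pos hδ)).const_mul (Real.exp 2)
    have := ha.add hb
    rw [mul_zero, mul_zero, add_zero] at this
    refine this.congr (fun n => ?_)
    rw [sub_eq_add_neg, Real.exp_add, neg_mul]
    ring
  have := (t1.add t2).add t3
  rw [add_zero, add_zero] at this
  exact this

/-- There is `δ = δ(F) > 0` such that `G = H_u(n,p₊)` and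
`H = H_F(n,π₊)` may be coupled so that whp (i) every `F`-edge of `H` is present as a
copy of `F` in `G`, and (ii) no vertex of degree at most `7g(n)` in `H` lies in an
extra copy of `F` in `G`. -/
theorem statement_6 (u r : ℕ) (hu : 2 ≤ u) (hr : 4 ≤ r)
    (F : Finset (Finset (Fin r))) (hFcard : ∀ e ∈ F, e.card = u) (hF : Nice u F)
    (g : ℕ → ℝ) (hg : GoodG g) :
    ∃ δ : ℝ, 0 < δ ∧
      ∃ μ : (n : ℕ) → PMF (Finset (Finset (Fin n)) × Finset (FE n)),
        (∀ᶠ n : ℕ in atTop,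
          BernoulliVia (μ n) Prod.fst (allUEdges u n) (pPlus F g δ n)) ∧
        (∀ᶠ n : ℕ in atTop,
          BernoulliVia (μ n) Prod.snd (allFEdges F n) (piPlus F g n)) ∧
        Tendsto (fun n => (μ n).toOuterMeasure
            {ω | (∀ h ∈ ω.2, h.2 ⊆ ω.1) ∧
                 ∀ v : Fin n, (degFE ω.2 v : ℝ) ≤ 7 * g n →
                   ¬ ∃ h : FE n, IsFEdge F n h ∧ h.2 ⊆ ω.1 ∧ h ∉ ω.2 ∧ v ∈ h.1})
          atTop (nhds 1) := by
  have hs1 := nice_card_pos hF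
  have hs0 : (1 : ℝ) ≤ (F.card : ℝ) := by exact_mod_cast hs1
  set δ : ℝ := 1 / (2 * (F.card : ℝ)) with hδ
  have hδ0 : 0 < δ := by positivity
  have hδ1 : δ ≤ 1 := by
    rw [hδ, div_le_one (by positivity)]; linarith
  refine ⟨δ, hδ0, ?_⟩
  have hev : ∀ᶠ n : ℕ in atTop, ∃ μ : PMF (Finset (Finset (Fin n)) × Finset (FE n)),
      BernoulliVia μ Prod.fst (allUEdges u n) (pPlus F g δ n) ∧
      BernoulliVia μ Prod.snd (allFEdges F n) (piPlus F g n) ∧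
      ENNReal.ofReal (1 - failB r F.card δ n) ≤
      μ.toOuterMeasure {ω | (∀ h ∈ ω.2, h.2 ⊆ ω.1) ∧
                 ∀ v : Fin n, (degFE ω.2 v : ℝ) ≤ 7 * g n →
                   ¬ ∃ h : FE n, IsFEdge F n h ∧ h.2 ⊆ ω.1 ∧ h ∉ ω.2 ∧ v ∈ h.1} := by
    have hth : Tendsto (fun n : ℕ => (n : ℝ) ^ (-δ)) atTop (nhds 0) :=
      (tendsto_rpow_neg_atTop hδ0).comp tendsto_natCast_atTop_atTop
    have hLn := (logpow 1 one_pos).const_mul (4 * c1 r)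
    rw [mul_zero] at hLn
    filter_upwards [eventually_ge_atTop (2 * r), tendsto_log_nat.eventually_ge_atTop 3,
      hg.1.eventually_ge_atTop 0, hg.2.bound (by positivity : 0 < δ / 14),
      hth.eventually (ge_mem_nhds (by norm_num : (0 : ℝ) < 1 / 2)),
      hLn.eventually (ge_mem_nhds (one_pos)), Kn_event (r := r) hs1]
      with n hn hl hg0 hgo hθ hL hK
    have hn0 : (0 : ℝ) < n := by exact_mod_cast (by omega : 0 < n)
    have hloglog : 1 ≤ Real.log (Real.log n) := by
      rw [Real.le_log_iff_exp_le (by linarith)]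
      have := Real.exp_one_lt_d9
      linarith
    refine point_n (D := ⌈(Real.log n) ^ 2⌉₊) hu hr hFcard hF hn g hδ0 hδ1 hl (Nat.le_ceil _) hg0 ?_ hθ ?_ hK
    · rw [Real.norm_of_nonneg hg0, Real.norm_of_nonneg (div_nonneg (by linarith) (by linarith)),
        ← mul_div_assoc, le_div_iff₀ (by linarith)] at hgo
      exact hgo
    · rw [← rpow_neg_eq (by omega), Real.rpow_neg_one, pow_one, ← mul_assoc,
        ← div_eq_mul_inv, div_le_one hn0] at hL
      exact hL
  set μ : (n : ℕ) → PMF (Finset (Finset (Fin n)) × Finset (FE n)) := fun n =>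
    if h : ∃ μ : PMF (Finset (Finset (Fin n)) × Finset (FE n)),
      BernoulliVia μ Prod.fst (allUEdges u n) (pPlus F g δ n) ∧
      BernoulliVia μ Prod.snd (allFEdges F n) (piPlus F g n) ∧
      ENNReal.ofReal (1 - failB r F.card δ n) ≤
      μ.toOuterMeasure {ω | (∀ h ∈ ω.2, h.2 ⊆ ω.1) ∧
                 ∀ v : Fin n, (degFE ω.2 v : ℝ) ≤ 7 * g n →
                   ¬ ∃ h : FE n, IsFEdge F n h ∧ h.2 ⊆ ω.1 ∧ h ∉ ω.2 ∧ v ∈ h.1}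
    then h.choose else PMF.pure (∅, ∅) with hμ
  have hev2 : ∀ᶠ n : ℕ in atTop, 
      BernoulliVia (μ n) Prod.fst (allUEdges u n) (pPlus F g δ n) ∧
      BernoulliVia (μ n) Prod.snd (allFEdges F n) (piPlus F g n) ∧
      ENNReal.ofReal (1 - failB r F.card δ n) ≤
      (μ n).toOuterMeasure {ω | (∀ h ∈ ω.2, h.2 ⊆ ω.1) ∧
                 ∀ v : Fin n, (degFE ω.2 v : ℝ) ≤ 7 * g n →
                   ¬ ∃ h : FE n, IsFEdge F n h ∧ h.2 ⊆ ω.1 ∧ h ∉ ω.2 ∧ v ∈ h.1} := by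
    filter_upwards [hev] with n hn
    have : μ n = hn.choose := by rw [hμ]; exact dif_pos hn
    rw [this]
    exact hn.choose_spec
  refine ⟨μ, hev2.mono fun n h => h.1, hev2.mono fun n h => h.2.1, ?_⟩
  have hlow : Tendsto (fun n => ENNReal.ofReal (1 - failB r F.card δ n)) atTop (nhds 1) := by
    have := ENNReal.tendsto_ofReal ((tendsto_const_nhds (x := (1 : ℝ))).sub
      (failB_tendsto r F.card hδ0))
    rwa [sub_zero, ENNReal.ofReal_one] at this
  refine tendsto_of_tendsto_of_tendsto_of_le_of_le' hlow tendsto_const_nhds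
    (hev2.mono fun n h => h.2.2) (Eventually.of_forall fun n => ?_)
  rw [PMF.toOuterMeasure_apply, ← (μ n).tsum_coe]
  exact ENNReal.tsum_le_tsum (fun ω => Set.indicator_le_self _ _ _)
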